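/- arXiv:2506.11359 — 2 statements merged into one kernel-verified Lean document; each statement's English description precedes it below -/
import Mathlib

section
/- If a distinct covering system has least modulus equal to 4, then its largest modulus is at least 60. -/
/-- A covering system: a finite set of congruences `x ≡ a (mod n)`, encoded as pairs
`(a, n) : ℤ × ℕ`, with positive moduli, such that every integer satisfies at least one
of the congruences. -/
def IsCoveringSystem (C : Finset (ℤ × ℕ)) : Prop :=
  (∀ c ∈ C, 0 < c.2) ∧ ∀ x : ℤ, ∃ c ∈ C, x ≡ c.1 [ZMOD (c.2 : ℤ)]

/-- The moduli of the congruences in `C` are pairwise distinct. -/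
def HasDistinctModuli (C : Finset (ℤ × ℕ)) : Prop :=
  ∀ c ∈ C, ∀ c' ∈ C, c ≠ c' → c.2 ≠ c'.2

/-- A distinct covering system: a covering system whose moduli are pairwise distinct
and all greater than `1`. -/
def IsDistinctCoveringSystem (C : Finset (ℤ × ℕ)) : Prop :=
  IsCoveringSystem C ∧ (∀ c ∈ C, 1 < c.2) ∧ HasDistinctModuli C

namespace CovSearch

/-- Evaluate `n` before passing it on (call by value for kernel reduction). -/
noncomputable def forceNat (n : ℕ) (k : ℕ → Bool) : Bool :=
  Nat.rec (motive := fun _ => Bool) (k 0) (fun i _ => k (Nat.succ i)) n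

theorem forceNat_eq (n : ℕ) (k : ℕ → Bool) : forceNat n k = k n := by
  cases n <;> rfl

/-- Remove the class `a` mod `m` from a list of points. -/
noncomputable def flt (m a : ℕ) (U : List ℕ) : List ℕ → (List ℕ → Bool) → Bool :=
  List.rec (motive := fun _ => List ℕ → (List ℕ → Bool) → Bool)
    (fun acc k => k acc)
    (fun x _ ih acc k => cond (Nat.beq (Nat.mod x m) a) (ih acc k) (ih (x :: acc) k)) U

theorem flt_eq (m a : ℕ) (U acc : List ℕ) (k : List ℕ → Bool) :
    flt m a U acc k = k ((U.filter (fun x => !(Nat.beq (x % m) a))).reverse ++ acc) := by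
  induction U generalizing acc with
  | nil => rfl
  | cons x xs ih =>
    have h : flt m a (x :: xs) acc k
      = cond (Nat.beq (x % m) a) (flt m a xs acc k) (flt m a xs (x :: acc) k) := rfl
    rw [h, ih, ih]
    cases hb : Nat.beq (x % m) a <;> simp [hb]

/-- Number of points in the class `a` mod `m`. -/
noncomputable def cnt (m a : ℕ) (U : List ℕ) : ℕ :=
  List.rec (motive := fun _ => ℕ) 0
    (fun x _ ih => cond (Nat.beq (Nat.mod x m) a) (Nat.succ ih) ih) U

theorem cnt_eq (m a : ℕ) (U : List ℕ) :
    cnt m a U = U.countP (fun x => Nat.beq (x % m) a) := by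
  induction U with
  | nil => rfl
  | cons x xs ih =>
    have h : cnt m a (x :: xs)
      = cond (Nat.beq (x % m) a) (Nat.succ (cnt m a xs)) (cnt m a xs) := rfl
    rw [h, ih, List.countP_cons]
    cases hb : Nat.beq (x % m) a <;> simp

/-- All class counts modulo `m`, packed as the base-256 digits of one number. -/
noncomputable def tally (m : ℕ) (U : List ℕ) : ℕ :=
  List.rec (motive := fun _ => ℕ) 0
    (fun x _ ih => Nat.add ih (Nat.pow 256 (Nat.mod x m))) U

/-- The base-256 digit of `N` at position `a`. -/
def dig (N a : ℕ) : ℕ := Nat.mod (Nat.div N (Nat.pow 256 a)) 256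

theorem dig_eq (N a : ℕ) : dig N a = N / 256 ^ a % 256 := rfl

theorem dig_add (N r a : ℕ) (h : dig N r < 255) :
    dig (N + 256 ^ r) a = dig N a + (if r = a then 1 else 0) := by
  rw [dig_eq] at h
  rw [dig_eq, dig_eq]
  rcases lt_trichotomy a r with hlt | rfl | hlt
  · rw [if_neg (by omega)]
    obtain ⟨d, rfl⟩ := Nat.exists_eq_add_of_lt hlt
    have e : N + 256 ^ (a + d + 1) = N + 256 ^ a * (256 * 256 ^ d) := by ring
    rw [e, Nat.add_mul_div_left _ _ (by positivity)]
    omega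
  · rw [if_pos rfl, Nat.add_div_right _ (by positivity)]
    omega
  · rw [if_neg (by omega)]
    obtain ⟨d, rfl⟩ := Nat.exists_eq_add_of_lt hlt
    have e : 256 ^ (r + d + 1) = 256 ^ r * (256 * 256 ^ d) := by ring
    rw [e, ← Nat.div_div_eq_div_mul, ← Nat.div_div_eq_div_mul, Nat.add_div_right _ (by positivity),
      ← Nat.div_div_eq_div_mul, ← Nat.div_div_eq_div_mul]
    have : (N / 256 ^ r + 1) / 256 = N / 256 ^ r / 256 := by omega
    rw [this]
    rfl

theorem dig_tally (m : ℕ) (U : List ℕ) (hU : U.length < 255) (a : ℕ) :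
    dig (tally m U) a = cnt m a U := by
  induction U generalizing a with
  | nil =>
    have h : tally m [] = 0 := rfl
    have h' : cnt m a [] = 0 := rfl
    rw [h, h', dig_eq]; simp
  | cons x xs ih =>
    have hl : xs.length < 255 := by simp at hU; omega
    have h : tally m (x :: xs) = tally m xs + 256 ^ (x % m) := rfl
    have h' : cnt m a (x :: xs)
      = cond (Nat.beq (x % m) a) (Nat.succ (cnt m a xs)) (cnt m a xs) := rfl
    have h2 : dig (tally m xs) (x % m) < 255 := by
      rw [ih hl, cnt_eq]
      exact lt_of_le_of_lt List.countP_le_length hl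
    rw [h, h', dig_add _ _ _ h2, ih hl]
    cases hb : Nat.beq (x % m) a
    · have : x % m ≠ a := Nat.ne_of_beq_eq_false hb
      simp [this]
    · have : x % m = a := Nat.eq_of_beq_eq_true hb
      simp [this]

noncomputable def lenk (U : List ℕ) : ℕ :=
  List.rec (motive := fun _ => ℕ) 0 (fun _ _ ih => Nat.succ ih) U

theorem lenk_eq (U : List ℕ) : lenk U = U.length := by
  induction U with
  | nil => rfl
  | cons x xs ih =>
    have h : lenk (x :: xs) = Nat.succ (lenk xs) := rfl
    rw [h, ih]; rfl

/-- Pass to `k` the maximum of `best` and all digits of `N` at positions `a < j`. -/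
noncomputable def maxk (N : ℕ) (j : ℕ) : ℕ → (ℕ → Bool) → Bool :=
  Nat.rec (motive := fun _ => ℕ → (ℕ → Bool) → Bool) (fun best k => k best)
    (fun a ih best k => forceNat (dig N a) (fun c => cond (Nat.ble best c) (ih c k) (ih best k))) j

theorem maxk_spec (N : ℕ) (j best : ℕ) (k : ℕ → Bool) :
    ∃ b, maxk N j best k = k b ∧ best ≤ b ∧ ∀ a < j, dig N a ≤ b := by
  induction j generalizing best with
  | zero => exact ⟨best, rfl, le_rfl, by simp⟩
  | succ j ih =>
    have h : maxk N (j + 1) best k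
      = forceNat (dig N j) (fun c => cond (Nat.ble best c) (maxk N j c k) (maxk N j best k)) :=
      rfl
    rw [h, forceNat_eq]
    cases hb : Nat.ble best (dig N j)
    · obtain ⟨b, h1, h2, h3⟩ := ih best
      refine ⟨b, by simpa using h1, h2, fun a ha => ?_⟩
      have hb' : ¬ best ≤ dig N j := fun hh => by
        rw [Nat.ble_eq_true_of_le hh] at hb; cases hb
      rcases Nat.lt_succ_iff_lt_or_eq.1 ha with h | rfl
      · exact h3 a h
      · omega
    · obtain ⟨b, h1, h2, h3⟩ := ih (dig N j)
      have hb' : best ≤ dig N j := Nat.le_of_ble_eq_true hb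
      refine ⟨b, by simpa using h1, by omega, fun a ha => ?_⟩
      rcases Nat.lt_succ_iff_lt_or_eq.1 ha with h | rfl
      · exact h3 a h
      · exact h2

/-- Pass to `k` an upper bound for the number of points that the moduli in `L` can cover. -/
noncomputable def sumk (U : List ℕ) (L : List ℕ) : ℕ → (ℕ → Bool) → Bool :=
  List.rec (motive := fun _ => ℕ → (ℕ → Bool) → Bool) (fun s k => k s)
    (fun m _ ih s k => forceNat (tally m U) (fun N =>
      maxk N m 0 (fun b => forceNat (Nat.add s b) (fun s' => ih s' k)))) L

theorem sumk_spec (U : List ℕ) (hU : U.length < 255) (P : List (ℕ × ℕ)) (hP : ∀ p ∈ P, p.2 < p.1) (s : ℕ)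
    (k : ℕ → Bool) :
    ∃ b, sumk U (P.map Prod.fst) s k = k b ∧ s + (P.map fun p => cnt p.1 p.2 U).sum ≤ b := by
  induction P generalizing s with
  | nil => exact ⟨s, rfl, by simp⟩
  | cons p P ih =>
    have h : sumk U ((p :: P).map Prod.fst) s k
      = forceNat (tally p.1 U) (fun N => maxk N p.1 0 (fun b => forceNat (Nat.add s b)
          (fun s' => sumk U (P.map Prod.fst) s' k))) := rfl
    rw [h, forceNat_eq]
    obtain ⟨b, h1, -, h3⟩ := maxk_spec (tally p.1 U) p.1 0 (fun b => forceNat (Nat.add s b)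
          (fun s' => sumk U (P.map Prod.fst) s' k))
    rw [h1, forceNat_eq]
    obtain ⟨c, h4, h5⟩ := ih (fun q hq => hP q (List.mem_cons_of_mem _ hq)) (Nat.add s b)
    refine ⟨c, h4, ?_⟩
    have := h3 p.2 (hP p List.mem_cons_self)
    rw [dig_tally _ _ hU] at this
    have h6 : Nat.add s b = s + b := rfl
    rw [h6] at h5
    simp only [List.map_cons, List.sum_cons]
    omega

noncomputable def allk (j : ℕ) (f : ℕ → Bool) : Bool :=
  Nat.rec (motive := fun _ => Bool) true (fun a ih => cond (f a) ih false) j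

theorem allk_spec (j : ℕ) (f : ℕ → Bool) (h : allk j f = true) : ∀ a < j, f a = true := by
  induction j with
  | zero => simp
  | succ j ih =>
    have e : allk (j + 1) f = cond (f j) (allk j f) false := rfl
    rw [e] at h
    intro a ha
    cases hf : f j
    · rw [hf] at h; cases h
    · rw [hf] at h
      rcases Nat.lt_succ_iff_lt_or_eq.1 ha with h' | rfl
      · exact ih h a h'
      · exact hf

/-- `check L U = true` certifies that `U` minus one point cannot be covered by one residue class
for each of the moduli in `L`. -/
noncomputable def check (L : List ℕ) : List ℕ → Bool :=
  List.rec (motive := fun _ => List ℕ → Bool)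
    (fun U => Nat.ble 2 (lenk U))
    (fun m L ih U => sumk U L 1 (fun s => forceNat (lenk U) (fun n =>
      forceNat (tally m U) (fun N => allk m (fun a =>
        cond (Nat.ble n (Nat.add (dig N a) s)) (flt m a U [] ih) true))))) L

theorem length_le (P : List (ℕ × ℕ)) (U : List ℕ) (hU : U.Nodup) (z : ℕ)
    (h : ∀ x ∈ U, x = z ∨ ∃ p ∈ P, x % p.1 = p.2) :
    U.length ≤ 1 + (P.map fun p => cnt p.1 p.2 U).sum := by
  induction P generalizing U with
  | nil =>
    have hs : U.toFinset ⊆ {z} := by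
      intro x hx
      have := h x (List.mem_toFinset.1 hx)
      simpa using this
    have := Finset.card_le_card hs
    rw [List.toFinset_card_of_nodup hU] at this
    simpa using this
  | cons p P ih =>
    have hih := ih (U.filter (fun x => !(Nat.beq (x % p.1) p.2))) (hU.filter _) (by
      intro x hx
      rw [List.mem_filter] at hx
      rcases h x hx.1 with h1 | ⟨q, hq, h2⟩
      · exact Or.inl h1
      · rcases List.mem_cons.1 hq with rfl | hq
        · simp [h2] at hx
        · exact Or.inr ⟨q, hq, h2⟩)
    have hlen := List.length_eq_countP_add_countP (fun x => Nat.beq (x % p.1) p.2) (l := U)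
    have hle : (P.map fun q => cnt q.1 q.2 (U.filter (fun x => !(Nat.beq (x % p.1) p.2)))).sum
        ≤ (P.map fun q => cnt q.1 q.2 U).sum := by
      apply List.sum_le_sum
      intro q _
      rw [cnt_eq, cnt_eq]
      exact List.Sublist.countP_le List.filter_sublist
    have h5 : (U.filter (fun x => !(Nat.beq (x % p.1) p.2))).length
        = List.countP (fun x => decide ¬ (Nat.beq (x % p.1) p.2) = true) U := by
      rw [List.countP_eq_length_filter]
      congr 2
      funext x
      cases Nat.beq (x % p.1) p.2 <;> rfl
    simp only [List.map_cons, List.sum_cons]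
    rw [cnt_eq p.1 p.2 U]
    omega

theorem check_sound (P : List (ℕ × ℕ)) (hP : ∀ p ∈ P, p.2 < p.1) (U : List ℕ) (hU : U.Nodup)
    (hl : U.length < 255) (z : ℕ) (hc : check (P.map Prod.fst) U = true) :
    ∃ x ∈ U, x ≠ z ∧ ∀ p ∈ P, x % p.1 ≠ p.2 := by
  by_contra hcon
  have hcov : ∀ x ∈ U, x = z ∨ ∃ p ∈ P, x % p.1 = p.2 := by
    intro x hx
    by_contra h
    push Not at h
    exact hcon ⟨x, hx, h.1, h.2⟩
  induction P generalizing U with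
  | nil =>
    have h : check ([].map (Prod.fst (α := ℕ) (β := ℕ))) U = Nat.ble 2 (lenk U) := rfl
    rw [h, lenk_eq] at hc
    have := Nat.le_of_ble_eq_true hc
    have h2 := length_le [] U hU z hcov
    simp at h2
    omega
  | cons p P ih =>
    have h : check ((p :: P).map Prod.fst) U
      = sumk U (P.map Prod.fst) 1 (fun s => forceNat (lenk U) (fun n =>
          forceNat (tally p.1 U) (fun N => allk p.1 (fun a =>
            cond (Nat.ble n (Nat.add (dig N a) s))
              (flt p.1 a U [] (check (P.map Prod.fst))) true)))) := rfl
    have hP' : ∀ q ∈ P, q.2 < q.1 := fun q hq => hP q (List.mem_cons_of_mem _ hq)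
    obtain ⟨b, h1, h2⟩ := sumk_spec U hl P hP' 1 (fun s => forceNat (lenk U) (fun n =>
          forceNat (tally p.1 U) (fun N => allk p.1 (fun a =>
            cond (Nat.ble n (Nat.add (dig N a) s))
              (flt p.1 a U [] (check (P.map Prod.fst))) true))))
    rw [h, h1, forceNat_eq, lenk_eq, forceNat_eq] at hc
    have h3 := allk_spec _ _ hc p.2 (hP p List.mem_cons_self)
    rw [dig_tally _ _ hl] at h3
    have h4 := length_le _ U hU z hcov
    simp only [List.map_cons, List.sum_cons] at h4
    have h5 : Nat.ble U.length (Nat.add (cnt p.1 p.2 U) b) = true := by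
      apply Nat.ble_eq_true_of_le
      have : Nat.add (cnt p.1 p.2 U) b = cnt p.1 p.2 U + b := rfl
      omega
    simp only [h5, cond_true] at h3
    rw [flt_eq, List.append_nil] at h3
    have hcov' : ∀ x ∈ (U.filter (fun x => !(Nat.beq (x % p.1) p.2))).reverse,
        x = z ∨ ∃ q ∈ P, x % q.1 = q.2 := by
      intro x hx
      rw [List.mem_reverse, List.mem_filter] at hx
      rcases hcov x hx.1 with h6 | ⟨q, hq, h6⟩
      · exact Or.inl h6
      · rcases List.mem_cons.1 hq with rfl | hq
        · simp [h6] at hx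
        · exact Or.inr ⟨q, hq, h6⟩
    refine ih hP' _ (List.nodup_reverse.2 (hU.filter _))
      (by rw [List.length_reverse]; exact lt_of_le_of_lt (List.length_filter_le _ _) hl) h3 ?_ hcov'
    rintro ⟨x, hx, hz, hq⟩
    rcases hcov' x hx with h6 | ⟨q, hq1, hq2⟩
    · exact hz h6
    · exact hq q hq1 hq2

/-- The moduli that remain for the final search. -/
def mods : List ℕ := [6, 12, 24, 24, 10, 15, 20, 30, 40]

noncomputable def topA (α u v : ℕ) : Bool :=
  flt 4 0 (List.range 120) [] fun U => flt 5 0 U [] fun U => flt 8 α U [] fun U =>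
    flt 12 u U [] fun U => flt 30 v U [] fun U => check mods U

noncomputable def topB (α v : ℕ) : Bool :=
  flt 4 0 (List.range 120) [] fun U => flt 5 0 U [] fun U => flt 8 α U [] fun U =>
    flt 15 v U [] fun U => check mods U

theorem topB_all : ∀ α < 4, ∀ v < 15, v % 3 = 0 → topB α v = true := by
  decide +kernel

theorem topA_all : ∀ α < 4, ∀ u < 12, ∀ v < 30, u % 3 = 0 → u % 6 = v % 6 →
    topA α u v = true := by
  decide +kernel
end CovSearch

namespace CovReduce

/-- Pigeonhole: an integer `x` not in the `M`-periodic set `Q` gives an injection from the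
translates `x + j * M`, `j < p`, to the moduli in `T`. -/
theorem core (a : ℕ → ℤ) (Q : ℤ → Prop) (M p : ℕ) (T : List ℕ)
    (hQ : ∀ x j : ℤ, Q (x + j * M) → Q x)
    (hcov : ∀ x, Q x ∨ ∃ n ∈ T, (n : ℤ) ∣ x - a n)
    (hT : ∀ n ∈ T, ∀ j < p, 0 < j → ¬ n ∣ j * M) (x : ℤ) (hx : ¬ Q x) :
    ∃ f : Fin p → ℕ, Function.Injective f ∧
      ∀ j, f j ∈ T ∧ (f j : ℤ) ∣ x + ((j : ℕ) : ℤ) * M - a (f j) := by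
  have h1 : ∀ j : Fin p, ∃ n ∈ T, (n : ℤ) ∣ x + ((j : ℕ) : ℤ) * M - a n := by
    intro j
    rcases hcov (x + ((j : ℕ) : ℤ) * M) with h | h
    · exact absurd (hQ _ _ h) hx
    · exact h
  choose f hf1 hf2 using h1
  have key : ∀ i j : Fin p, (i : ℕ) < j → f i ≠ f j := by
    intro i j hij he
    have e1 := hf2 i
    have e2 := hf2 j
    rw [he] at e1
    have e3 := dvd_sub e2 e1
    have e4 : x + ((j : ℕ) : ℤ) * M - a (f j) - (x + ((i : ℕ) : ℤ) * M - a (f j))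
        = (((j : ℕ) - (i : ℕ) : ℕ) * M : ℕ) := by
      push_cast [Nat.cast_sub hij.le]
      ring
    rw [e4, Int.natCast_dvd_natCast] at e3
    exact hT _ (hf1 j) ((j : ℕ) - i) (by omega) (by omega) e3
  refine ⟨f, ?_, fun j => ⟨hf1 j, hf2 j⟩⟩
  intro i j he
  rcases lt_trichotomy (i : ℕ) j with h | h | h
  · exact absurd he (key i j h)
  · exact Fin.ext h
  · exact absurd he.symm (key j i h)

theorem exact_case (a : ℕ → ℤ) (Q : ℤ → Prop) (M p : ℕ) (T : List ℕ)
    (hQ : ∀ x j : ℤ, Q (x + j * M) → Q x)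
    (hcov : ∀ x, Q x ∨ ∃ n ∈ T, (n : ℤ) ∣ x - a n)
    (hT : ∀ n ∈ T, ∀ j < p, 0 < j → ¬ n ∣ j * M) (hlen : T.length ≤ p)
    (x : ℤ) (hx : ¬ Q x) (n : ℕ) (hn : n ∈ T) (g : ℤ) (hgn : g ∣ n) (hgM : g ∣ M) :
    g ∣ x - a n := by
  obtain ⟨f, hf, hf'⟩ := core a Q M p T hQ hcov hT x hx
  have h1 : Finset.univ.image f = T.toFinset := by
    apply Finset.eq_of_subset_of_card_le
    · intro y hy
      obtain ⟨j, -, rfl⟩ := Finset.mem_image.1 hy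
      exact List.mem_toFinset.2 (hf' j).1
    · rw [Finset.card_image_of_injective _ hf, Finset.card_univ, Fintype.card_fin]
      exact (List.toFinset_card_le T).trans hlen
  have h2 : n ∈ Finset.univ.image f := by rw [h1]; exact List.mem_toFinset.2 hn
  obtain ⟨j, -, rfl⟩ := Finset.mem_image.1 h2
  have h3 := dvd_sub (hgn.trans (hf' j).2) (dvd_mul_of_dvd_right hgM ((j : ℕ) : ℤ))
  have e : x + ((j : ℕ) : ℤ) * M - a (f j) - ((j : ℕ) : ℤ) * M = x - a (f j) := by ring
  rwa [e] at h3

theorem periodic (a : ℕ → ℤ) (L : List ℕ) (M : ℕ) (hL : ∀ n ∈ L, n ∣ M) (x j : ℤ)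
    (h : ∃ n ∈ L, (n : ℤ) ∣ x + j * M - a n) : ∃ n ∈ L, (n : ℤ) ∣ x - a n := by
  obtain ⟨n, hn, hd⟩ := h
  refine ⟨n, hn, ?_⟩
  have h3 := dvd_sub hd (dvd_mul_of_dvd_right (Int.natCast_dvd_natCast.2 (hL n hn)) j)
  have e : x + j * M - a n - j * M = x - a n := by ring
  rwa [e] at h3

theorem drop (a : ℕ → ℤ) (L : List ℕ) (M p : ℕ)
    (hcov : ∀ x, ∃ n ∈ L, (n : ℤ) ∣ x - a n)
    (hT : ∀ n ∈ L, ¬ n ∣ M → ∀ j < p, 0 < j → ¬ n ∣ j * M)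
    (hlen : (L.filter (fun n => ¬ n ∣ M)).length < p) :
    ∀ x, ∃ n ∈ L.filter (fun n => n ∣ M), (n : ℤ) ∣ x - a n := by
  intro x
  by_contra hx
  obtain ⟨f, hf, hf'⟩ := core a (fun x => ∃ n ∈ L.filter (fun n => n ∣ M), (n : ℤ) ∣ x - a n) M p
    (L.filter (fun n => ¬ n ∣ M)) (fun x j => periodic a _ M (by simp) x j)
    (by
      intro x
      obtain ⟨n, hn, hd⟩ := hcov x
      by_cases h : n ∣ M
      · exact Or.inl ⟨n, by simp [hn, h], hd⟩
      · exact Or.inr ⟨n, by simp [hn, h], hd⟩)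
    (by
      intro n hn
      simp only [List.mem_filter, decide_eq_true_eq] at hn
      exact hT n hn.1 hn.2) x hx
  have h1 : Finset.univ.image f ⊆ (L.filter (fun n => ¬ n ∣ M)).toFinset := by
    intro y hy
    obtain ⟨j, -, rfl⟩ := Finset.mem_image.1 hy
    exact List.mem_toFinset.2 (hf' j).1
  have h2 := Finset.card_le_card h1
  rw [Finset.card_image_of_injective _ hf, Finset.card_univ, Fintype.card_fin] at h2
  have := List.toFinset_card_le (L.filter (fun n => ¬ n ∣ M))
  omega

/-- Drop in turn, for each pair `(q, p)` with `q` a power of the prime `p`, the moduli divisible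
by `q`. -/
def steps : List (ℕ × ℕ) := [(59, 59), (53, 53), (47, 47), (43, 43), (41, 41), (37, 37), (31, 31),
  (29, 29), (23, 23), (19, 19), (17, 17), (13, 13), (11, 11), (49, 7), (25, 5), (27, 3), (32, 2)]

def theM (L : List ℕ) (q : ℕ) : ℕ := (L.filter (fun n => ¬ q ∣ n)).foldr Nat.lcm 1

def runSteps : List (ℕ × ℕ) → List ℕ → List ℕ
  | [], L => L
  | s :: S, L => runSteps S (L.filter (fun n => n ∣ theM L s.1))

def okSteps : List (ℕ × ℕ) → List ℕ → Bool
  | [], _ => true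
  | s :: S, L =>
    decide (∀ n ∈ L, ¬ n ∣ theM L s.1 → ∀ j < s.2, 0 < j → ¬ n ∣ j * theM L s.1) &&
    decide ((L.filter (fun n => ¬ n ∣ theM L s.1)).length < s.2) &&
    okSteps S (L.filter (fun n => n ∣ theM L s.1))

theorem dropAll (a : ℕ → ℤ) (S : List (ℕ × ℕ)) (L : List ℕ)
    (hcov : ∀ x, ∃ n ∈ L, (n : ℤ) ∣ x - a n) (hok : okSteps S L = true) :
    ∀ x, ∃ n ∈ runSteps S L, (n : ℤ) ∣ x - a n := by
  induction S generalizing L with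
  | nil => exact hcov
  | cons s S ih =>
    simp only [okSteps, Bool.and_eq_true, decide_eq_true_eq] at hok
    exact ih _ (drop a L _ s.2 hcov hok.1.1 hok.1.2) hok.2

theorem ok_all : okSteps steps (List.range' 4 56) = true := by decide +kernel

theorem run_all : runSteps steps (List.range' 4 56) =
    [4, 5, 6, 7, 8, 9, 10, 12, 14, 15, 16, 18, 20, 21, 24, 28, 30, 35, 36, 40, 42, 45, 48, 56] := by
  decide +kernel

/-- The moduli `7, 14, 21, 28, 35, 42, 56` can be replaced by one class modulo `120`. -/
theorem seven (a : ℕ → ℤ) (hcov : ∀ x, ∃ n ∈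
    [4, 5, 6, 7, 8, 9, 10, 12, 14, 15, 16, 18, 20, 21, 24, 28, 30, 35, 36, 40, 42, 45, 48, 56],
      ((n : ℕ) : ℤ) ∣ x - a n) :
    ∃ b : ℤ, ∀ x, (∃ n ∈ [4, 5, 6, 8, 9, 10, 12, 15, 16, 18, 20, 24, 30, 36, 40, 45, 48],
      ((n : ℕ) : ℤ) ∣ x - a n) ∨ 120 ∣ x - b := by
  by_cases h : ∃ x0 : ℤ, ¬ ∃ n ∈ [4, 5, 6, 8, 9, 10, 12, 15, 16, 18, 20, 24, 30, 36, 40, 45, 48],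
      ((n : ℕ) : ℤ) ∣ x0 - a n
  · obtain ⟨x0, hx0⟩ := h
    refine ⟨x0, fun x => ?_⟩
    by_contra hx
    obtain ⟨hx, hx'⟩ := not_or.1 hx
    have key := exact_case a (fun x => ∃ n ∈
      [4, 5, 6, 8, 9, 10, 12, 15, 16, 18, 20, 24, 30, 36, 40, 45, 48],
      ((n : ℕ) : ℤ) ∣ x - a n) 720 7 [7, 14, 21, 28, 35, 42, 56]
      (fun x j => periodic a _ 720 (by decide) x j)
      (by
        intro x
        obtain ⟨n, hn, hd⟩ := hcov x
        by_cases h7 : n ∈ [7, 14, 21, 28, 35, 42, 56]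
        · exact Or.inr ⟨n, h7, hd⟩
        · refine Or.inl ⟨n, ?_, hd⟩
          simp only [List.mem_cons, List.not_mem_nil, or_false] at hn h7 ⊢
          omega)
      (by decide) (by decide)
    have k1 := key x hx 56 (by decide) 8 (by norm_num) (by norm_num)
    have k2 := key x hx 35 (by decide) 5 (by norm_num) (by norm_num)
    have k3 := key x hx 21 (by decide) 3 (by norm_num) (by norm_num)
    have k4 := key x0 hx0 56 (by decide) 8 (by norm_num) (by norm_num)
    have k5 := key x0 hx0 35 (by decide) 5 (by norm_num) (by norm_num)
    have k6 := key x0 hx0 21 (by decide) 3 (by norm_num) (by norm_num)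
    omega
  · push Not at h
    exact ⟨0, fun x => Or.inl (h x)⟩

/-- The moduli `16, 48` can be replaced by one class modulo `24`. -/
theorem sixteen (a : ℕ → ℤ) (b : ℤ)
    (hcov : ∀ x, (∃ n ∈ [4, 5, 6, 8, 9, 10, 12, 15, 16, 18, 20, 24, 30, 36, 40, 45, 48],
      ((n : ℕ) : ℤ) ∣ x - a n) ∨ 120 ∣ x - b) :
    ∃ c : ℤ, ∀ x, ((∃ n ∈ [4, 5, 6, 8, 9, 10, 12, 15, 18, 20, 24, 30, 36, 40, 45],
      ((n : ℕ) : ℤ) ∣ x - a n) ∨ 120 ∣ x - b) ∨ 24 ∣ x - c := by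
  by_cases h : ∃ x0 : ℤ, ¬ ((∃ n ∈ [4, 5, 6, 8, 9, 10, 12, 15, 18, 20, 24, 30, 36, 40, 45],
      ((n : ℕ) : ℤ) ∣ x0 - a n) ∨ 120 ∣ x0 - b)
  · obtain ⟨x0, hx0⟩ := h
    refine ⟨x0, fun x => ?_⟩
    by_contra hx
    obtain ⟨hx, hx'⟩ := not_or.1 hx
    have key := exact_case a (fun x => (∃ n ∈
      [4, 5, 6, 8, 9, 10, 12, 15, 18, 20, 24, 30, 36, 40, 45],
      ((n : ℕ) : ℤ) ∣ x - a n) ∨ 120 ∣ x - b) 360 2 [16, 48]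
      (fun x j hh => by
        rcases hh with hh | hh
        · exact Or.inl (periodic a _ 360 (by decide) x j hh)
        · right; push_cast at hh; omega)
      (by
        intro x
        rcases hcov x with ⟨n, hn, hd⟩ | hd
        · by_cases h7 : n ∈ [16, 48]
          · exact Or.inr ⟨n, h7, hd⟩
          · refine Or.inl (Or.inl ⟨n, ?_, hd⟩)
            simp only [List.mem_cons, List.not_mem_nil, or_false] at hn h7 ⊢
            omega
        · exact Or.inl (Or.inr hd))
      (by decide) (by decide)
    have k1 := key x hx 48 (by decide) 24 (by norm_num) (by norm_num)
    have k4 := key x0 hx0 48 (by decide) 24 (by norm_num) (by norm_num)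
    omega
  · push Not at h
    exact ⟨0, fun x => Or.inl (by
      by_contra hh
      exact (h x).elim (fun h1 => hh (Or.inl h1)) (fun h1 => hh (Or.inr h1)))⟩

/-- If three translates of `x` are covered by classes modulo `9, 18, 36, 45`. -/
def Tri (p q r s x : ℤ) : Prop :=
  (9 ∣ x - p ∨ 18 ∣ x - q ∨ 36 ∣ x - r ∨ 45 ∣ x - s) ∧
  (9 ∣ x + 120 - p ∨ 18 ∣ x + 120 - q ∨ 36 ∣ x + 120 - r ∨ 45 ∣ x + 120 - s) ∧
  (9 ∣ x + 240 - p ∨ 18 ∣ x + 240 - q ∨ 36 ∣ x + 240 - r ∨ 45 ∣ x + 240 - s)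

theorem tri_five (p q r s x : ℤ) (h : Tri p q r s x) (h5 : ¬ 5 ∣ x - s) :
    3 ∣ x - p ∧ 3 ∣ x - q ∧ 3 ∣ x - r ∧ 2 ∣ x - q ∧ 4 ∣ x - r ∧
    ¬ 9 ∣ p - q ∧ ¬ 9 ∣ p - r ∧ ¬ 9 ∣ q - r := by
  obtain ⟨h1, h2, h3⟩ := h
  rcases h1 with h1 | h1 | h1 | h1 <;> rcases h2 with h2 | h2 | h2 | h2 <;>
    rcases h3 with h3 | h3 | h3 | h3 <;> omega

theorem tri_three (p q r s x y : ℤ) (h : Tri p q r s x) (h' : Tri p q r s y) : 3 ∣ x - y := by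
  obtain ⟨h1, h2, h3⟩ := h
  obtain ⟨g1, g2, g3⟩ := h'
  have hx : (3 ∣ x - p ∧ 3 ∣ x - q) ∨ (3 ∣ x - p ∧ 3 ∣ x - r) ∨ (3 ∣ x - q ∧ 3 ∣ x - r) := by
    rcases h1 with h1 | h1 | h1 | h1 <;> rcases h2 with h2 | h2 | h2 | h2 <;>
      rcases h3 with h3 | h3 | h3 | h3 <;> omega
  have hy : (3 ∣ y - p ∧ 3 ∣ y - q) ∨ (3 ∣ y - p ∧ 3 ∣ y - r) ∨ (3 ∣ y - q ∧ 3 ∣ y - r) := by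
    rcases g1 with h1 | h1 | h1 | h1 <;> rcases g2 with h2 | h2 | h2 | h2 <;>
      rcases g3 with h3 | h3 | h3 | h3 <;> omega
  omega

theorem tri_A (p q r s x y : ℤ) (h : Tri p q r s x) (h5 : ¬ 5 ∣ x - s) (h' : Tri p q r s y) :
    12 ∣ y - x ∨ (6 ∣ y - x ∧ 5 ∣ y - s) := by
  have h3 := tri_three p q r s x y h h'
  obtain ⟨k1, k2, k3, k4, k5, k6, k7, k8⟩ := tri_five p q r s x h h5
  by_cases hy : 5 ∣ y - s
  · obtain ⟨g1, g2, g3⟩ := h'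
    have : 2 ∣ y - q ∨ 4 ∣ y - r := by
      clear h3 k1 k2 k3 k4 k5 h5 hy
      rcases g1 with h1 | h1 | h1 | h1 <;> rcases g2 with h2 | h2 | h2 | h2 <;>
        rcases g3 with h3 | h3 | h3 | h3 <;> omega
    omega
  · have := tri_five p q r s y h' hy
    omega

/-- The moduli `9, 18, 36, 45` can be replaced by two classes modulo `12` and `30` which agree
modulo `6`, or by one class modulo `15`. -/
theorem nine (a : ℕ → ℤ) (Q : ℤ → Prop) (hQ : ∀ x j : ℤ, Q (x + j * 120) → Q x)
    (hcov : ∀ x, Q x ∨ 9 ∣ x - a 9 ∨ 18 ∣ x - a 18 ∨ 36 ∣ x - a 36 ∨ 45 ∣ x - a 45) :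
    (∃ u v : ℤ, 6 ∣ u - v ∧ ∀ x, Q x ∨ 12 ∣ x - u ∨ 30 ∣ x - v) ∨
    (∃ u : ℤ, ∀ x, Q x ∨ 15 ∣ x - u) := by
  have htri : ∀ x, ¬ Q x → Tri (a 9) (a 18) (a 36) (a 45) x := by
    intro x hx
    refine ⟨(hcov x).resolve_left hx, (hcov (x + 120)).resolve_left fun h => hx ?_,
      (hcov (x + 240)).resolve_left fun h => hx ?_⟩
    · exact hQ x 1 (by simpa using h)
    · exact hQ x 2 (by norm_num; exact h)
  by_cases h : ∃ x0, ¬ Q x0 ∧ ¬ 5 ∣ x0 - a 45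
  · obtain ⟨x0, h0, h5⟩ := h
    left
    refine ⟨x0, 25 * x0 + 6 * a 45, by omega, fun x => ?_⟩
    by_cases hx : Q x
    · exact Or.inl hx
    · have := tri_A _ _ _ _ x0 x (htri x0 h0) h5 (htri x hx)
      omega
  · push Not at h
    right
    by_cases h1 : ∃ x0, ¬ Q x0
    · obtain ⟨x0, h0⟩ := h1
      refine ⟨x0, fun x => ?_⟩
      by_cases hx : Q x
      · exact Or.inl hx
      · have e1 := tri_three _ _ _ _ x x0 (htri x hx) (htri x0 h0)
        have e2 := h x hx
        have e3 := h x0 h0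
        omega
    · push Not at h1
      exact ⟨0, fun x => Or.inl (h1 x)⟩

theorem mem_flt {m a x : ℕ} {U : List ℕ} :
    x ∈ (U.filter (fun x => !(Nat.beq (x % m) a))).reverse ++ [] ↔ x ∈ U ∧ x % m ≠ a := by
  have : (x % m).beq a = false ↔ ¬ x % m = a := by
    rw [← Bool.not_eq_true, Nat.beq_eq]
  simp [this]

theorem nodup_flt {m a : ℕ} {U : List ℕ} (h : U.Nodup) :
    ((U.filter (fun x => !(Nat.beq (x % m) a))).reverse ++ []).Nodup := by
  simpa using h.filter _

theorem len_flt {m a : ℕ} {U : List ℕ} (h : U.length < 255) :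
    ((U.filter (fun x => !(Nat.beq (x % m) a))).reverse ++ []).length < 255 := by
  rw [List.append_nil, List.length_reverse]
  exact lt_of_le_of_lt (List.length_filter_le _ _) h

/-- The residue of an integer as a natural number. -/
def res (z : ℤ) (m : ℕ) : ℕ := (z % m).toNat

theorem res_lt (z : ℤ) (m : ℕ) (hm : 0 < m) : res z m < m := by
  unfold res
  have := Int.emod_lt_of_pos z (show (0 : ℤ) < m by exact_mod_cast hm)
  have := Int.emod_nonneg z (show (m : ℤ) ≠ 0 by positivity)
  omega

theorem res_of_dvd (z : ℤ) (m x : ℕ) (hm : 0 < m) (h : (m : ℤ) ∣ x - z) : x % m = res z m := by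
  unfold res
  have h1 : (x : ℤ) % m = z % m := Int.emod_eq_emod_iff_emod_sub_eq_zero.2
    (Int.emod_eq_zero_of_dvd h)
  omega

/-- The conclusion of the search, for points that survive the initial classes. -/
theorem endgame (a : ℕ → ℤ) (b c t : ℤ) (U : List ℕ) (hU : U.Nodup) (hl : U.length < 255)
    (h120 : ∀ x ∈ U, x < 120) (hc : CovSearch.check CovSearch.mods U = true) :
    ∃ x ∈ U, ¬ (120 ∣ (x + t : ℤ) - b) ∧ ¬ (24 ∣ (x + t : ℤ) - c) ∧
      ∀ n ∈ [6, 10, 12, 15, 20, 24, 30, 40], ¬ ((n : ℕ) : ℤ) ∣ (x + t : ℤ) - a n := by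
  obtain ⟨x, hx, hz, hp⟩ := CovSearch.check_sound
    [(6, res (a 6 - t) 6), (12, res (a 12 - t) 12), (24, res (a 24 - t) 24), (24, res (c - t) 24),
      (10, res (a 10 - t) 10), (15, res (a 15 - t) 15), (20, res (a 20 - t) 20),
      (30, res (a 30 - t) 30), (40, res (a 40 - t) 40)]
    (by
      intro p hp
      simp only [List.mem_cons, List.not_mem_nil, or_false] at hp
      rcases hp with rfl | rfl | rfl | rfl | rfl | rfl | rfl | rfl | rfl <;>
        exact res_lt _ _ (by norm_num)) U hU hl (res (b - t) 120) hc
  refine ⟨x, hx, fun h => hz ?_, fun h => ?_, fun n hn h => ?_⟩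
  · rw [← res_of_dvd (b - t) 120 x (by norm_num) (by push_cast; omega)]
    have := h120 x hx
    omega
  · exact hp (24, res (c - t) 24) (by simp)
      (res_of_dvd (c - t) 24 x (by norm_num) (by push_cast; omega))
  · have hmem : (n, res (a n - t) n) ∈
        [(6, res (a 6 - t) 6), (12, res (a 12 - t) 12), (24, res (a 24 - t) 24),
          (24, res (c - t) 24),
          (10, res (a 10 - t) 10), (15, res (a 15 - t) 15), (20, res (a 20 - t) 20),
          (30, res (a 30 - t) 30), (40, res (a 40 - t) 40)] ∧ 0 < n := by
      simp only [List.mem_cons, List.not_mem_nil, or_false] at hn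
      rcases hn with rfl | rfl | rfl | rfl | rfl | rfl | rfl | rfl <;> simp
    refine hp _ hmem.1 (res_of_dvd _ _ _ hmem.2 ?_)
    have e : (x : ℤ) - (a n - t) = x + t - a n := by ring
    rw [e]; exact h

theorem not_cov (a : ℕ → ℤ)
    (hcov : ∀ x, ∃ n ∈ List.range' 4 56, ((n : ℕ) : ℤ) ∣ x - a n) : False := by
  have h1 := dropAll a steps _ hcov ok_all
  rw [run_all] at h1
  obtain ⟨b, h2⟩ := seven a h1
  obtain ⟨c, h3⟩ := sixteen a b h2
  clear hcov h1 h2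
  have h4 := nine a (fun x => ((∃ n ∈ [4, 5, 6, 8, 10, 12, 15, 20, 24, 30, 40],
      ((n : ℕ) : ℤ) ∣ x - a n) ∨ 120 ∣ x - b) ∨ 24 ∣ x - c)
    (by
      intro x j h
      rcases h with (h | h) | h
      · exact Or.inl (Or.inl (periodic a _ 120 (by decide) x j h))
      · left; right; omega
      · right; omega)
    (by
      intro x
      rcases h3 x with (⟨n, hn, hd⟩ | h) | h
      · by_cases h9 : n ∈ [9, 18, 36, 45]
        · right
          simp only [List.mem_cons, List.not_mem_nil, or_false] at h9
          rcases h9 with rfl | rfl | rfl | rfl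
          · exact Or.inl hd
          · exact Or.inr (Or.inl hd)
          · exact Or.inr (Or.inr (Or.inl hd))
          · exact Or.inr (Or.inr (Or.inr hd))
        · refine Or.inl (Or.inl (Or.inl ⟨n, ?_, hd⟩))
          simp only [List.mem_cons, List.not_mem_nil, or_false] at hn h9 ⊢
          omega
      · exact Or.inl (Or.inl (Or.inr h))
      · exact Or.inl (Or.inr h))
  have hrange : (List.range 120).length < 255 := by simp
  have ht : ∀ u : ℤ, ∃ t : ℤ, 4 ∣ a 4 - t ∧ 5 ∣ a 5 - t ∧ 3 ∣ u - t ∧ res (a 8 - t) 8 < 4 := by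
    intro u
    by_cases h : res (a 8 - (45 * a 4 + 36 * a 5 + 40 * u)) 8 < 4
    · exact ⟨45 * a 4 + 36 * a 5 + 40 * u, by omega, by omega, by omega, h⟩
    · refine ⟨45 * a 4 + 36 * a 5 + 40 * u + 60, by omega, by omega, by omega, ?_⟩
      unfold res at h ⊢
      omega
  -- the classes modulo `4, 5, 8` and the remaining ones
  have fin : ∀ (t : ℤ) (x : ℕ), 4 ∣ a 4 - t → 5 ∣ a 5 - t → x % 4 ≠ 0 → x % 5 ≠ 0 →
      x % 8 ≠ res (a 8 - t) 8 → ¬ (120 ∣ (x + t : ℤ) - b) → ¬ (24 ∣ (x + t : ℤ) - c) →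
      (∀ n ∈ [6, 10, 12, 15, 20, 24, 30, 40], ¬ ((n : ℕ) : ℤ) ∣ (x + t : ℤ) - a n) →
      ¬ (((∃ n ∈ [4, 5, 6, 8, 10, 12, 15, 20, 24, 30, 40],
      ((n : ℕ) : ℤ) ∣ (x + t : ℤ) - a n) ∨ 120 ∣ (x + t : ℤ) - b) ∨ 24 ∣ (x + t : ℤ) - c) := by
    intro t x t4 t5 x4 x5 x8 hb hc hn
    rintro ((⟨n, hn', hd⟩ | h) | h)
    · by_cases h458 : n ∈ [6, 10, 12, 15, 20, 24, 30, 40]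
      · exact hn n h458 hd
      · have : n = 4 ∨ n = 5 ∨ n = 8 := by
          simp only [List.mem_cons, List.not_mem_nil, or_false] at hn' h458
          omega
        rcases this with rfl | rfl | rfl
        · push_cast at hd; omega
        · push_cast at hd; omega
        · exact x8 (res_of_dvd _ _ _ (by norm_num) (by push_cast at hd ⊢; omega))
    · exact hb h
    · exact hc h
  rcases h4 with ⟨u, v, huv, h4⟩ | ⟨u, h4⟩
  · obtain ⟨t, t4, t5, t3, t8⟩ := ht u
    have htop := CovSearch.topA_all (res (a 8 - t) 8) t8 (res (u - t) 12) (res_lt _ _ (by norm_num))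
      (res (v - t) 30) (res_lt _ _ (by norm_num)) (by unfold res; omega) (by unfold res; omega)
    unfold CovSearch.topA at htop
    simp only [CovSearch.flt_eq] at htop
    obtain ⟨x, hx, e1, e2, e3⟩ := endgame a b c t _
      (nodup_flt (nodup_flt (nodup_flt (nodup_flt (nodup_flt List.nodup_range)))))
      (len_flt (len_flt (len_flt (len_flt (len_flt hrange)))))
      (by intro x hx; simp only [mem_flt, List.mem_range] at hx; exact hx.1.1.1.1.1) htop
    simp only [mem_flt, List.mem_range] at hx
    obtain ⟨⟨⟨⟨⟨-, x4⟩, x5⟩, x8⟩, x12⟩, x30⟩ := hx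
    rcases h4 (x + t) with h | h | h
    · exact fin t x t4 t5 x4 x5 x8 e1 e2 e3 h
    · exact x12 (res_of_dvd _ _ _ (by norm_num) (by push_cast; omega))
    · exact x30 (res_of_dvd _ _ _ (by norm_num) (by push_cast; omega))
  · obtain ⟨t, t4, t5, t3, t8⟩ := ht u
    have htop := CovSearch.topB_all (res (a 8 - t) 8) t8 (res (u - t) 15) (res_lt _ _ (by norm_num))
      (by unfold res; omega)
    unfold CovSearch.topB at htop
    simp only [CovSearch.flt_eq] at htop
    obtain ⟨x, hx, e1, e2, e3⟩ := endgame a b c t _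
      (nodup_flt (nodup_flt (nodup_flt (nodup_flt List.nodup_range))))
      (len_flt (len_flt (len_flt (len_flt hrange))))
      (by intro x hx; simp only [mem_flt, List.mem_range] at hx; exact hx.1.1.1.1) htop
    simp only [mem_flt, List.mem_range] at hx
    obtain ⟨⟨⟨⟨-, x4⟩, x5⟩, x8⟩, x15⟩ := hx
    rcases h4 (x + t) with h | h
    · exact fin t x t4 t5 x4 x5 x8 e1 e2 e3 h
    · exact x15 (res_of_dvd _ _ _ (by norm_num) (by push_cast; omega))

end CovReduce

/-- If a distinct covering system has least modulus equal to `4`, then its largest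
modulus is at least `60`. -/
theorem min_modulus_four_implies_max_ge_60 (C : Finset (ℤ × ℕ))
    (hC : IsDistinctCoveringSystem C)
    (hmin : ∀ c ∈ C, 4 ≤ c.2) (h4 : ∃ c ∈ C, c.2 = 4) :
    ∃ c ∈ C, 60 ≤ c.2 := by
  classical
  by_contra hcon
  push Not at hcon
  obtain ⟨⟨-, hcov⟩, -, hdist⟩ := hC
  have hch : ∀ n : ℕ, ∃ r : ℤ, ∀ c ∈ C, c.2 = n → c.1 = r := by
    intro n
    by_cases h : ∃ c ∈ C, c.2 = n
    · obtain ⟨c, hc, rfl⟩ := h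
      refine ⟨c.1, fun d hd hdn => ?_⟩
      by_contra hne
      exact hdist d hd c hc (fun h => hne (by rw [h])) hdn
    · exact ⟨0, fun c hc hn => absurd ⟨c, hc, hn⟩ h⟩
  choose a ha using hch
  refine CovReduce.not_cov a fun x => ?_
  obtain ⟨c, hc, hx⟩ := hcov x
  refine ⟨c.2, ?_, ?_⟩
  · have := hmin c hc
    have := hcon c hc
    rw [List.mem_range'_1]
    omega
  · rw [← ha c.2 c hc rfl]
    exact (Int.modEq_iff_dvd.1 hx.symm)
end

section
/- If a distinct covering system has least modulus equal to 5, then its largest modulus is at least 108. -/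
set_option autoImplicit false

namespace CS

/-- Boolean choice with a natural number result. -/
noncomputable def pw (i : ℕ) : ℕ := Nat.pow 2 (Nat.pow 2 i)
noncomputable def allS (i : ℕ) : ℕ := Nat.sub (pw i) 1
noncomputable def allH (i : ℕ) : ℕ := Nat.shiftLeft (allS i) (Nat.pow 2 i)
/-- bits of indices below `2 ^ 20` (in binary) not containing `i`. -/
noncomputable def notS (i : ℕ) : ℕ :=
  @Nat.rec (fun _ => ℕ) 1 (fun n r =>
    @Bool.rec (fun _ => ℕ) (Nat.lor r (Nat.shiftLeft r (Nat.pow 2 n))) r (Nat.beq n i)) 20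

noncomputable def chk (f : ℕ → ℕ → ℕ) (F G : ℕ) : ℕ :=
  @Bool.rec (fun _ => ℕ) (@Bool.rec (fun _ => ℕ) (f F G) G (Nat.beq (Nat.mod F 2) 1)) 0 (Nat.beq F 0)

noncomputable def prodF (n : ℕ) : ℕ → ℕ → ℕ :=
  @Nat.rec (fun _ => ℕ → ℕ → ℕ) (fun _ G => G) (fun j ih F G =>
    @Bool.rec (fun _ => ℕ) (ih F G)
      (Nat.lor (chk ih (Nat.land F (allS j)) G)
        (Nat.shiftLeft
          (chk ih (Nat.land (Nat.shiftRight F (Nat.pow 2 j)) (Nat.xor (allS j) (Nat.land F (allS j))))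
            (Nat.land G (notS j)))
          (Nat.pow 2 j)))
      (Nat.ble (pw j) F)) n

noncomputable def prodT (l r : ℕ) : ℕ :=
  @Bool.rec (fun _ => ℕ)
    (@Bool.rec (fun _ => ℕ)
      (@Bool.rec (fun _ => ℕ)
        (@Bool.rec (fun _ => ℕ) (chk (prodF 17) r l) (chk (prodF 17) l r) (Nat.ble r l))
        l (Nat.beq (Nat.mod r 2) 1))
      0 (Nat.beq r 0))
    0 (Nat.beq l 0)

abbrev Row := List ℕ
abbrev Tab := List (List ℕ)

noncomputable def mapL {α β : Type} (f : α → β) (l : List α) : List β :=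
  @List.rec α (fun _ => List β) [] (fun a _ ih => f a :: ih) l
noncomputable def zipL {α β γ : Type} (f : α → β → γ) (l : List α) : List β → List γ :=
  @List.rec α (fun _ => List β → List γ) (fun _ => []) (fun a _ ih m =>
    @List.rec β (fun _ => List γ) [] (fun b m' _ => f a b :: ih m') m) l
noncomputable def shGo {α : Type} (l : List α) : α → List α :=
  @List.rec α (fun _ => α → List α) (fun x => [x]) (fun b _ ih _ => b :: ih b) l
noncomputable def shL {α : Type} (l : List α) : List α :=
  @List.rec α (fun _ => List α) [] (fun a m _ => shGo m a) l

noncomputable def opA (i : ℕ) (T : Tab) : Tab := mapL (mapL (fun x => Nat.lor x (allH i))) T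
noncomputable def sho (i x y : ℕ) : ℕ := Nat.lor x (Nat.shiftLeft y (Nat.pow 2 i))
noncomputable def opC (i : ℕ) (T : Tab) : Tab := zipL (zipL (sho i)) T (shL T)
noncomputable def opD (i : ℕ) (T : Tab) : Tab := mapL (fun r => zipL (sho i) r (shL r)) T
/-- item type: 0 = whole fibre, 1 = column, 2 = row -/
noncomputable def op (t i : ℕ) (T : Tab) : Tab :=
  @Nat.rec (fun _ => Tab) (opA i T) (fun s _ => @Nat.rec (fun _ => Tab) (opC i T) (fun _ _ => opD i T) s) t
noncomputable def fixOp (z t : ℕ) (T : Tab) : Tab :=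
  @Nat.rec (fun _ => Tab) (mapL (mapL (fun _ => allS z)) T)
    (fun s _ => @Nat.rec (fun _ => Tab) (shL T) (fun _ _ => mapL shL T) s) t

noncomputable def ops (I : List (ℕ × ℕ)) (T : Tab) : Tab :=
  @List.rec (ℕ × ℕ) (fun _ => Tab) T (fun a _ ih => op a.1 a.2 ih) I

/-- fixed item: (relative level, type, relative residue) -/
abbrev Sig := List (ℕ × ℕ × ℕ)
noncomputable def half (b : ℕ) (s : Sig) : Sig :=
  @List.rec (ℕ × ℕ × ℕ) (fun _ => Sig) [] (fun a _ ih =>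
    @Nat.rec (fun _ => Sig) ih (fun k _ => 
      @Bool.rec (fun _ => Sig) ih ((k, a.2.1, Nat.div a.2.2 2) :: ih) (Nat.beq (Nat.mod a.2.2 2) b)) a.1) s
noncomputable def fixOps (z : ℕ) (s : Sig) (T : Tab) : Tab :=
  @List.rec (ℕ × ℕ × ℕ) (fun _ => Tab) T (fun a _ ih =>
     @Nat.rec (fun _ => Tab) (fixOp z a.2.1 ih) (fun _ _ => ih) a.1) s

noncomputable def nrm (f : Sig → Tab) (s : Sig) : Tab :=
  @List.rec (ℕ × ℕ × ℕ) (fun _ => Tab) (f []) (fun a l _ => f (a :: l)) s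

noncomputable def tabV (base : Tab) (L : List (ℕ × List (ℕ × ℕ))) : Sig → Tab :=
  @List.rec (ℕ × List (ℕ × ℕ)) (fun _ => Sig → Tab) (fun _ => base)
    (fun I _ ih s => zipL (zipL prodT)
      (nrm (fun s => fixOps I.1 s (ops I.2 (ih s))) (half 0 s))
      (nrm (fun s => fixOps I.1 s (ops I.2 (ih s))) (half 1 s))) L

def base2 : Tab := [[0,0,0,0,0,0,1],[0,0,0,0,0,0,1],[0,0,0,0,0,1,1],[0,0,0,0,1,1,1],[1,1,1,1,1,1,1]]
def base3 : Tab := [[0,0,0,0,0,0,1],[0,0,0,0,0,1,1],[0,0,0,0,0,1,1],[0,0,0,1,1,1,1],[1,1,1,1,1,1,1]]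
noncomputable def itsFull : List (ℕ × List (ℕ × ℕ)) :=
  [(17, [(2,16),(1,15),(1,14),(0,13),(0,12)]), (12, [(2,11),(2,10),(1,9),(0,8),(0,7)]), (7, [(2,6),(0,5),(0,4)]),
   (4, [(1,3),(0,2),(0,1),(0,0)])]

noncomputable def hd (l : List ℕ) : ℕ := @List.rec ℕ (fun _ => ℕ) 0 (fun a _ _ => a) l
noncomputable def hdT (T : Tab) : ℕ := @List.rec (List ℕ) (fun _ => ℕ) 0 (fun a _ _ => hd a) T

noncomputable def avail (i F : ℕ) : ℕ :=
  Nat.lor (Nat.land F (notS i)) (Nat.land (Nat.shiftRight F (Nat.pow 2 i)) (notS i))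
noncomputable def adjB (b : Bool) (i F : ℕ) : ℕ :=
  @Bool.rec (fun _ => ℕ) (Nat.land F (notS i)) (avail i F) b
noncomputable def upS (i F : ℕ) : ℕ := Nat.lor F (Nat.shiftLeft (Nat.land F (notS i)) (Nat.pow 2 i))
noncomputable def up (l : List ℕ) (F : ℕ) : ℕ := @List.rec ℕ (fun _ => ℕ) F (fun i _ ih => upS i ih) l
noncomputable def adj (b72 b36 b18 c18 : Bool) (F : ℕ) : ℕ :=
  adjB b72 5 (adjB b36 8 (adjB b18 13 (adjB c18 15 (avail 2 (avail 3 (avail 6 (avail 11 F)))))))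
noncomputable def lv0 (c9 d9 : Bool) (T : Tab) : ℕ :=
  hdT (opD 18 (opC 17 (@Bool.rec (fun _ => Tab) (@Bool.rec (fun _ => Tab) T (shL T) c9)
    (mapL shL (@Bool.rec (fun _ => Tab) T (shL T) c9)) d9)))
noncomputable def fam (T2 T3 : Tab) (b72 b36 b18 c18 c9 d9 : Bool) : ℕ :=
  up [0,1,4,7,9,10,12,14,16,17,18,19] 
   (Nat.lor (lv0 c9 d9 (mapL (mapL (adj b72 b36 b18 c18)) T2))
    (Nat.shiftLeft (lv0 c9 d9 (mapL (mapL (adj b72 b36 b18 c18)) T3)) (Nat.pow 2 19)))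

noncomputable def chkD (f : ℕ → ℕ → ℕ) (F D : ℕ) : ℕ :=
  @Bool.rec (fun _ => ℕ) 
   (@Bool.rec (fun _ => ℕ) 
     (@Bool.rec (fun _ => ℕ) (f F D) D (Nat.beq (Nat.mod F 2) 1)) 0 (Nat.beq F 0)) 0 (Nat.beq D 0)
noncomputable def pdF (n : ℕ) : ℕ → ℕ → ℕ :=
  @Nat.rec (fun _ => ℕ → ℕ → ℕ) (fun _ D => D) (fun j ih F D =>
    @Bool.rec (fun _ => ℕ) (ih F D)
      (Nat.lor (chkD ih (Nat.land F (allS j)) D)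
          (chkD ih (Nat.land (Nat.shiftRight F (Nat.pow 2 j)) (Nat.xor (allS j) (Nat.land F (allS j))))
            (Nat.land (Nat.shiftRight D (Nat.pow 2 j)) (notS j))))
      (Nat.ble (pw j) F)) n
noncomputable def pd (F D : ℕ) : ℕ := chkD (pdF 20) F D
noncomputable def andB (a b : Bool) : Bool := @Bool.rec (fun _ => Bool) false b a
noncomputable def z (n : ℕ) : Bool := Nat.beq n 0
noncomputable def xchk (fm : Bool → Bool → Bool → Bool → Bool → Bool → ℕ) (D2 : ℕ) (a b c d : Bool) : Bool :=
  z (Nat.land D2 (Nat.land (fm a false true b c d) (fm (!a) true false (!b) (!c) (!d))))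
noncomputable def xall (fm : Bool → Bool → Bool → Bool → Bool → Bool → ℕ) (D2 : ℕ) : Bool :=
  andB (xchk fm D2 false false false false) (
  andB (xchk fm D2 false false false true) (
  andB (xchk fm D2 false false true false) (
  andB (xchk fm D2 false false true true) (
  andB (xchk fm D2 false true false false) (
  andB (xchk fm D2 false true false true) (
  andB (xchk fm D2 false true true false) (
  andB (xchk fm D2 false true true true) (
  andB (xchk fm D2 true false false false) (
  andB (xchk fm D2 true false false true) (
  andB (xchk fm D2 true false true false) (
  andB (xchk fm D2 true false true true) (
  andB (xchk fm D2 true true false false) (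
  andB (xchk fm D2 true true false true) (
  andB (xchk fm D2 true true true false) 
   (xchk fm D2 true true true true)))))))))))))))
noncomputable def or3 (a b c : ℕ) : ℕ := Nat.lor a (Nat.lor b c)
noncomputable def mj3 (a b c : ℕ) : ℕ := or3 (Nat.land a b) (Nat.land a c) (Nat.land b c)
noncomputable def chkFam (fm : Bool → Bool → Bool → Bool → Bool → Bool → ℕ) (D1 : ℕ) : Bool :=
  andB (z (Nat.land (pd (fm false false false false false false) D1) (fm true false false true true true))) (
  andB (xall fm (pd (fm false false false false false false) D1)) (
  andB (z (Nat.land 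
    (pd (or3 (fm true false false false false false) (fm false true false false false false) (or3 (fm false false false true false false) (fm false false false false true false) (fm false false false false false true))) D1)
    (or3 (fm true false false false false false) (fm false true false false false false) (or3 (fm false false false true false false) (fm false false false false true false) (fm false false false false false true))))) (
  andB (z (Nat.land (Nat.land (fm false false true false false false)
    (pd (Nat.land (fm false true false false false false)
         (mj3 (fm false false false true false false) (fm false false false false true false) (fm false false false false false true))) D1))
    (or3 (fm true false false true false false) (fm true false false false true false) (fm true false false false false true)))) (
  andB (z (Nat.land (Nat.land (fm false false true false false false)
    (pd (Nat.land (Nat.land (fm true false false false false false) (fm false true false false false false))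
         (or3 (fm false false false true false false) (fm false false false false true false) (fm false false false false false true))) D1))
    (or3 (fm false false false true true false) (fm false false false true false true) (fm false false false false true true))))
   (z (Nat.land (Nat.land (fm false false true false false false)
    (pd (Nat.lor (Nat.land (fm true false false false false false) (mj3 (fm false false false true false false) (fm false false false false true false) (fm false false false false false true)))
         (Nat.land (fm false false false true false false) (Nat.land (fm false false false false true false) (fm false false false false false true)))) D1))
    (Nat.lor (fm true true false false false false) (or3 (fm false true false true false false) (fm false true false false true false) (fm false true false false false true)))))))))
noncomputable def chkTab (T2 T3 : Tab) : Bool :=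
  chkFam (fam T2 T3) (pd (fam T2 T3 false false false false false false) (allS 20))
noncomputable def check (L : List (ℕ × List (ℕ × ℕ))) (s : Sig) : Bool :=
  chkTab (tabV base2 L s) (tabV base3 L s)
end CS
namespace CS
theorem tb_allS (j m : ℕ) : (allS j).testBit m = decide (m < 2 ^ j) := by
  show (2 ^ (2 ^ j) - 1).testBit m = _
  exact Nat.testBit_two_pow_sub_one _ _

/-- Submask relation. -/
def Sub (a b : ℕ) : Prop := ∀ i, a.testBit i = true → b.testBit i = true
/-- Disjointness of masks. -/
def Dsj (a b : ℕ) : Prop := ∀ i, a.testBit i = true → b.testBit i = true → False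

theorem notS_go (i m : ℕ) (hi : m.testBit i = false) (n : ℕ) (hm : m < 2 ^ n) :
    (@Nat.rec (fun _ => ℕ) 1 (fun n r =>
      @Bool.rec (fun _ => ℕ) (Nat.lor r (Nat.shiftLeft r (Nat.pow 2 n))) r (Nat.beq n i)) n : ℕ).testBit m = true := by
  induction n generalizing m with
  | zero =>
    have : m = 0 := by simpa using hm
    subst this; exact (by decide : Nat.testBit 1 0 = true)
  | succ n ih =>
    show (@Bool.rec (fun _ => ℕ) (Nat.lor _ (Nat.shiftLeft _ (Nat.pow 2 n))) _ (Nat.beq n i) : ℕ).testBit m = true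
    by_cases hlt : m < 2 ^ n
    · have := ih m hi hlt
      cases Nat.beq n i
      · show (_ ||| _ : ℕ).testBit m = true
        rw [Nat.testBit_or, this]; rfl
      · exact this
    · have hb : m.testBit n = true := by
        rw [Nat.testBit_eq_decide_div_mod_eq]
        have : m / 2 ^ n = 1 := by
          rw [pow_succ] at hm
          refine Nat.div_eq_of_lt_le (by omega) (by omega)
        simp [this]
      have hne : n ≠ i := by rintro rfl; rw [hb] at hi; cases hi
      have hbeq : Nat.beq n i = false := by
        cases h : Nat.beq n i
        · rfl
        · exact absurd (Nat.eq_of_beq_eq_true h) hne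
      rw [hbeq]
      show (_ ||| (_ <<< (2 ^ n)) : ℕ).testBit m = true
      rw [Nat.testBit_or, Nat.testBit_shiftLeft]
      have h2 : (m - 2 ^ n).testBit i = false := by
        have hx : m = 2 ^ n + (m - 2 ^ n) := by omega
        rw [hx] at hi
        rcases lt_or_gt_of_ne hne with h | h
        · have h3 : m - 2 ^ n < 2 ^ i := lt_of_lt_of_le (show m - 2 ^ n < 2 ^ n by rw [pow_succ] at hm; omega)
            (Nat.pow_le_pow_right (by norm_num) h.le)
          exact Nat.testBit_lt_two_pow h3
        · rwa [Nat.testBit_two_pow_add_gt h] at hi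
      rw [ih _ h2 (by rw [pow_succ] at hm; omega)]
      simp; right; omega

theorem tb_notS (i m : ℕ) (hi : m.testBit i = false) (hm : m < 2 ^ 20) : (notS i).testBit m = true :=
  notS_go i m hi 20 hm

theorem sub_hi {j m : ℕ} (h1 : 2 ^ j ≤ m) (h2 : m < 2 ^ (j + 1)) :
    ∃ m', m = m' + 2 ^ j ∧ m' < 2 ^ j ∧ m'.testBit j = false ∧ m.testBit j = true ∧ Sub m' m := by
  refine ⟨m - 2 ^ j, by omega, by rw [pow_succ] at h2; omega, ?_, ?_, ?_⟩
  · exact Nat.testBit_lt_two_pow (by rw [pow_succ] at h2; omega)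
  · obtain ⟨k, rfl⟩ := Nat.exists_eq_add_of_le h1
    rw [Nat.testBit_two_pow_add_eq, Nat.testBit_lt_two_pow (by rw [pow_succ] at h2; omega)]; rfl
  · intro i hi
    obtain ⟨k, rfl⟩ := Nat.exists_eq_add_of_le h1
    rw [Nat.add_sub_cancel_left] at hi
    have hk : k < 2 ^ j := by rw [pow_succ] at h2; omega
    have hij : i < j := by
      by_contra hc
      rw [Nat.testBit_lt_two_pow (lt_of_lt_of_le hk (Nat.pow_le_pow_right (by norm_num) (not_lt.1 hc)))] at hi
      cases hi
    rw [Nat.testBit_two_pow_add_gt hij]; exact hi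

/-- adding a missing bit -/
theorem tb_add {m j : ℕ} (h : m.testBit j = false) (i : ℕ) :
    (m + 2 ^ j).testBit i = (m.testBit i || decide (i = j)) := by
  rcases lt_trichotomy i j with hi | rfl | hi
  · rw [Nat.add_comm, Nat.testBit_two_pow_add_gt hi]; simp [hi.ne]
  · rw [Nat.add_comm, Nat.testBit_two_pow_add_eq, h]; simp
  · obtain ⟨k, rfl⟩ := Nat.exists_eq_add_of_lt hi
    have e : j + k + 1 = k + (j + 1) := by omega
    rw [e, ← Nat.testBit_div_two_pow, ← Nat.testBit_div_two_pow]
    have : (m + 2 ^ j) / 2 ^ (j + 1) = m / 2 ^ (j + 1) := by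
      rw [Nat.testBit_eq_decide_div_mod_eq] at h
      have h1 : m / 2 ^ j % 2 = 0 := by
        have := of_decide_eq_false h; omega
      rw [pow_succ, ← Nat.div_div_eq_div_mul, ← Nat.div_div_eq_div_mul, Nat.add_div_right _ (by positivity)]
      omega
    rw [this]; simp; omega

end CS

set_option autoImplicit false
namespace CS
theorem chk_sound {f : ℕ → ℕ → ℕ} {F G m1 m2 : ℕ} (h1 : F.testBit m1 = true) (h2 : G.testBit m2 = true)
    (hf : ∃ m, (f F G).testBit m = true ∧ Sub m (m1 ||| m2)) :
    ∃ m, (chk f F G).testBit m = true ∧ Sub m (m1 ||| m2) := by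
  unfold chk
  have h0 : Nat.beq F 0 = false := by
    cases h : Nat.beq F 0
    · rfl
    · rw [Nat.eq_of_beq_eq_true h] at h1; simp at h1
  rw [h0]
  cases Nat.beq (Nat.mod F 2) 1
  · exact hf
  · exact ⟨m2, h2, fun i hi => by rw [Nat.testBit_or, hi, Bool.or_true]⟩

theorem prodF_succ (j F G : ℕ) : prodF (j + 1) F G = @Bool.rec (fun _ => ℕ) (prodF j F G)
      ((chk (prodF j) (F &&& allS j) G) |||
        ((chk (prodF j) ((F >>> (2 ^ j)) &&& ((allS j) ^^^ (F &&& allS j)))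
            (G &&& (notS j))) <<< (2 ^ j)))
      (Nat.ble (pw j) F) := rfl

theorem lt_pw {F m : ℕ} (h : F.testBit m = true) {j : ℕ} (hb : Nat.ble (pw j) F = false) : m < 2 ^ j := by
  by_contra hc
  have h1 : ¬ pw j ≤ F := by
    intro hh; rw [Nat.ble_eq_true_of_le hh] at hb; cases hb
  have h2 : F < 2 ^ m := lt_of_lt_of_le (not_le.1 h1)
    (show 2 ^ 2 ^ j ≤ 2 ^ m from Nat.pow_le_pow_right (by norm_num) (not_lt.1 hc))
  rw [Nat.testBit_lt_two_pow h2] at h; cases h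

theorem hi_bit {F j m' : ℕ} (hm' : m' < 2 ^ j) (h1 : F.testBit (m' + 2 ^ j) = true)
    (hn : F.testBit m' = false) :
    ((F >>> (2 ^ j)) &&& ((allS j) ^^^ (F &&& allS j))).testBit m' = true := by
  rw [Nat.testBit_and, Nat.testBit_shiftRight, Nat.testBit_xor, Nat.testBit_and, tb_allS, Nat.add_comm, h1, hn]
  simp [hm']

theorem prodF_sound (n : ℕ) : ∀ (F G m1 m2 : ℕ), F.testBit m1 = true → G.testBit m2 = true →
    Dsj m1 m2 → m1 < 2 ^ n → m2 < 2 ^ 20 →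
    ∃ m, (prodF n F G).testBit m = true ∧ Sub m (m1 ||| m2) := by
  induction n with
  | zero =>
    intro F G m1 m2 _ h2 _ _ _
    exact ⟨m2, h2, fun i hi => by rw [Nat.testBit_or, hi, Bool.or_true]⟩
  | succ j ih =>
    intro F G m1 m2 h1 h2 hd hm1 hm2
    rw [prodF_succ]
    cases hb : Nat.ble (pw j) F
    · exact ih F G m1 m2 h1 h2 hd (lt_pw h1 hb) hm2
    · show ∃ m, (_ ||| _ : ℕ).testBit m = true ∧ _
      have low : ∀ m', m' < 2 ^ j → F.testBit m' = true → Sub m' m1 →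
          ∃ m, ((chk (prodF j) (F &&& allS j) G) |||
        ((chk (prodF j) ((F >>> (2 ^ j)) &&& ((allS j) ^^^ (F &&& allS j)))
            (G &&& (notS j))) <<< (2 ^ j))).testBit m = true ∧ Sub m (m1 ||| m2) := by
        intro m' hl hF hs
        have hF0 : (F &&& allS j).testBit m' = true := by
          rw [Nat.testBit_and, hF, tb_allS]; simp [hl]
        obtain ⟨m, hm, hsub⟩ := chk_sound hF0 h2 (ih _ _ m' m2 hF0 h2 (fun i a b => hd i (hs i a) b) hl hm2)
        refine ⟨m, by rw [Nat.testBit_or, hm]; rfl, fun i hi => ?_⟩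
        have := hsub i hi
        rw [Nat.testBit_or] at this ⊢
        cases h : m'.testBit i
        · rw [h] at this; rw [Bool.false_or] at this; rw [this, Bool.or_true]
        · rw [hs i h]; rfl
      by_cases hl : m1 < 2 ^ j
      · exact low m1 hl h1 (fun i hi => hi)
      · obtain ⟨m', rfl, hm', hbj, hbj1, hs⟩ := sub_hi (not_lt.1 hl) hm1
        cases hn : F.testBit m'
        · have hF1 := hi_bit hm' h1 hn
          have hm2j : m2.testBit j = false := by
            cases h : m2.testBit j
            · rfl
            · exact (hd j hbj1 h).elim
          have hG : (G &&& notS j).testBit m2 = true := by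
            rw [Nat.testBit_and, h2, tb_notS j m2 hm2j hm2]; rfl
          obtain ⟨m, hm, hsub⟩ := chk_sound hF1 hG (ih _ _ m' m2 hF1 hG (fun i a b => hd i (hs i a) b) hm' hm2)
          have hmj : m.testBit j = false := by
            cases h : m.testBit j
            · rfl
            · have := hsub j h
              rw [Nat.testBit_or, hbj, hm2j] at this; cases this
          refine ⟨m + 2 ^ j, ?_, fun i hi => ?_⟩
          · rw [Nat.testBit_or, Nat.testBit_shiftLeft, Nat.add_sub_cancel, hm]; simp
          · rw [tb_add hmj] at hi
            rw [Nat.testBit_or, tb_add hbj]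
            cases h : m.testBit i
            · rw [h] at hi; simp at hi; simp [hi]
            · have := hsub i h
              rw [Nat.testBit_or] at this
              cases h' : m'.testBit i
              · rw [h'] at this; simp at this; simp [this]
              · rfl
        · exact low m' hm' hn hs

theorem prodT_sound {F G m1 m2 : ℕ} (h1 : F.testBit m1 = true) (h2 : G.testBit m2 = true)
    (hd : Dsj m1 m2) (hm1 : m1 < 2 ^ 17) (hm2 : m2 < 2 ^ 17) :
    ∃ m, (prodT F G).testBit m = true ∧ Sub m (m1 ||| m2) := by
  have hz : ∀ {F m : ℕ}, F.testBit m = true → Nat.beq F 0 = false := by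
    intro F m h1
    cases h : Nat.beq F 0
    · rfl
    · rw [Nat.eq_of_beq_eq_true h] at h1; simp at h1
  unfold prodT
  rw [hz h1, hz h2]
  cases Nat.beq (Nat.mod G 2) 1
  · cases Nat.ble G F
    · have := chk_sound h2 h1 (prodF_sound 17 _ _ m2 m1 h2 h1 (fun i a b => hd i b a) hm2
        (lt_trans hm1 (by norm_num)))
      rw [Nat.lor_comm] at this
      exact this
    · exact chk_sound h1 h2 (prodF_sound 17 _ _ m1 m2 h1 h2 hd hm1 (lt_trans hm2 (by norm_num)))
  · exact ⟨m1, h1, fun i hi => by rw [Nat.testBit_or, hi]; rfl⟩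

theorem chkD_sound {f : ℕ → ℕ → ℕ} {F D m T : ℕ} (h1 : F.testBit m = true) (h2 : D.testBit T = true)
    (hf : (f F D).testBit T = true) : (chkD f F D).testBit T = true := by
  have hz : ∀ {F m : ℕ}, F.testBit m = true → Nat.beq F 0 = false := by
    intro F m h1
    cases h : Nat.beq F 0
    · rfl
    · rw [Nat.eq_of_beq_eq_true h] at h1; simp at h1
  unfold chkD
  rw [hz h1, hz h2]
  cases Nat.beq (Nat.mod F 2) 1
  · exact hf
  · exact h2

theorem pdF_succ (j F D : ℕ) : pdF (j + 1) F D = @Bool.rec (fun _ => ℕ) (pdF j F D)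
      ((chkD (pdF j) (F &&& allS j) D) |||
        (chkD (pdF j) ((F >>> (2 ^ j)) &&& ((allS j) ^^^ (F &&& allS j)))
            ((D >>> (2 ^ j)) &&& (notS j))))
      (Nat.ble (pw j) F) := rfl

theorem or_add {T m j : ℕ} (hT : T.testBit j = false) (hm : m.testBit j = false) :
    T ||| (m + 2 ^ j) = (T ||| m) + 2 ^ j := by
  apply Nat.eq_of_testBit_eq; intro i
  have : (T ||| m).testBit j = false := by rw [Nat.testBit_or, hT, hm]; rfl
  rw [tb_add this, Nat.testBit_or, tb_add hm, Nat.testBit_or, Bool.or_assoc]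

theorem pdF_sound (n : ℕ) : ∀ (F D m T : ℕ), F.testBit m = true →
    (∀ m', Sub m' m → D.testBit (T ||| m') = true) →
    Dsj T m → m < 2 ^ n → n ≤ 20 → T < 2 ^ 20 → (pdF n F D).testBit T = true := by
  induction n with
  | zero =>
    intro F D m T _ h2 _ _ _ _
    have := h2 0 (fun i hi => by simp at hi)
    show D.testBit T = true
    simpa using this
  | succ j ih =>
    intro F D m T h1 h2 hd hm hn hT
    rw [pdF_succ]
    have h20 : D.testBit T = true := by
      have := h2 0 (fun i hi => by simp at hi)
      simpa using this
    cases hb : Nat.ble (pw j) F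
    · exact ih F D m T h1 h2 hd (lt_pw h1 hb) (by omega) hT
    · show (_ ||| _ : ℕ).testBit T = true
      rw [Nat.testBit_or]
      have low : ∀ m', m' < 2 ^ j → F.testBit m' = true → Sub m' m →
          (chkD (pdF j) (F &&& allS j) D).testBit T = true := by
        intro m' hl hF hs
        have hF0 : (F &&& allS j).testBit m' = true := by
          rw [Nat.testBit_and, hF, tb_allS]; simp [hl]
        exact chkD_sound hF0 h20 (ih _ _ m' T hF0 (fun m'' h'' => h2 m'' (fun i hi => hs i (h'' i hi)))
          (fun i a b => hd i a (hs i b)) hl (by omega) hT)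
      by_cases hl : m < 2 ^ j
      · rw [low m hl h1 (fun i hi => hi)]; rfl
      · obtain ⟨m', rfl, hm', hbj, hbj1, hs⟩ := sub_hi (not_lt.1 hl) hm
        cases hnn : F.testBit m'
        · have hF1 := hi_bit hm' h1 hnn
          have hTj : T.testBit j = false := by
            cases h : T.testBit j
            · rfl
            · exact (hd j h hbj1).elim
          have hD : ∀ m'', Sub m'' m' → ((D >>> 2 ^ j) &&& notS j).testBit (T ||| m'') = true := by
            intro m'' h''
            have hj'' : m''.testBit j = false := by
              cases h : m''.testBit j
              · rfl
              · rw [h'' j h] at hbj; cases hbj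
            have hlt : m'' < 2 ^ 20 := by
              apply Nat.lt_pow_two_of_testBit
              intro i hi
              cases h : m''.testBit i
              · rfl
              · have := h'' i h
                rw [Nat.testBit_lt_two_pow (lt_of_lt_of_le hm'
                  (Nat.pow_le_pow_right (by norm_num) (by omega)))] at this; cases this
            rw [Nat.testBit_and, Nat.testBit_shiftRight, Nat.add_comm, ← or_add hTj hj'']
            rw [h2 _ ?_, tb_notS j _ (by rw [Nat.testBit_or, hTj, hj'']; rfl) (Nat.or_lt_two_pow hT hlt)]
            · rfl
            · intro i hi
              rw [tb_add hj''] at hi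
              rw [tb_add hbj]
              cases h : m''.testBit i
              · rw [h] at hi; simp at hi; simp [hi]
              · rw [h'' i h]; rfl
          have hD0 := hD 0 (fun i hi => by simp at hi)
          rw [Nat.or_zero] at hD0
          rw [chkD_sound hF1 hD0 (ih _ _ m' T hF1 hD (fun i a b => hd i a (hs i b)) hm' (by omega) hT)]
          simp
        · rw [low m' hm' hnn hs]; rfl

theorem pd_sound {F D m T : ℕ} (h1 : F.testBit m = true)
    (h2 : ∀ m', Sub m' m → D.testBit (T ||| m') = true)
    (hd : Dsj T m) (hm : m < 2 ^ 20) (hT : T < 2 ^ 20) : (pd F D).testBit T = true := by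
  refine chkD_sound h1 ?_ (pdF_sound 20 F D m T h1 h2 hd hm le_rfl hT)
  simpa using h2 0 (fun i hi => by simp at hi)
end CS

set_option autoImplicit false
namespace CS
open Classical in
/-- number of items of kind `c` in `I` present in `S` -/
noncomputable def cI (c : ℕ) (I : List (ℕ × ℕ)) (S : ℕ → Prop) : ℕ :=
  (I.map (fun p => if min p.1 2 = c ∧ S p.2 then 1 else 0)).sum
noncomputable def cL (c : ℕ) : ℕ → List (ℕ × List (ℕ × ℕ)) → (ℕ → Prop) → (ℕ → ℕ) → ℕ → ℕ
  | _, [], _, _, _ => 0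
  | d, (_, I) :: L, S, ρ, y => cI c I (fun i => S i ∧ y % 2 ^ d = ρ i % 2 ^ d) + cL c (d + 1) L S ρ y
def cS (c : ℕ) (s : Sig) (y : ℕ) : ℕ :=
  (s.map (fun a => if 1 ≤ a.1 ∧ min a.2.1 2 = c ∧ y % 2 ^ a.1 = a.2.2 % 2 ^ a.1 then 1 else 0)).sum
def cF (c : ℕ) (s : Sig) : ℕ :=
  (s.map (fun a => if a.1 = 0 ∧ min a.2.1 2 = c then 1 else 0)).sum

def tab (f : ℕ → ℕ → ℕ) : Tab :=
  [[f 0 0, f 0 1, f 0 2, f 0 3, f 0 4, f 0 5, f 0 6], [f 1 0, f 1 1, f 1 2, f 1 3, f 1 4, f 1 5, f 1 6],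
   [f 2 0, f 2 1, f 2 2, f 2 3, f 2 4, f 2 5, f 2 6], [f 3 0, f 3 1, f 3 2, f 3 3, f 3 4, f 3 5, f 3 6],
   [f 4 0, f 4 1, f 4 2, f 4 3, f 4 4, f 4 5, f 4 6]]

def SatB (b F : ℕ) (S : ℕ → Prop) : Prop :=
  ∃ m, F.testBit m = true ∧ m < 2 ^ b ∧ ∀ i, m.testBit i = true → S i

noncomputable def fop (t i : ℕ) (f : ℕ → ℕ → ℕ) (h g : ℕ) : ℕ :=
  match t with
  | 0 => f h g ||| allH i
  | 1 => sho i (f h g) (f (min (h + 1) 4) g)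
  | _ => sho i (f h g) (f h (min (g + 1) 6))
noncomputable def ffix (z t : ℕ) (f : ℕ → ℕ → ℕ) (h g : ℕ) : ℕ :=
  match t with
  | 0 => allS z
  | 1 => f (min (h + 1) 4) g
  | _ => f h (min (g + 1) 6)
noncomputable def fops : List (ℕ × ℕ) → (ℕ → ℕ → ℕ) → ℕ → ℕ → ℕ
  | [], f => f
  | a :: I, f => fop a.1 a.2 (fops I f)
noncomputable def ffixs (z : ℕ) : Sig → (ℕ → ℕ → ℕ) → ℕ → ℕ → ℕ
  | [], f => f
  | (0, t, _) :: s, f => ffix z t (ffixs z s f)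
  | (_ + 1, _, _) :: s, f => ffixs z s f
noncomputable def fV (β : ℕ → ℕ → ℕ) : List (ℕ × List (ℕ × ℕ)) → Sig → ℕ → ℕ → ℕ
  | [], _ => β
  | (z, I) :: L, s => fun h g =>
    prodT (ffixs z (half 0 s) (fops I (fV β L (half 0 s))) h g)
      (ffixs z (half 1 s) (fops I (fV β L (half 1 s))) h g)

theorem op_tab (t i : ℕ) (f : ℕ → ℕ → ℕ) : op t i (tab f) = tab (fop t i f) := by
  rcases t with _ | _ | t <;> rfl
theorem fixOp_tab (z t : ℕ) (f : ℕ → ℕ → ℕ) : fixOp z t (tab f) = tab (ffix z t f) := by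
  rcases t with _ | _ | t <;> rfl
theorem ops_tab (I : List (ℕ × ℕ)) (f : ℕ → ℕ → ℕ) : ops I (tab f) = tab (fops I f) := by
  induction I with
  | nil => rfl
  | cons a I ih =>
    show op a.1 a.2 (ops I (tab f)) = _
    rw [ih, op_tab]; rfl
theorem fixOps_tab (z : ℕ) (s : Sig) (f : ℕ → ℕ → ℕ) : fixOps z s (tab f) = tab (ffixs z s f) := by
  induction s with
  | nil => rfl
  | cons a s ih =>
    obtain ⟨l, t, r⟩ := a
    cases l with
    | zero =>
      show fixOp z t (fixOps z s (tab f)) = _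
      rw [ih, fixOp_tab]; rfl
    | succ l =>
      show fixOps z s (tab f) = _
      rw [ih]; rfl
theorem nrm_eq (f : Sig → Tab) (s : Sig) : nrm f s = f s := by cases s <;> rfl
theorem tabV_tab (β : ℕ → ℕ → ℕ) (L : List (ℕ × List (ℕ × ℕ))) (s : Sig) :
    tabV (tab β) L s = tab (fV β L s) := by
  induction L generalizing s with
  | nil => rfl
  | cons a L ih =>
    obtain ⟨z, I⟩ := a
    show zipL (zipL prodT) (nrm (fun s => fixOps z s (ops I (tabV (tab β) L s))) (half 0 s))
      (nrm (fun s => fixOps z s (ops I (tabV (tab β) L s))) (half 1 s)) = _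
    rw [nrm_eq, nrm_eq, ih, ih, ops_tab, ops_tab, fixOps_tab, fixOps_tab]; rfl

theorem half_cons_zero (b t r : ℕ) (s : Sig) : half b ((0, t, r) :: s) = half b s := rfl
theorem half_cons_succ (b k t r : ℕ) (s : Sig) : half b ((k + 1, t, r) :: s) =
    if r % 2 = b then (k, t, r / 2) :: half b s else half b s := by
  show @Bool.rec (fun _ => Sig) (half b s) ((k, t, r / 2) :: half b s) (Nat.beq (r % 2) b) = _
  by_cases h : r % 2 = b
  · rw [if_pos h, h, show Nat.beq b b = true from Nat.beq_refl b]
  · rw [if_neg h]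
    cases hb : Nat.beq (r % 2) b
    · rfl
    · exact absurd (Nat.eq_of_beq_eq_true hb) h

def bnd (b : ℕ) : List (ℕ × ℕ) → ℕ
  | [] => b
  | (_, i) :: _ => i + 1
def okI (b : ℕ) : List (ℕ × ℕ) → Prop
  | [] => True
  | (_, i) :: I => okI b I ∧ bnd b I ≤ i
def bd : List (ℕ × List (ℕ × ℕ)) → ℕ
  | [] => 0
  | (z, _) :: _ => z
def okL : List (ℕ × List (ℕ × ℕ)) → Prop
  | [] => True
  | (z, I) :: L => okI (bd L) I ∧ bnd (bd L) I ≤ z ∧ z ≤ 17 ∧ okL L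

theorem SatB.mono {b b' F : ℕ} {S S' : ℕ → Prop} (h : SatB b F S) (hb : b ≤ b') (hS : ∀ i, S i → S' i) :
    SatB b' F S' := by
  obtain ⟨m, h1, h2, h3⟩ := h
  exact ⟨m, h1, lt_of_lt_of_le h2 (Nat.pow_le_pow_right (by norm_num) hb), fun i hi => hS i (h3 i hi)⟩

theorem SatB.left {b F G : ℕ} {S : ℕ → Prop} (h : SatB b F S) : SatB b (F ||| G) S := by
  obtain ⟨m, h1, h2, h3⟩ := h
  exact ⟨m, by rw [Nat.testBit_or, h1]; rfl, h2, h3⟩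

theorem SatB.shift {b i F G : ℕ} {S : ℕ → Prop} (h : SatB b G S) (hb : b ≤ i) (hi : S i) :
    SatB (i + 1) (sho i F G) S := by
  obtain ⟨m, h1, h2, h3⟩ := h
  have hlt : m < 2 ^ i := lt_of_lt_of_le h2 (Nat.pow_le_pow_right (by norm_num) hb)
  refine ⟨m + 2 ^ i, ?_, by rw [pow_succ]; omega, fun k hk => ?_⟩
  · show (F ||| (G <<< (2 ^ i))).testBit _ = true
    rw [Nat.testBit_or, Nat.testBit_shiftLeft, Nat.add_sub_cancel, h1]; simp
  · rw [tb_add (Nat.testBit_lt_two_pow hlt)] at hk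
    cases h : m.testBit k
    · rw [h] at hk; simp at hk; rw [hk]; exact hi
    · exact h3 k h

theorem cI_cons (c t i : ℕ) (I : List (ℕ × ℕ)) (S : ℕ → Prop) [Decidable (S i)] :
    cI c ((t, i) :: I) S = (if min t 2 = c ∧ S i then 1 else 0) + cI c I S := by
  unfold cI; simp only [List.map_cons, List.sum_cons]; congr

theorem ops_sound (b : ℕ) (f : ℕ → ℕ → ℕ) (S : ℕ → Prop) (I : List (ℕ × ℕ)) : okI b I → ∀ h g, 
    (0 < cI 0 I S ∨ SatB b (f (min (h + cI 1 I S) 4) (min (g + cI 2 I S) 6)) S) → h ≤ 4 → g ≤ 6 →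
    SatB (bnd b I) (fops I f h g) S := by
  classical
  induction I with
  | nil =>
    intro _ h g hh h4 h6
    show SatB b (f h g) S
    simpa [cI, h4, h6] using hh
  | cons a I ih =>
    obtain ⟨t, i⟩ := a
    intro ⟨ok, hb⟩ h g hh h4 h6
    rw [cI_cons, cI_cons, cI_cons] at hh
    by_cases hS : S i
    · rcases t with _ | _ | t
      · refine ⟨2 ^ i, ?_, ?_, fun k hk => ?_⟩
        · show (_ ||| ((allS i) <<< (2 ^ i))).testBit _ = true
          rw [Nat.testBit_or, Nat.testBit_shiftLeft, tb_allS]; simp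
        · show _ < 2 ^ (i + 1); rw [pow_succ]; have : 0 < 2 ^ i := by positivity
          omega
        · rw [Nat.testBit_two_pow] at hk; simp at hk; rwa [← hk]
      · refine SatB.shift (ih ok _ _ ?_ (min_le_right _ _) h6) hb hS
        simp [hS] at hh
        rw [show min (min (h + 1) 4 + cI 1 I S) 4 = min (h + (1 + cI 1 I S)) 4 by omega]
        exact hh
      · refine SatB.shift (ih ok _ _ ?_ h4 (min_le_right _ _)) hb hS
        simp [hS] at hh
        rw [show min (min (g + 1) 6 + cI 2 I S) 6 = min (g + (1 + cI 2 I S)) 6 by omega]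
        exact hh
    · simp [hS] at hh
      have := (ih ok _ _ hh h4 h6).mono (show bnd b I ≤ i + 1 by omega) (fun i hi => hi)
      rcases t with _ | _ | t <;> exact this.left

theorem ffixs_sound (z : ℕ) (f : ℕ → ℕ → ℕ) (S : ℕ → Prop) (s : Sig) : ∀ h g, 
    (0 < cF 0 s ∨ SatB z (f (min (h + cF 1 s) 4) (min (g + cF 2 s) 6)) S) → h ≤ 4 → g ≤ 6 →
    SatB z (ffixs z s f h g) S := by
  induction s with
  | nil =>
    intro h g hh h4 h6
    show SatB z (f h g) S
    simpa [cF, h4, h6] using hh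
  | cons a s ih =>
    obtain ⟨l, t, r⟩ := a
    intro h g hh h4 h6
    have e : ∀ c, cF c ((l, t, r) :: s) = (if l = 0 ∧ min t 2 = c then 1 else 0) + cF c s := fun c => by
      simp [cF]
    rw [e, e, e] at hh
    rcases l with _ | l
    · rcases t with _ | _ | t
      · refine ⟨0, ?_, by positivity, fun k hk => by simp at hk⟩
        show (allS z).testBit 0 = true
        rw [tb_allS]; simp
      · refine (ih (min (h + 1) 4) g ?_ (min_le_right _ _) h6)
        simp at hh
        rw [show min (min (h + 1) 4 + cF 1 s) 4 = min (h + (1 + cF 1 s)) 4 by omega]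
        exact hh
      · refine (ih h (min (g + 1) 6) ?_ h4 (min_le_right _ _))
        simp at hh
        rw [show min (min (g + 1) 6 + cF 2 s) 6 = min (g + (1 + cF 2 s)) 6 by omega]
        exact hh
    · simp at hh
      exact ih _ _ hh h4 h6

theorem modpow (y' r b d : ℕ) (hb : b < 2) :
    ((2 * y' + b) % 2 ^ (d + 1) = r % 2 ^ (d + 1)) ↔ (r % 2 = b ∧ y' % 2 ^ d = r / 2 % 2 ^ d) := by
  have e : ∀ n : ℕ, n % 2 ^ (d + 1) = n % 2 + 2 * (n / 2 % 2 ^ d) := fun n => by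
    rw [pow_succ, Nat.mul_comm, Nat.mod_mul]
  rw [e, e r, show (2 * y' + b) / 2 = y' by omega]
  omega

theorem cI_congr (c : ℕ) (I : List (ℕ × ℕ)) {S S' : ℕ → Prop} (h : ∀ i, S i ↔ S' i) : cI c I S = cI c I S' := by
  have : S = S' := funext fun i => propext (h i)
  rw [this]

theorem cL_shift (c : ℕ) (L : List (ℕ × List (ℕ × ℕ))) (S : ℕ → Prop) (ρ : ℕ → ℕ) (y' b : ℕ) (hb : b < 2) :
    ∀ d, cL c (d + 1) L S ρ (2 * y' + b) = cL c d L (fun i => S i ∧ ρ i % 2 = b) (fun i => ρ i / 2) y' := by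
  induction L with
  | nil => intro d; rfl
  | cons a L ih =>
    obtain ⟨z, I⟩ := a
    intro d
    show cI _ _ _ + _ = cI _ _ _ + _
    rw [ih (d + 1)]
    congr 1
    apply cI_congr
    intro i
    rw [modpow y' (ρ i) b d hb, and_assoc]

theorem cS_half (c : ℕ) (s : Sig) (y' b : ℕ) (hb : b < 2) :
    cS c s (2 * y' + b) = cF c (half b s) + cS c (half b s) y' := by
  induction s with
  | nil => rfl
  | cons a s ih =>
    obtain ⟨l, t, r⟩ := a
    have e1 : ∀ y l t r s, cS c ((l, t, r) :: s) y =
      (if 1 ≤ l ∧ min t 2 = c ∧ y % 2 ^ l = r % 2 ^ l then 1 else 0) + cS c s y := fun y l t r s => by simp [cS]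
    have e2 : ∀ l t r s, cF c ((l, t, r) :: s) = (if l = 0 ∧ min t 2 = c then 1 else 0) + cF c s :=
      fun l t r s => by simp [cF]
    rcases l with _ | l
    · rw [half_cons_zero, e1, ih]; simp
    · rw [half_cons_succ, e1, ih]
      simp only [modpow y' r b l hb]
      by_cases hr : r % 2 = b
      · rw [if_pos hr, e1, e2]
        rcases l with _ | l
        · by_cases ht : min t 2 = c <;> simp [hr, ht, Nat.mod_one] <;> omega
        · by_cases ht : min t 2 = c <;> simp [hr, ht]; omega
      · rw [if_neg hr]; simp [hr]

theorem half_lev (b n : ℕ) (s : Sig) (h : ∀ a ∈ s, a.1 ≤ n + 1) : ∀ a ∈ half b s, a.1 ≤ n := by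
  induction s with
  | nil => intro a ha; exact absurd ha (by simp [half])
  | cons a s ih =>
    obtain ⟨l, t, r⟩ := a
    have ih' := ih (fun a ha => h a (List.mem_cons_of_mem _ ha))
    rcases l with _ | l
    · rw [half_cons_zero]; exact ih'
    · rw [half_cons_succ]
      have h1 := h _ List.mem_cons_self
      split_ifs
      · intro a ha
        rcases List.mem_cons.1 ha with rfl | ha
        · simp at h1 ⊢; exact h1
        · exact ih' a ha
      · exact ih'

theorem cS_zero (c : ℕ) (s : Sig) (y : ℕ) (h : ∀ a ∈ s, a.1 ≤ 0) : cS c s y = 0 := by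
  unfold cS
  apply List.sum_eq_zero
  intro x hx
  obtain ⟨a, ha, rfl⟩ := List.mem_map.1 hx
  have := h a ha
  rw [if_neg (by omega)]

def good (β : ℕ → ℕ → ℕ) (L : List (ℕ × List (ℕ × ℕ))) (s : Sig) (S : ℕ → Prop) (ρ : ℕ → ℕ) (h g y : ℕ) : Prop :=
  0 < cL 0 1 L S ρ y + cS 0 s y ∨
    (β (min (h + (cL 1 1 L S ρ y + cS 1 s y)) 4) (min (g + (cL 2 1 L S ρ y + cS 2 s y)) 6)).testBit 0 = true

theorem fV_sound (β : ℕ → ℕ → ℕ) (L : List (ℕ × List (ℕ × ℕ))) : okL L → ∀ (s : Sig) (S : ℕ → Prop) (ρ : ℕ → ℕ) (h g : ℕ),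
    (∀ a ∈ s, a.1 ≤ L.length) → h ≤ 4 → g ≤ 6 → (∀ y < 2 ^ L.length, good β L s S ρ h g y) →
    SatB (bd L) (fV β L s h g) S := by
  induction L with
  | nil =>
    intro _ s S ρ h g hs h4 h6 hy
    have := hy 0 (by simp)
    unfold good at this
    rw [cS_zero 0 s 0 hs, cS_zero 1 s 0 hs, cS_zero 2 s 0 hs] at this
    simp [cL, h4, h6] at this
    refine ⟨0, ?_, by simp [bd], fun i hi => by simp at hi⟩
    show (β h g).testBit 0 = true
    simpa using this
  | cons a L ih =>
    obtain ⟨z, I⟩ := a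
    intro ⟨ok1, ok2, ok3, ok4⟩ s S ρ h g hs h4 h6 hy
    have side : ∀ b < 2, SatB z (ffixs z (half b s) (fops I (fV β L (half b s))) h g) (fun i => S i ∧ ρ i % 2 = b) := by
      intro b hb
      refine ffixs_sound z _ _ _ h g ?_ h4 h6
      by_cases h0 : 0 < cF 0 (half b s)
      · exact Or.inl h0
      right
      refine (ops_sound (bd L) _ _ I ok1 _ _ ?_ (min_le_right _ _) (min_le_right _ _)).mono ok2 (fun i hi => hi)
      by_cases h1 : 0 < cI 0 I (fun i => S i ∧ ρ i % 2 = b)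
      · exact Or.inl h1
      right
      refine ih ok4 _ _ (fun i => ρ i / 2) _ _ (half_lev b _ s hs) (min_le_right _ _) (min_le_right _ _) ?_
      intro y' hy'
      have h2 := hy (2 * y' + b) (by simp only [List.length_cons, pow_succ]; omega)
      have eI : ∀ c, cI c I (fun i => S i ∧ (2 * y' + b) % 2 ^ 1 = ρ i % 2 ^ 1) = cI c I (fun i => S i ∧ ρ i % 2 = b) := by
        intro c; apply cI_congr; intro i
        rw [pow_one, show (2 * y' + b) % 2 = b by omega, eq_comm (a := b)]
      have eL : ∀ c, cL c 1 ((z, I) :: L) S ρ (2 * y' + b) = cI c I (fun i => S i ∧ ρ i % 2 = b) +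
          cL c 1 L (fun i => S i ∧ ρ i % 2 = b) (fun i => ρ i / 2) y' := by
        intro c
        show cI _ _ _ + _ = _
        rw [eI, cL_shift _ _ _ _ _ _ hb]
      unfold good at h2 ⊢
      rw [eL, eL, eL, cS_half _ _ _ _ hb, cS_half _ _ _ _ hb, cS_half _ _ _ _ hb] at h2
      rcases h2 with h2 | h2
      · left; omega
      · right
        convert h2 using 2
        congr 1 <;> omega
    obtain ⟨m1, a1, a2, a3⟩ := side 0 (by norm_num)
    obtain ⟨m2, b1, b2, b3⟩ := side 1 (by norm_num)
    have hp : 2 ^ z ≤ 2 ^ 17 := Nat.pow_le_pow_right (by norm_num) ok3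
    obtain ⟨m, c1, c2⟩ := prodT_sound a1 b1 (fun i x y => by have := (a3 i x).2; have := (b3 i y).2; omega)
      (lt_of_lt_of_le a2 hp) (lt_of_lt_of_le b2 hp)
    refine ⟨m, c1, ?_, fun i hi => ?_⟩
    · apply Nat.lt_pow_two_of_testBit
      intro i hi
      cases h : m.testBit i
      · rfl
      · have := c2 i h
        have hz : 2 ^ z ≤ 2 ^ i := Nat.pow_le_pow_right (by norm_num) hi
        rw [Nat.testBit_or, Nat.testBit_lt_two_pow (lt_of_lt_of_le a2 hz), 
          Nat.testBit_lt_two_pow (lt_of_lt_of_le b2 hz)] at this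
        cases this
    · have := c2 i hi
      rw [Nat.testBit_or, Bool.or_eq_true] at this
      rcases this with h | h
      · exact (a3 i h).1
      · exact (b3 i h).1
end CS

set_option autoImplicit false
namespace CS
theorem avail_sound {b i F : ℕ} {S : ℕ → Prop} (h : SatB b F S) (hb : b ≤ 20) :
    SatB b (avail i F) (fun k => S k ∧ k ≠ i) := by
  obtain ⟨m, h1, h2, h3⟩ := h
  have h20 : 2 ^ b ≤ 2 ^ 20 := Nat.pow_le_pow_right (by norm_num) hb
  show ∃ m, ((F &&& notS i) ||| ((F >>> (2 ^ i)) &&& notS i)).testBit m = true ∧ _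
  cases hi : m.testBit i
  · refine ⟨m, ?_, h2, fun k hk => ⟨h3 k hk, ?_⟩⟩
    · rw [Nat.testBit_or, Nat.testBit_and, h1, tb_notS i m hi (lt_of_lt_of_le h2 h20)]; rfl
    · rintro rfl; rw [hi] at hk; cases hk
  · have hx : (m ^^^ 2 ^ i).testBit i = false := by
      rw [Nat.testBit_xor, hi, Nat.testBit_two_pow]; simp
    have hm : (m ^^^ 2 ^ i) + 2 ^ i = m := by
      apply Nat.eq_of_testBit_eq; intro k
      rw [tb_add hx, Nat.testBit_xor, Nat.testBit_two_pow]
      by_cases hk : k = i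
      · subst hk; simp [hi]
      · simp [hk, Ne.symm hk]
    have hlt : m ^^^ 2 ^ i < 2 ^ b := lt_of_le_of_lt (le_of_le_of_eq (Nat.le_add_right _ (2 ^ i)) hm) h2
    refine ⟨m ^^^ 2 ^ i, ?_, hlt, fun k hk => ?_⟩
    · rw [Nat.testBit_or, Nat.testBit_and, Nat.testBit_and, tb_notS i _ hx (lt_of_lt_of_le hlt h20),
        Nat.testBit_shiftRight, Nat.add_comm, hm, h1]
      simp
    · have hki : k ≠ i := by rintro rfl; rw [hx] at hk; cases hk
      refine ⟨h3 k ?_, hki⟩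
      rw [Nat.testBit_xor, Nat.testBit_two_pow] at hk
      simpa [Ne.symm hki] using hk

theorem adjB_sound {b i F : ℕ} {S : ℕ → Prop} (t : Bool) (h : SatB b F S) (hb : b ≤ 20) (ht : S i → t = true) :
    SatB b (adjB t i F) (fun k => S k ∧ k ≠ i) := by
  cases t
  · obtain ⟨m, h1, h2, h3⟩ := h
    have h20 : 2 ^ b ≤ 2 ^ 20 := Nat.pow_le_pow_right (by norm_num) hb
    have hi : m.testBit i = false := by
      cases h : m.testBit i
      · rfl
      · exact (ht (h3 i h)).symm
    refine ⟨m, ?_, h2, fun k hk => ⟨h3 k hk, ?_⟩⟩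
    · show (F &&& notS i).testBit m = true
      rw [Nat.testBit_and, h1, tb_notS i m hi (lt_of_lt_of_le h2 h20)]; rfl
    · rintro rfl; rw [hi] at hk; cases hk
  · exact avail_sound h hb

theorem adj_sound {F : ℕ} {S : ℕ → Prop} (b72 b36 b18 c18 : Bool) (h : SatB 17 F S)
    (h5 : S 5 → b72 = true) (h8 : S 8 → b36 = true) (h13 : S 13 → b18 = true) (h15 : S 15 → c18 = true) :
    SatB 17 (adj b72 b36 b18 c18 F)
      (fun k => S k ∧ k ≠ 2 ∧ k ≠ 3 ∧ k ≠ 6 ∧ k ≠ 11 ∧ k ≠ 5 ∧ k ≠ 8 ∧ k ≠ 13 ∧ k ≠ 15) := by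
  unfold adj
  have a1 := avail_sound (i := 11) h (by norm_num)
  have a2 := avail_sound (i := 6) a1 (by norm_num)
  have a3 := avail_sound (i := 3) a2 (by norm_num)
  have a4 := avail_sound (i := 2) a3 (by norm_num)
  have a5 := adjB_sound (i := 15) c18 a4 (by norm_num) (fun h => h15 (by tauto))
  have a6 := adjB_sound (i := 13) b18 a5 (by norm_num) (fun h => h13 (by tauto))
  have a7 := adjB_sound (i := 8) b36 a6 (by norm_num) (fun h => h8 (by tauto))
  have a8 := adjB_sound (i := 5) b72 a7 (by norm_num) (fun h => h5 (by tauto))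
  exact a8.mono le_rfl (fun i hi => by tauto)

theorem lv0_eq (c9 d9 : Bool) (f : ℕ → ℕ → ℕ) : lv0 c9 d9 (tab f) =
    sho 18 (sho 17 (f c9.toNat d9.toNat) (f (c9.toNat + 1) d9.toNat))
      (sho 17 (f c9.toNat (d9.toNat + 1)) (f (c9.toNat + 1) (d9.toNat + 1))) := by
  cases c9 <;> cases d9 <;> rfl

theorem up_sound (l : List ℕ) {F m R : ℕ} (hm : F.testBit m = true) (hR : ∀ i ∈ l, R.testBit i = true → i < 20)
    (hm20 : m < 2 ^ 20) (hsub : Sub m R) : 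
    ∃ m', (up l F).testBit m' = true ∧ m' < 2 ^ 20 ∧ Sub m' R ∧ Sub m m' ∧ ∀ i ∈ l, R.testBit i = true → m'.testBit i = true := by
  induction l with
  | nil => exact ⟨m, hm, hm20, hsub, fun i hi => hi, fun i hi => absurd hi (by simp)⟩
  | cons a l ih =>
    obtain ⟨m', h1, h2, h3, h4, h5⟩ := ih (fun i hi => hR i (List.mem_cons_of_mem _ hi))
    show ∃ m', ((up l F) ||| ((up l F &&& notS a) <<< (2 ^ a))).testBit m' = true ∧ _
    by_cases ha : R.testBit a = true ∧ m'.testBit a = false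
    · obtain ⟨ha1, ha2⟩ := ha
      refine ⟨m' + 2 ^ a, ?_, ?_, fun i hi => ?_, fun i hi => ?_, fun i hi hr => ?_⟩
      · rw [Nat.testBit_or, Nat.testBit_shiftLeft, Nat.add_sub_cancel, Nat.testBit_and, h1, tb_notS a m' ha2 h2]; simp
      · have ha20 := hR a List.mem_cons_self ha1
        apply Nat.lt_pow_two_of_testBit
        intro i hi
        rw [tb_add ha2, Nat.testBit_lt_two_pow (lt_of_lt_of_le h2 (Nat.pow_le_pow_right (by norm_num) hi))]
        simp; omega
      · rw [tb_add ha2] at hi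
        cases h : m'.testBit i
        · rw [h] at hi; simp at hi; rw [hi]; exact ha1
        · exact h3 i h
      · rw [tb_add ha2, h4 i hi]; rfl
      · rw [tb_add ha2]
        rcases List.mem_cons.1 hi with rfl | hi
        · simp
        · rw [h5 i hi hr]; rfl
    · refine ⟨m', by rw [Nat.testBit_or, h1]; rfl, h2, h3, h4, fun i hi hr => ?_⟩
      rcases List.mem_cons.1 hi with rfl | hi
      · cases h : m'.testBit i
        · exact absurd ⟨hr, h⟩ ha
        · rfl
      · exact h5 i hi hr

def SPEC : List ℕ := [0,1,4,7,9,10,12,14,16,17,18,19]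

theorem lv0_sound {f : ℕ → ℕ → ℕ} {R : ℕ} (c9 d9 : Bool)
    (hs : SatB 17 (f ((R.testBit 17).toNat + c9.toNat) ((R.testBit 18).toNat + d9.toNat)) (fun i => R.testBit i = true)) :
    SatB 19 (lv0 c9 d9 (tab f)) (fun i => R.testBit i = true) := by
  rw [lv0_eq]
  cases h17 : R.testBit 17 <;> cases h18 : R.testBit 18 <;> rw [h17, h18] at hs <;> 
    simp only [Bool.toNat_false, Bool.toNat_true, Nat.zero_add, Nat.add_comm 1] at hs
  · exact SatB.left (SatB.left (hs.mono (by norm_num) fun i hi => hi))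
  · exact SatB.shift (SatB.left (hs.mono (le_refl 17) fun i hi => hi)) (by norm_num) h18
  · exact SatB.left ((SatB.shift hs (le_refl _) h17).mono (by norm_num) fun i hi => hi)
  · exact SatB.shift (SatB.shift hs (le_refl _) h17) (by norm_num) h18

theorem fam_sound {f2 f3 : ℕ → ℕ → ℕ} {R : ℕ} {S : ℕ → Prop} (b72 b36 b18 c18 c9 d9 : Bool)
    (hR : ∀ i, R.testBit i = true → i ∈ SPEC)
    (hS : ∀ i, S i → R.testBit i = true ∨ i = 2 ∨ i = 3 ∨ i = 6 ∨ i = 11 ∨ (i = 5 ∧ b72 = true) ∨ 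
      (i = 8 ∧ b36 = true) ∨ (i = 13 ∧ b18 = true) ∨ (i = 15 ∧ c18 = true))
    (hs : SatB 17 ((bif R.testBit 19 then f3 else f2) ((R.testBit 17).toNat + c9.toNat) ((R.testBit 18).toNat + d9.toNat)) S) :
    (fam (tab f2) (tab f3) b72 b36 b18 c18 c9 d9).testBit R = true := by
  have hn : ∀ i, i ∉ SPEC → R.testBit i = false := by
    intro i hi
    cases h : R.testBit i
    · rfl
    · exact absurd (hR i h) hi
  have key : ∀ f : ℕ → ℕ → ℕ, SatB 17 (f ((R.testBit 17).toNat + c9.toNat) ((R.testBit 18).toNat + d9.toNat)) S →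
      SatB 19 (lv0 c9 d9 (mapL (mapL (adj b72 b36 b18 c18)) (tab f))) (fun i => R.testBit i = true) := by
    intro f hf
    have h2 := adj_sound b72 b36 b18 c18 hf
      (fun h => by simpa [hn 5 (by decide)] using hS 5 h) (fun h => by simpa [hn 8 (by decide)] using hS 8 h)
      (fun h => by simpa [hn 13 (by decide)] using hS 13 h) (fun h => by simpa [hn 15 (by decide)] using hS 15 h)
    have e : mapL (mapL (adj b72 b36 b18 c18)) (tab f) = tab (fun h g => adj b72 b36 b18 c18 (f h g)) := rfl
    rw [e]
    refine lv0_sound c9 d9 (h2.mono le_rfl fun i hi => ?_)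
    have := hS i hi.1
    tauto
  have h20 : SatB 20 ((lv0 c9 d9 (mapL (mapL (adj b72 b36 b18 c18)) (tab f2))) |||
     ((lv0 c9 d9 (mapL (mapL (adj b72 b36 b18 c18)) (tab f3))) <<< (2 ^ 19))) (fun i => R.testBit i = true) := by
    cases h19 : R.testBit 19
    · rw [h19] at hs
      exact SatB.left ((key f2 hs).mono (by norm_num) fun i hi => hi)
    · rw [h19] at hs
      exact SatB.shift (key f3 hs) (le_refl _) h19
  obtain ⟨m, h1, h2, h3⟩ := h20
  obtain ⟨m', k1, k2, k3, k4, k5⟩ := up_sound SPEC h1 (R := R) (fun i hi _ => (by decide : ∀ i ∈ SPEC, i < 20) i hi) h2 h3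
  have : m' = R := by
    apply Nat.eq_of_testBit_eq; intro i
    cases h : R.testBit i
    · cases h' : m'.testBit i
      · rfl
      · rw [k3 i h'] at h; cases h
    · exact k5 i (hR i h) h
  rw [this] at k1
  exact k1
end CS

set_option autoImplicit false
namespace CS
abbrev Fm := Bool → Bool → Bool → Bool → Bool → Bool → ℕ
abbrev fmx (fm : Fm) (X : Fin 7 → Bool) : ℕ := fm (X 3) (X 2) (X 1) (X 5) (X 4) (X 6)

theorem andB_true {a b : Bool} (h : andB a b = true) : a = true ∧ b = true := by
  cases a
  · cases h
  · exact ⟨rfl, h⟩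

theorem z_land {a b m : ℕ} (h : z (Nat.land a b) = true) (ha : a.testBit m = true) (hb : b.testBit m = true) : False := by
  have h0 : a &&& b = 0 := Nat.eq_of_beq_eq_true h
  have : (a &&& b).testBit m = true := by rw [Nat.testBit_and, ha, hb]; rfl
  rw [h0] at this; simp at this

theorem tland {a b m : ℕ} : (Nat.land a b).testBit m = (a.testBit m && b.testBit m) := Nat.testBit_and a b m
theorem tlor {a b m : ℕ} : (Nat.lor a b).testBit m = (a.testBit m || b.testBit m) := Nat.testBit_or a b m

theorem xall_true {fm : Fm} {D2 : ℕ} (h : xall fm D2 = true) (a b c d : Bool) : xchk fm D2 a b c d = true := by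
  unfold xall at h
  obtain ⟨h0, h⟩ := andB_true h
  obtain ⟨h1, h⟩ := andB_true h
  obtain ⟨h2, h⟩ := andB_true h
  obtain ⟨h3, h⟩ := andB_true h
  obtain ⟨h4, h⟩ := andB_true h
  obtain ⟨h5, h⟩ := andB_true h
  obtain ⟨h6, h⟩ := andB_true h
  obtain ⟨h7, h⟩ := andB_true h
  obtain ⟨h8, h⟩ := andB_true h
  obtain ⟨h9, h⟩ := andB_true h
  obtain ⟨h10, h⟩ := andB_true h
  obtain ⟨h11, h⟩ := andB_true h
  obtain ⟨h12, h⟩ := andB_true h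
  obtain ⟨h13, h⟩ := andB_true h
  obtain ⟨h14, h⟩ := andB_true h
  cases a <;> cases b <;> cases c <;> cases d <;> assumption

section
variable {fm : Fm} {R : Fin 3 → ℕ} {p : Fin 7 → Fin 3 × Fin 3}

/-- the class `k` has an empty cell -/
def lucky (p : Fin 7 → Fin 3 × Fin 3) (k : Fin 3) : Prop := ∃ j, ∀ i, p i ≠ (k, j)

def Hyp (fm : Fm) (R : Fin 3 → ℕ) (p : Fin 7 → Fin 3 × Fin 3) : Prop :=
  ∀ k j, p 0 ≠ (k, j) → ∀ X : Fin 7 → Bool, (∀ i, p i = (k, j) → X i = true) → (fmx fm X).testBit (R k) = true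

theorem Hyp.lucky (H : Hyp fm R p) {k : Fin 3} (hk : lucky p k) (X : Fin 7 → Bool) : (fmx fm X).testBit (R k) = true := by
  obtain ⟨j, hj⟩ := hk
  exact H k j (hj 0) X (fun i hi => absurd hi (hj i))

theorem D1_bit (H : Hyp fm R p) {k : Fin 3} (hk : lucky p k) (hR : ∀ k, R k < 2 ^ 20) {T : ℕ} (hT : T < 2 ^ 20)
    (hd : Dsj T (R k)) : (pd (fm false false false false false false) (allS 20)).testBit T = true := by
  refine pd_sound (H.lucky hk (fun _ => false)) (fun m' hm' => ?_) hd (hR k) hT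
  have hlt : m' < 2 ^ 20 := by
    apply Nat.lt_pow_two_of_testBit
    intro i hi
    cases h : m'.testBit i
    · rfl
    · have := hm' i h
      rw [Nat.testBit_lt_two_pow (lt_of_lt_of_le (hR k) (Nat.pow_le_pow_right (by norm_num) hi))] at this
      cases this
  rw [tb_allS]
  exact decide_eq_true (Nat.or_lt_two_pow hT hlt)

/-- combine with a class `b` whose residue set has the property `F` -/
theorem PD_bit (H : Hyp fm R p) {a b k : Fin 3} (hk : lucky p k) (hR : ∀ k, R k < 2 ^ 20)
    (hd : ∀ k l, k ≠ l → Dsj (R k) (R l)) (hab : a ≠ b) (hak : a ≠ k) (hbk : b ≠ k) {F : ℕ}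
    (hF : F.testBit (R b) = true) :
    (pd F (pd (fm false false false false false false) (allS 20))).testBit (R a) = true := by
  refine pd_sound hF (fun m' hm' => ?_) (hd a b hab) (hR b) (hR a)
  have hlt : m' < 2 ^ 20 := by
    apply Nat.lt_pow_two_of_testBit
    intro i hi
    cases h : m'.testBit i
    · rfl
    · have := hm' i h
      rw [Nat.testBit_lt_two_pow (lt_of_lt_of_le (hR b) (Nat.pow_le_pow_right (by norm_num) hi))] at this
      cases this
  refine D1_bit H hk hR (Nat.or_lt_two_pow (hR a) hlt) (fun i h1 h2 => ?_)
  rw [Nat.testBit_or, Bool.or_eq_true] at h1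
  rcases h1 with h1 | h1
  · exact hd a k hak i h1 h2
  · exact hd b k hbk i (hm' i h1) h2

set_option synthInstance.maxHeartbeats 400000 in
set_option synthInstance.maxSize 1000 in
theorem h012_aux : ∀ (a : Fin 3) (p0 p1 p2 : Fin 3 × Fin 3), (p0 ≠ (a, 0) → p1 ≠ (a, 0) → p2 = (a, 0)) →
    (p0 ≠ (a, 1) → p1 ≠ (a, 1) → p2 = (a, 1)) → (p0 ≠ (a, 2) → p1 ≠ (a, 2) → p2 = (a, 2)) →
    ∃ j1 j2, p1 = (a, j1) ∧ p2 = (a, j2) ∧ j1 ≠ j2 ∧ p0 ≠ (a, j1) ∧ p0 ≠ (a, j2) := by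
  decide +kernel

theorem case1 (H : Hyp fm R p) (hR : ∀ k, R k < 2 ^ 20) (hd : ∀ k l, k ≠ l → Dsj (R k) (R l))
    (hc : chkFam fm (pd (fm false false false false false false) (allS 20)) = true) {a b c : Fin 3}
    (hb : lucky p b) (hcl : lucky p c) (hab : a ≠ b) (hac : a ≠ c) (hbc : b ≠ c) : False := by
  have hD2 := PD_bit H hcl hR hd hab hac hbc (H.lucky hb (fun _ => false))
  unfold chkFam at hc
  obtain ⟨h1, hc⟩ := andB_true hc
  obtain ⟨h2, hc⟩ := andB_true hc
  by_cases hex : ∃ j, p 0 ≠ (a, j) ∧ p 1 ≠ (a, j) ∧ p 2 ≠ (a, j)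
  · obtain ⟨j, j0, j1, j2⟩ := hex
    refine z_land h1 hD2 (H a j j0 (fun i => decide (3 ≤ i.val)) (fun i hi => ?_))
    fin_cases i <;> first | rfl | (exfalso; tauto)
  · push Not at hex
    have h012 := h012_aux a (p 0) (p 1) (p 2) (hex 0) (hex 1) (hex 2)
    obtain ⟨j1, j2, q1, q2, q12, q01, q02⟩ := h012
    have hx := xall_true h2 (decide (p 3 = (a, j1))) (decide (p 5 = (a, j1))) (decide (p 4 = (a, j1))) (decide (p 6 = (a, j1)))
    unfold xchk at hx
    refine z_land hx hD2 ?_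
    rw [tland]
    have f1 := H a j1 q01 (fun i => if i = 1 then true else if i = 2 then false else decide (p i = (a, j1))) (fun i hi => by
      by_cases i1 : i = 1
      · simp [i1]
      · by_cases i2 : i = 2
        · subst i2; rw [q2] at hi; simp at hi; exact absurd hi.symm q12
        · simp [i1, i2, hi])
    have f2 := H a j2 q02 (fun i => if i = 1 then false else if i = 2 then true else !decide (p i = (a, j1))) (fun i hi => by
      by_cases i1 : i = 1
      · subst i1; rw [q1] at hi; simp at hi; exact absurd hi q12
      · by_cases i2 : i = 2
        · simp [i2]
        · simp [i1, i2, hi, Ne.symm q12])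
    rw [Bool.and_eq_true]
    exact ⟨f1, f2⟩


theorem case2 (H : Hyp fm R p) (hR : ∀ k, R k < 2 ^ 20) (hd : ∀ k l, k ≠ l → Dsj (R k) (R l))
    (hchk : chkFam fm (pd (fm false false false false false false) (allS 20)) = true) {b c d : Fin 3}
    (hbc : b ≠ c) (hdb : d ≠ b) (hdc : d ≠ c) (u v : Fin 3 → Fin 7) (w : Fin 7)
    (hu : ∀ j, p (u j) = (b, j)) (hv : ∀ j, p (v j) = (c, j)) (hwu : ∀ j, u j ≠ w) (hwv : ∀ j, v j ≠ w)
    (hall : ∀ i, (∃ j, u j = i) ∨ (∃ j, v j = i) ∨ i = w) (hwb : (p w).1 ≠ b) : False := by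
  have ui : ∀ i j, u i = u j → i = j := by
    intro i j h
    have := hu i
    rw [h, hu j] at this
    exact (Prod.mk.inj this).2.symm
  have vi : ∀ i j, v i = v j → i = j := by
    intro i j h
    have := hv i
    rw [h, hv j] at this
    exact (Prod.mk.inj this).2.symm
  have hld : lucky p d := by
    have : ∃ j : Fin 3, j ≠ (p w).2 := by
      generalize (p w).2 = q
      revert q; decide
    obtain ⟨j, hj⟩ := this
    refine ⟨j, fun i hi => ?_⟩
    rcases hall i with ⟨k, rfl⟩ | ⟨k, rfl⟩ | rfl
    · rw [hu] at hi; exact hdb (Prod.mk.inj hi).1.symm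
    · rw [hv] at hi; exact hdc (Prod.mk.inj hi).1.symm
    · rw [hi] at hj; exact hj rfl
  have cb : ∀ i j, p i = (b, j) → i = u j := by
    intro i j hi
    rcases hall i with ⟨k, rfl⟩ | ⟨k, rfl⟩ | rfl
    · rw [hu] at hi; rw [(Prod.mk.inj hi).2]
    · rw [hv] at hi; exact absurd (Prod.mk.inj hi).1.symm hbc
    · rw [hi] at hwb; exact absurd rfl hwb
  have cc : ∀ i j, p i = (c, j) → i = v j ∨ i = w := by
    intro i j hi
    rcases hall i with ⟨k, rfl⟩ | ⟨k, rfl⟩ | rfl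
    · rw [hu] at hi; exact absurd (Prod.mk.inj hi).1 hbc
    · rw [hv] at hi; rw [(Prod.mk.inj hi).2]; exact Or.inl rfl
    · exact Or.inr rfl
  have FB : ∀ j, u j ≠ 0 → ∀ X : Fin 7 → Bool, X (u j) = true → (fmx fm X).testBit (R b) = true := by
    intro j h0 X hX
    refine H b j (fun h => h0 (cb 0 j h).symm) X (fun i hi => ?_)
    rw [cb i j hi]; exact hX
  have FC : ∀ j, v j ≠ 0 → w ≠ 0 → ∀ X : Fin 7 → Bool, X (v j) = true → X w = true → (fmx fm X).testBit (R c) = true := by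
    intro j h0 h1 X hX hw
    refine H c j (fun h => ?_) X (fun i hi => ?_)
    · rcases cc 0 j h with h | h
      · exact h0 h.symm
      · exact h1 h.symm
    · rcases cc i j hi with rfl | rfl
      · exact hX
      · exact hw
  have FC1 : ∀ j, v j ≠ 0 → p w ≠ (c, j) → ∀ X : Fin 7 → Bool, X (v j) = true → (fmx fm X).testBit (R c) = true := by
    intro j h0 h1 X hX
    refine H c j (fun h => ?_) X (fun i hi => ?_)
    · rcases cc 0 j h with h' | h'
      · exact h0 h'.symm
      · rw [h'] at h; exact h1 h
    · rcases cc i j hi with rfl | rfl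
      · exact hX
      · exact absurd hi h1
  have big : ∀ f : Fin 3 → Fin 7, (∀ i j, f i = f j → i = j) → ∃ j, 2 ≤ f j := by
    intro f hf
    by_contra hcon
    push Not at hcon
    have h0 := hcon 0
    have h1 := hcon 1
    have h2 := hcon 2
    have g01 : f 0 ≠ f 1 := fun h => absurd (hf _ _ h) (by decide)
    have g02 : f 0 ≠ f 2 := fun h => absurd (hf _ _ h) (by decide)
    have g12 : f 1 ≠ f 2 := fun h => absurd (hf _ _ h) (by decide)
    generalize f 0 = a0 at *
    generalize f 1 = a1 at *
    generalize f 2 = a2 at *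
    omega
  unfold chkFam at hchk
  obtain ⟨-, hchk⟩ := andB_true hchk
  obtain ⟨-, hchk⟩ := andB_true hchk
  obtain ⟨hP, hchk⟩ := andB_true hchk
  obtain ⟨hZ1, hchk⟩ := andB_true hchk
  obtain ⟨hZ2, hZ3⟩ := andB_true hchk
  have G5 : ∀ (x : Fin 7) (k : Fin 3), 2 ≤ x → (∀ X : Fin 7 → Bool, X x = true → (fmx fm X).testBit (R k) = true) →
      (or3 (fm true false false false false false) (fm false true false false false false) (or3 (fm false false false true false false) (fm false false false false true false) (fm false false false false false true))).testBit (R k) = true := by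
    intro x k hx hX
    have h := hX (fun i => decide (i = x)) (by simp)
    unfold fmx at h
    simp only [or3, tlor]
    match x, hx, h with
    | 2, _, h => have h : (fm false true false false false false).testBit (R k) = true := h
                 simp [h]
    | 3, _, h => have h : (fm true false false false false false).testBit (R k) = true := h
                 simp [h]
    | 4, _, h => have h : (fm false false false false true false).testBit (R k) = true := h
                 simp [h]
    | 5, _, h => have h : (fm false false false true false false).testBit (R k) = true := h
                 simp [h]
    | 6, _, h => have h : (fm false false false false false true).testBit (R k) = true := h
                 simp [h]
  obtain ⟨ju, hju⟩ := big u ui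
  have ge0 : ∀ x : Fin 7, 2 ≤ x → x ≠ 0 := by decide
  by_cases hex : ∃ j, 2 ≤ v j ∧ p w ≠ (c, j)
  · obtain ⟨j, hj, hjw⟩ := hex
    exact z_land hP (PD_bit H hld hR hd hbc.symm hdc.symm hdb.symm (G5 (u ju) b hju (FB ju (ge0 _ hju))))
      (G5 (v j) c hj (FC1 j (ge0 _ hj) hjw))
  push Not at hex
  obtain ⟨j0, hj0⟩ := big v vi
  have hw0 := hex j0 hj0
  have hoth : ∀ j, j ≠ j0 → v j < 2 := by
    intro j hj
    by_contra hcon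
    have := hex j (not_lt.1 hcon)
    rw [hw0] at this
    exact hj (Prod.mk.inj this).2.symm
  have h2 : ∃ j1 j2 : Fin 3, j1 ≠ j0 ∧ j2 ≠ j0 ∧ j1 ≠ j2 := by
    clear hoth hw0 hj0
    revert j0; decide
  have h1 : ∃ j1 j2, j1 ≠ j0 ∧ j2 ≠ j0 ∧ v j1 = 1 ∧ v j2 = 0 := by
    obtain ⟨j1, j2, a1, a2, a3⟩ := h2
    have b1 := hoth j1 a1
    have b2 := hoth j2 a2
    have b3 : v j1 ≠ v j2 := fun h => a3 (vi _ _ h)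
    by_cases e : v j1 = 1
    · exact ⟨j1, j2, a1, a2, e, by omega⟩
    · exact ⟨j2, j1, a2, a1, by omega, by omega⟩
  obtain ⟨j1, j2, hj1, hj2, v1, v2⟩ := h1
  have w0 : w ≠ 0 := fun h => hwv j2 (by rw [v2, h])
  have w1 : w ≠ 1 := fun h => hwv j1 (by rw [v1, h])
  have S : ∀ x : Fin 7, 2 ≤ x → x ≠ v j0 → x ≠ w → ∀ X : Fin 7 → Bool, X x = true → (fmx fm X).testBit (R b) = true := by
    intro x hx hxv hxw X hX
    rcases hall x with ⟨k, rfl⟩ | ⟨k, rfl⟩ | h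
    · exact FB k (ge0 _ hx) X hX
    · exfalso
      have : k ≠ j0 := fun h => hxv (by rw [h])
      exact absurd (hoth k this) (not_lt.2 hx)
    · exact absurd h hxw
  have P := FC j0 (ge0 _ hj0) w0
  have f18 : (fm false false true false false false).testBit (R c) = true := by
    refine FC1 j1 (by rw [v1]; decide) ?_ (fun i => decide (i = 1)) (by rw [v1]; rfl)
    rw [hw0]; intro h; exact hj1 (Prod.mk.inj h).2.symm
  have hvw := hwv j0
  generalize v j0 = y at *
  have Z1 := fun hF hp => z_land hZ1 (m := R c) (by rw [tland, f18, PD_bit H hld hR hd hbc.symm hdc.symm hdb.symm hF]; rfl) hp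
  have Z2 := fun hF hp => z_land hZ2 (m := R c) (by rw [tland, f18, PD_bit H hld hR hd hbc.symm hdc.symm hdb.symm hF]; rfl) hp
  have Z3 := fun hF hp => z_land hZ3 (m := R c) (by rw [tland, f18, PD_bit H hld hR hd hbc.symm hdc.symm hdb.symm hF]; rfl) hp
  simp only [mj3, or3, tland, tlor] at Z1 Z2 Z3
  have s2 : (2 : Fin 7) ≠ y → 2 ≠ w → (fm false true false false false false).testBit (R b) = true := fun h1 h2 => S 2 (by decide) h1 h2 (fun i => decide (i = 2)) rfl
  have s3 : (3 : Fin 7) ≠ y → 3 ≠ w → (fm true false false false false false).testBit (R b) = true := fun h1 h2 => S 3 (by decide) h1 h2 (fun i => decide (i = 3)) rfl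
  have s4 : (4 : Fin 7) ≠ y → 4 ≠ w → (fm false false false false true false).testBit (R b) = true := fun h1 h2 => S 4 (by decide) h1 h2 (fun i => decide (i = 4)) rfl
  have s5 : (5 : Fin 7) ≠ y → 5 ≠ w → (fm false false false true false false).testBit (R b) = true := fun h1 h2 => S 5 (by decide) h1 h2 (fun i => decide (i = 5)) rfl
  have s6 : (6 : Fin 7) ≠ y → 6 ≠ w → (fm false false false false false true).testBit (R b) = true := fun h1 h2 => S 6 (by decide) h1 h2 (fun i => decide (i = 6)) rfl
  have hp := P (fun i => decide (i = y ∨ i = w)) (by simp) (by simp)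
  unfold fmx at hp
  have hw2 : 2 ≤ w := by omega
  clear hd hR hchk hju
  clear P S G5 FC FC1 FB H hP hZ1 hZ2 hZ3 hall hex hoth f18 big cb cc ui vi w0 w1 hu hv hwu hwv hw0 hwb hld
  fin_cases y <;> first | (exfalso; revert hj0; decide) | skip
  all_goals fin_cases w <;> first | (exfalso; revert hw2; decide) | (exfalso; exact hvw rfl) | skip
  all_goals simp at s2 s3 s4 s5 s6 hp
  all_goals first
    | (refine Z1 ?_ ?_ <;> (simp [s2, s3, s4, s5, s6, hp]; done))
    | (refine Z2 ?_ ?_ <;> (simp [s2, s3, s4, s5, s6, hp]; done))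
    | (refine Z3 ?_ ?_ <;> (simp [s2, s3, s4, s5, s6, hp]; done))

theorem nine_false (H : Hyp fm R p) (hR : ∀ k, R k < 2 ^ 20) (hd : ∀ k l, k ≠ l → Dsj (R k) (R l))
    (hchk : chkFam fm (pd (fm false false false false false false) (allS 20)) = true) : False := by
  have two : ∀ b c : Fin 3, b ≠ c → ¬ lucky p b → ¬ lucky p c → False := by
    intro b c hbc hb hc
    unfold lucky at hb hc
    push Not at hb hc
    choose u hu using hb
    choose v hv using hc
    have hd3 : ∃ d : Fin 3, d ≠ b ∧ d ≠ c := by clear hu hv; revert b c; intro b c _ ; revert b c; decide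
    obtain ⟨d, hdb, hdc⟩ := hd3
    have ui : ∀ i j, u i = u j → i = j := by
      intro i j h
      have := hu i
      rw [h, hu j] at this
      exact (Prod.mk.inj this).2.symm
    have vi : ∀ i j, v i = v j → i = j := by
      intro i j h
      have := hv i
      rw [h, hv j] at this
      exact (Prod.mk.inj this).2.symm
    have uv : ∀ i j, u i ≠ v j := by
      intro i j h
      have := hu i
      rw [h, hv j] at this
      exact hbc (Prod.mk.inj this).1.symm
    have hU : (Finset.univ.image u ∪ Finset.univ.image v).card = 6 := by
      rw [Finset.card_union_of_disjoint, Finset.card_image_of_injective _ (fun i j => ui i j),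
        Finset.card_image_of_injective _ (fun i j => vi i j)]
      · rfl
      · rw [Finset.disjoint_left]
        intro x hx hy
        simp only [Finset.mem_image, Finset.mem_univ, true_and] at hx hy
        obtain ⟨i, rfl⟩ := hx
        obtain ⟨j, hj⟩ := hy
        exact uv i j hj.symm
    have hc1 : (Finset.univ.image u ∪ Finset.univ.image v)ᶜ.card = 1 := by
      rw [Finset.card_compl, hU]; rfl
    obtain ⟨w, hw⟩ := Finset.card_eq_one.1 hc1
    have hww : ∀ i, i = w ↔ ¬ ((∃ j, u j = i) ∨ ∃ j, v j = i) := by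
      intro i
      rw [← Finset.mem_singleton, ← hw]; simp
    have hwu : ∀ j, u j ≠ w := fun j h => ((hww (u j)).1 h) (Or.inl ⟨j, rfl⟩)
    have hwv : ∀ j, v j ≠ w := fun j h => ((hww (v j)).1 h) (Or.inr ⟨j, rfl⟩)
    have hall : ∀ i, (∃ j, u j = i) ∨ (∃ j, v j = i) ∨ i = w := by
      intro i
      by_cases h : (∃ j, u j = i) ∨ ∃ j, v j = i
      · exact h.elim Or.inl (fun h => Or.inr (Or.inl h))
      · exact Or.inr (Or.inr ((hww i).2 h))
    by_cases h : (p w).1 = b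
    · refine case2 H hR hd hchk hbc.symm hdc hdb v u w hv hu hwv hwu (fun i => (hall i).elim (fun h => Or.inr (Or.inl h)) (fun h => h.elim Or.inl (fun h => Or.inr (Or.inr h)))) ?_
      rw [h]; exact hbc
    · exact case2 H hR hd hchk hbc hdb hdc u v w hu hv hwu hwv hall h
  by_cases h0 : lucky p 0 <;> by_cases h1 : lucky p 1 <;> by_cases h2 : lucky p 2
  · exact case1 H hR hd hchk (a := 2) h0 h1 (by decide) (by decide) (by decide)
  · exact case1 H hR hd hchk (a := 2) h0 h1 (by decide) (by decide) (by decide)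
  · exact case1 H hR hd hchk (a := 1) h0 h2 (by decide) (by decide) (by decide)
  · exact two 1 2 (by decide) h1 h2
  · exact case1 H hR hd hchk (a := 0) h1 h2 (by decide) (by decide) (by decide)
  · exact two 0 2 (by decide) h0 h2
  · exact two 0 1 (by decide) h0 h1
  · exact two 0 1 (by decide) h0 h1

end
end CS

set_option autoImplicit false
namespace CS

open Classical in
noncomputable def nb (P : Prop) : ℕ := if P then 1 else 0

theorem nb_congr {P Q : Prop} (h : P ↔ Q) : nb P = nb Q := by rw [propext h]
theorem nb_true {P : Prop} (h : P) : nb P = 1 := by unfold nb; exact if_pos h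
theorem nb_false {P : Prop} (h : ¬ P) : nb P = 0 := by unfold nb; exact if_neg h
theorem nb_le (P : Prop) : nb P ≤ 1 := by unfold nb; split_ifs <;> omega
theorem nb_pos {P : Prop} (h : 0 < nb P) : P := by
  by_contra hc
  rw [nb_false hc] at h; omega

theorem cI_nil' (c : ℕ) (S : ℕ → Prop) : cI c [] S = 0 := rfl
theorem cI_cons' (c t i : ℕ) (I : List (ℕ × ℕ)) (S : ℕ → Prop) :
    cI c ((t, i) :: I) S = (if min t 2 = c then nb (S i) else 0) + cI c I S := by
  classical
  rw [cI_cons]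
  congr 1
  by_cases h : min t 2 = c
  · rw [if_pos h]
    by_cases h' : S i
    · rw [nb_true h', if_pos ⟨h, h'⟩]
    · rw [nb_false h', if_neg (fun hh => h' hh.2)]
  · rw [if_neg h, if_neg (fun hh => h hh.1)]
theorem cS_nil' (c : ℕ) (y : ℕ) : cS c [] y = 0 := rfl
theorem cS_cons' (c l t r : ℕ) (s : Sig) (y : ℕ) :
    cS c ((l, t, r) :: s) y = (if 1 ≤ l ∧ min t 2 = c then nb (y % 2 ^ l = r % 2 ^ l) else 0) + cS c s y := by
  show (List.map _ ((l, t, r) :: s)).sum = _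
  rw [List.map_cons, List.sum_cons]
  congr 1
  by_cases h : 1 ≤ l ∧ min t 2 = c
  · rw [if_pos h]
    by_cases h' : y % 2 ^ l = r % 2 ^ l
    · rw [nb_true h', if_pos ⟨h.1, h.2, h'⟩]
    · rw [nb_false h', if_neg (fun hh => h' hh.2.2)]
  · rw [if_neg h, if_neg (fun hh => h ⟨hh.1, hh.2.1⟩)]

/-- exponent of two of each item -/
def lev : ℕ → ℕ
  | 0 => 4 | 1 => 4 | 2 => 4 | 3 => 4
  | 4 => 3 | 5 => 3 | 6 => 3
  | 7 => 2 | 8 => 2 | 9 => 2 | 10 => 2 | 11 => 2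
  | 12 => 1 | 13 => 1 | 14 => 1 | 15 => 1 | 16 => 1
  | 20 => 1 | 21 => 2 | 22 => 3 | 23 => 1 | 24 => 3
  | _ => 0

theorem lev_le (i : ℕ) : lev i ≤ 4 := by
  unfold lev; split <;> omega

def SH : List ℕ := [2, 3, 6, 11, 20, 21, 22, 23, 24]
def NINE : List ℕ := [27, 13, 8, 5, 25, 15, 26]

/-- the item is present on the residue class `t` mod 9 -/
def pres (w : ℕ → ℕ) (t i : ℕ) : Prop := i ∈ SH ∨ (i ∈ SPEC ∧ w i % 3 = t % 3) ∨ (i ∈ NINE ∧ w i % 9 = t % 9)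
def on (w ρ : ℕ → ℕ) (t y i : ℕ) : Prop := pres w t i ∧ y % 2 ^ lev i = ρ i % 2 ^ lev i

def ok (e h g : ℕ) : Prop := 4 ≤ h ∨ 6 ≤ g ∨ (4 - h) * (6 - g) ≤ e

theorem ok_mono {e h g h' g' : ℕ} (H : ok e h g) (hh : h ≤ h') (hg : g ≤ g') : ok e (min h' 4) (min g' 6) := by
  unfold ok at *
  rcases H with H | H | H
  · left; omega
  · right; left; omega
  · by_cases h4 : 4 ≤ h'
    · left; omega
    · by_cases g6 : 6 ≤ g'
      · right; left; omega
      · right; right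
        rw [min_eq_left (by omega), min_eq_left (by omega)]
        exact le_trans (Nat.mul_le_mul (by omega) (by omega)) H

instance (e h g : ℕ) : Decidable (ok e h g) := by unfold ok; infer_instance
def bet (e h g : ℕ) : ℕ := if ok e h g then 1 else 0
theorem bet_bit {e h g : ℕ} (H : ok e h g) : (bet e h g).testBit 0 = true := by
  unfold bet; rw [if_pos H]; rfl
theorem base2_eq : base2 = tab (bet 2) := by decide +kernel
theorem base3_eq : base3 = tab (bet 3) := by decide +kernel

noncomputable def nA (f : ℕ → Prop) : ℕ :=
  nb (f 0) + nb (f 1) + nb (f 2) + nb (f 4) + nb (f 5) + nb (f 7) + nb (f 8) + nb (f 12) + nb (f 13) + nb (f 22)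
/-- without the level zero items -/
noncomputable def nC (f : ℕ → Prop) : ℕ :=
  nb (f 20) + nb (f 21) + nb (f 24) + nb (f 3) + nb (f 14) + nb (f 9) + nb (f 15)
noncomputable def nD (f : ℕ → Prop) : ℕ :=
  nb (f 23) + nb (f 11) + nb (f 6) + nb (f 16) + nb (f 10)

def Q (w ρ : ℕ → ℕ) : Prop := ∀ t < 9, ∀ y : ℕ, on w ρ t y 27 ∨ 0 < nA (on w ρ t y) ∨
  ok (2 + nb (on w ρ t y 19)) (nC (on w ρ t y) + nb (on w ρ t y 17) + nb (on w ρ t y 25))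
    (nD (on w ρ t y) + nb (on w ρ t y 18) + nb (on w ρ t y 26))

/-- what the layout has to satisfy -/
def Lay (w ρ : ℕ → ℕ) (L : List (ℕ × List (ℕ × ℕ))) (s : Sig) : Prop :=
  L.length = 4 ∧ bd L = 17 ∧ okL L ∧ (∀ a ∈ s, a.1 ≤ 4) ∧ ∀ t y,
    cL 0 1 L (fun i => i < 17 ∧ pres w t i) ρ y + cS 0 s y = nA (on w ρ t y) ∧
    cL 1 1 L (fun i => i < 17 ∧ pres w t i) ρ y + cS 1 s y = nC (on w ρ t y) ∧
    cL 2 1 L (fun i => i < 17 ∧ pres w t i) ρ y + cS 2 s y = nD (on w ρ t y)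

theorem nbS {w ρ : ℕ → ℕ} {t y : ℕ} (i d : ℕ) (hi : i < 17) (hd : lev i = d) :
    nb ((i < 17 ∧ pres w t i) ∧ y % 2 ^ d = ρ i % 2 ^ d) = nb (on w ρ t y i) := by
  subst hd
  apply nb_congr
  unfold on; tauto
theorem nbF {w ρ : ℕ → ℕ} {t y : ℕ} (i d r : ℕ) (hi : i ∈ SH) (hd : lev i = d) (hr : ρ i % 2 ^ d = r % 2 ^ d) :
    nb (y % 2 ^ d = r % 2 ^ d) = nb (on w ρ t y i) := by
  subst hd
  apply nb_congr
  unfold on pres; rw [hr]; tauto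

def L5 : List (ℕ × List (ℕ × ℕ)) :=
  [(17, [(2,16),(1,15),(1,14),(0,13),(0,12)]), (12, [(2,11),(2,10),(1,9),(0,8),(0,7)]), (7, [(2,6),(0,5),(0,4)]), (4, [(1,3),(0,2),(0,1),(0,0)])]
def L6 : List (ℕ × List (ℕ × ℕ)) :=
  [(17, [(2,16),(1,15),(1,14),(0,13),(0,12)]), (12, [(2,10),(1,9),(0,8),(0,7)]), (7, [(2,6),(0,5),(0,4)]), (4, [(1,3),(0,2),(0,1),(0,0)])]
def L7 : List (ℕ × List (ℕ × ℕ)) :=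
  [(17, [(2,16),(1,15),(1,14),(0,13),(0,12)]), (12, [(2,10),(1,9),(0,8),(0,7)]), (7, [(2,6),(0,5),(0,4)]), (4, [(1,3),(0,1),(0,0)])]
def L8 : List (ℕ × List (ℕ × ℕ)) :=
  [(17, [(2,16),(1,15),(1,14),(0,13),(0,12)]), (12, [(2,10),(1,9),(0,8),(0,7)]), (7, [(0,5),(0,4)]), (4, [(1,3),(0,1),(0,0)])]

def agree (ρ : ℕ → ℕ) (σ : List (ℕ × ℕ)) : Prop := ∀ a ∈ σ, ρ a.1 % 2 ^ lev a.1 = a.2 % 2 ^ lev a.1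
def Dead (w : ℕ → ℕ) (σ : List (ℕ × ℕ)) : Prop := ∀ ρ, Q w ρ → agree ρ σ → False

theorem lay5 {w ρ : ℕ → ℕ} {r1 r2 r3 r4 r5 : ℕ} (h1 : ρ 20 % 2 ^ 1 = r1 % 2 ^ 1) (h2 : ρ 21 % 2 ^ 2 = r2 % 2 ^ 2) (h3 : ρ 22 % 2 ^ 3 = r3 % 2 ^ 3) (h4 : ρ 23 % 2 ^ 1 = r4 % 2 ^ 1) (h5 : ρ 24 % 2 ^ 3 = r5 % 2 ^ 3) :
    Lay w ρ L5 [(1,1,r1),(2,1,r2),(3,0,r3),(1,2,r4),(3,1,r5)] := by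
  refine ⟨rfl, rfl, by simp [L5, okL, okI, bnd, bd], by simp, fun t y => ?_⟩
  simp only [L5, cL, cI_cons', cI_nil', cS_cons', cS_nil', Nat.reduceAdd,
    nbS 0 4 (by decide) rfl, nbS 1 4 (by decide) rfl, nbS 2 4 (by decide) rfl, nbS 3 4 (by decide) rfl, nbS 4 3 (by decide) rfl, nbS 5 3 (by decide) rfl, nbS 6 3 (by decide) rfl, nbS 7 2 (by decide) rfl, nbS 8 2 (by decide) rfl, nbS 9 2 (by decide) rfl, nbS 10 2 (by decide) rfl, nbS 11 2 (by decide) rfl, nbS 12 1 (by decide) rfl, nbS 13 1 (by decide) rfl, nbS 14 1 (by decide) rfl, nbS 15 1 (by decide) rfl, nbS 16 1 (by decide) rfl,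
    nbF (w := w) (t := t) 20 1 r1 (by decide) rfl h1,
    nbF (w := w) (t := t) 21 2 r2 (by decide) rfl h2,
    nbF (w := w) (t := t) 22 3 r3 (by decide) rfl h3,
    nbF (w := w) (t := t) 23 1 r4 (by decide) rfl h4,
    nbF (w := w) (t := t) 24 3 r5 (by decide) rfl h5]
  simp +decide only [if_true, if_false]
  unfold nA nC nD
  refine ⟨?_, ?_, ?_⟩ <;> ac_rfl

theorem lay6 {w ρ : ℕ → ℕ} {r1 r2 r3 r4 r5 r6 : ℕ} (h1 : ρ 20 % 2 ^ 1 = r1 % 2 ^ 1) (h2 : ρ 21 % 2 ^ 2 = r2 % 2 ^ 2) (h3 : ρ 22 % 2 ^ 3 = r3 % 2 ^ 3) (h4 : ρ 23 % 2 ^ 1 = r4 % 2 ^ 1) (h5 : ρ 24 % 2 ^ 3 = r5 % 2 ^ 3) (h6 : ρ 11 % 2 ^ 2 = r6 % 2 ^ 2) :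
    Lay w ρ L6 [(1,1,r1),(2,1,r2),(3,0,r3),(1,2,r4),(3,1,r5),(2,2,r6)] := by
  refine ⟨rfl, rfl, by simp [L6, okL, okI, bnd, bd], by simp, fun t y => ?_⟩
  simp only [L6, cL, cI_cons', cI_nil', cS_cons', cS_nil', Nat.reduceAdd,
    nbS 0 4 (by decide) rfl, nbS 1 4 (by decide) rfl, nbS 2 4 (by decide) rfl, nbS 3 4 (by decide) rfl, nbS 4 3 (by decide) rfl, nbS 5 3 (by decide) rfl, nbS 6 3 (by decide) rfl, nbS 7 2 (by decide) rfl, nbS 8 2 (by decide) rfl, nbS 9 2 (by decide) rfl, nbS 10 2 (by decide) rfl, nbS 12 1 (by decide) rfl, nbS 13 1 (by decide) rfl, nbS 14 1 (by decide) rfl, nbS 15 1 (by decide) rfl, nbS 16 1 (by decide) rfl,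
    nbF (w := w) (t := t) 20 1 r1 (by decide) rfl h1,
    nbF (w := w) (t := t) 21 2 r2 (by decide) rfl h2,
    nbF (w := w) (t := t) 22 3 r3 (by decide) rfl h3,
    nbF (w := w) (t := t) 23 1 r4 (by decide) rfl h4,
    nbF (w := w) (t := t) 24 3 r5 (by decide) rfl h5,
    nbF (w := w) (t := t) 11 2 r6 (by decide) rfl h6]
  simp +decide only [if_true, if_false]
  unfold nA nC nD
  refine ⟨?_, ?_, ?_⟩ <;> ac_rfl

theorem lay7 {w ρ : ℕ → ℕ} {r1 r2 r3 r4 r5 r6 r7 : ℕ} (h1 : ρ 20 % 2 ^ 1 = r1 % 2 ^ 1) (h2 : ρ 21 % 2 ^ 2 = r2 % 2 ^ 2) (h3 : ρ 22 % 2 ^ 3 = r3 % 2 ^ 3) (h4 : ρ 23 % 2 ^ 1 = r4 % 2 ^ 1) (h5 : ρ 24 % 2 ^ 3 = r5 % 2 ^ 3) (h6 : ρ 11 % 2 ^ 2 = r6 % 2 ^ 2) (h7 : ρ 2 % 2 ^ 4 = r7 % 2 ^ 4) :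
    Lay w ρ L7 [(1,1,r1),(2,1,r2),(3,0,r3),(1,2,r4),(3,1,r5),(2,2,r6),(4,0,r7)] := by
  refine ⟨rfl, rfl, by simp [L7, okL, okI, bnd, bd], by simp, fun t y => ?_⟩
  simp only [L7, cL, cI_cons', cI_nil', cS_cons', cS_nil', Nat.reduceAdd,
    nbS 0 4 (by decide) rfl, nbS 1 4 (by decide) rfl, nbS 3 4 (by decide) rfl, nbS 4 3 (by decide) rfl, nbS 5 3 (by decide) rfl, nbS 6 3 (by decide) rfl, nbS 7 2 (by decide) rfl, nbS 8 2 (by decide) rfl, nbS 9 2 (by decide) rfl, nbS 10 2 (by decide) rfl, nbS 12 1 (by decide) rfl, nbS 13 1 (by decide) rfl, nbS 14 1 (by decide) rfl, nbS 15 1 (by decide) rfl, nbS 16 1 (by decide) rfl,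
    nbF (w := w) (t := t) 20 1 r1 (by decide) rfl h1,
    nbF (w := w) (t := t) 21 2 r2 (by decide) rfl h2,
    nbF (w := w) (t := t) 22 3 r3 (by decide) rfl h3,
    nbF (w := w) (t := t) 23 1 r4 (by decide) rfl h4,
    nbF (w := w) (t := t) 24 3 r5 (by decide) rfl h5,
    nbF (w := w) (t := t) 11 2 r6 (by decide) rfl h6,
    nbF (w := w) (t := t) 2 4 r7 (by decide) rfl h7]
  simp +decide only [if_true, if_false]
  unfold nA nC nD
  refine ⟨?_, ?_, ?_⟩ <;> ac_rfl

theorem lay8 {w ρ : ℕ → ℕ} {r1 r2 r3 r4 r5 r6 r7 r8 : ℕ} (h1 : ρ 20 % 2 ^ 1 = r1 % 2 ^ 1) (h2 : ρ 21 % 2 ^ 2 = r2 % 2 ^ 2) (h3 : ρ 22 % 2 ^ 3 = r3 % 2 ^ 3) (h4 : ρ 23 % 2 ^ 1 = r4 % 2 ^ 1) (h5 : ρ 24 % 2 ^ 3 = r5 % 2 ^ 3) (h6 : ρ 11 % 2 ^ 2 = r6 % 2 ^ 2) (h7 : ρ 2 % 2 ^ 4 = r7 % 2 ^ 4) (h8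 : ρ 6 % 2 ^ 3 = r8 % 2 ^ 3) :
    Lay w ρ L8 [(1,1,r1),(2,1,r2),(3,0,r3),(1,2,r4),(3,1,r5),(2,2,r6),(4,0,r7),(3,2,r8)] := by
  refine ⟨rfl, rfl, by simp [L8, okL, okI, bnd, bd], by simp, fun t y => ?_⟩
  simp only [L8, cL, cI_cons', cI_nil', cS_cons', cS_nil', Nat.reduceAdd,
    nbS 0 4 (by decide) rfl, nbS 1 4 (by decide) rfl, nbS 3 4 (by decide) rfl, nbS 4 3 (by decide) rfl, nbS 5 3 (by decide) rfl, nbS 7 2 (by decide) rfl, nbS 8 2 (by decide) rfl, nbS 9 2 (by decide) rfl, nbS 10 2 (by decide) rfl, nbS 12 1 (by decide) rfl, nbS 13 1 (by decide) rfl, nbS 14 1 (by decide) rfl, nbS 15 1 (by decide) rfl, nbS 16 1 (by decide) rfl,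
    nbF (w := w) (t := t) 20 1 r1 (by decide) rfl h1,
    nbF (w := w) (t := t) 21 2 r2 (by decide) rfl h2,
    nbF (w := w) (t := t) 22 3 r3 (by decide) rfl h3,
    nbF (w := w) (t := t) 23 1 r4 (by decide) rfl h4,
    nbF (w := w) (t := t) 24 3 r5 (by decide) rfl h5,
    nbF (w := w) (t := t) 11 2 r6 (by decide) rfl h6,
    nbF (w := w) (t := t) 2 4 r7 (by decide) rfl h7,
    nbF (w := w) (t := t) 6 3 r8 (by decide) rfl h8]
  simp +decide only [if_true, if_false]
  unfold nA nC nD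
  refine ⟨?_, ?_, ?_⟩ <;> ac_rfl


/-- mask of a set of small numbers -/
noncomputable def mk (P : ℕ → Prop) : ℕ → ℕ
  | 0 => 0
  | n + 1 => mk P n + 2 ^ n * nb (P n)
theorem mk_spec (P : ℕ → Prop) (n : ℕ) : mk P n < 2 ^ n ∧ ∀ i, (mk P n).testBit i = true ↔ (i < n ∧ P i) := by
  induction n with
  | zero => exact ⟨by simp [mk], fun i => by simp [mk]⟩
  | succ n ih =>
    have hb : (mk P n).testBit n = false := Nat.testBit_lt_two_pow ih.1
    unfold mk
    by_cases h : P n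
    · rw [nb_true h, Nat.mul_one]
      refine ⟨by rw [pow_succ]; have := ih.1; omega, fun i => ?_⟩
      rw [tb_add hb, Bool.or_eq_true, ih.2, decide_eq_true_iff]
      constructor
      · rintro (⟨h1, h2⟩ | rfl)
        · exact ⟨by omega, h2⟩
        · exact ⟨by omega, h⟩
      · rintro ⟨h1, h2⟩
        by_cases e : i = n
        · exact Or.inr e
        · exact Or.inl ⟨by omega, h2⟩
    · rw [nb_false h, Nat.mul_zero, Nat.add_zero]
      refine ⟨by rw [pow_succ]; have := ih.1; omega, fun i => ?_⟩
      rw [ih.2]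
      constructor
      · rintro ⟨h1, h2⟩
        exact ⟨by omega, h2⟩
      · rintro ⟨h1, h2⟩
        refine ⟨?_, h2⟩
        by_contra hc
        exact h (by rwa [show i = n by omega] at h2)

theorem toNat_nb {b : Bool} {P : Prop} (h : P → b = true) : nb P ≤ b.toNat := by
  by_cases hp : P
  · rw [nb_true hp, h hp]; exact le_refl 1
  · rw [nb_false hp]; exact Nat.zero_le _

theorem spec_lt {i : ℕ} (h : i ∈ SPEC) : i < 20 := by
  unfold SPEC at h; simp only [List.mem_cons, List.not_mem_nil, or_false] at h; omega

def nineIx (i : Fin 7) : ℕ := NINE.getD i.val 0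

theorem leaf {w ρ : ℕ → ℕ} {L : List (ℕ × List (ℕ × ℕ))} {s : Sig} (hL : Lay w ρ L s) (hQ : Q w ρ)
    (hc : check L s = true) : False := by
  obtain ⟨hlen, hbd, hokL, hs4, hcnt⟩ := hL
  unfold check chkTab at hc
  rw [base2_eq, base3_eq, tabV_tab, tabV_tab] at hc
  set R : Fin 3 → ℕ := fun k => mk (fun i => i ∈ SPEC ∧ w i % 3 = k.val) 20 with hRdef
  have hRb : ∀ k i, (R k).testBit i = true ↔ (i < 20 ∧ i ∈ SPEC ∧ w i % 3 = k.val) := fun k => (mk_spec _ 20).2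
  set p : Fin 7 → Fin 3 × Fin 3 := fun i =>
    (⟨w (nineIx i) % 3, Nat.mod_lt _ (by norm_num)⟩, ⟨w (nineIx i) % 9 / 3, by omega⟩) with hp
  have hpe : ∀ i k j, p i = (k, j) ↔ w (nineIx i) % 9 = k.val + 3 * j.val := by
    intro i k j
    rw [hp]
    simp only [Prod.mk.injEq, Fin.ext_iff]
    have := k.2
    have := j.2
    omega
  refine nine_false (R := R) (p := p) ?_ (fun k => (mk_spec _ 20).1) ?_ hc
  · intro k j h0 X hX
    have hk := k.2
    have hj := j.2
    set t := k.val + 3 * j.val with ht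
    have htk : t % 3 = k.val := by omega
    have ht9 : t < 9 := by omega
    have ht9' : t % 9 = t := Nat.mod_eq_of_lt ht9
    have hn : ∀ i : Fin 7, w (nineIx i) % 9 = t % 9 → X i = true := by
      intro i hi
      exact hX i ((hpe i k j).2 (by omega))
    have hn0 : w 27 % 9 ≠ t % 9 := by
      intro h
      exact h0 ((hpe 0 k j).2 (show w 27 % 9 = _ by omega))
    have hn1 : w 13 % 9 = t % 9 → X 1 = true := hn 1
    have hn2 : w 8 % 9 = t % 9 → X 2 = true := hn 2
    have hn3 : w 5 % 9 = t % 9 → X 3 = true := hn 3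
    have hn4 : w 25 % 9 = t % 9 → X 4 = true := hn 4
    have hn5 : w 15 % 9 = t % 9 → X 5 = true := hn 5
    have hn6 : w 26 % 9 = t % 9 → X 6 = true := hn 6
    refine fam_sound (S := fun i => i < 17 ∧ pres w t i) _ _ _ _ _ _ (fun i hi => ((hRb k i).1 hi).2.1) ?_ ?_
    · rintro i ⟨hi, h⟩
      rcases h with h | ⟨h, h'⟩ | ⟨h, h'⟩
      · unfold SH at h
        simp only [List.mem_cons, List.not_mem_nil, or_false] at h
        right; omega
      · left
        exact (hRb k i).2 ⟨by omega, h, by omega⟩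
      · unfold NINE at h
        simp only [List.mem_cons, List.not_mem_nil, or_false] at h
        rcases h with rfl | rfl | rfl | rfl | rfl | rfl | rfl
        · omega
        · simp [hn1 h']
        · simp [hn2 h']
        · simp [hn3 h']
        · omega
        · simp [hn5 h']
        · omega
    · have key : ∀ F (S : ℕ → Prop), SatB (bd L) F S → SatB 17 F S := by
        intro F S h; rw [hbd] at h; exact h
      apply key
      have h19 : (bif (R k).testBit 19 then fV (bet 3) L s else fV (bet 2) L s) = fV (bet (2 + ((R k).testBit 19).toNat)) L s := by
        cases (R k).testBit 19 <;> rfl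
      rw [h19]
      have tn : ∀ b : Bool, b.toNat ≤ 1 := fun b => by cases b <;> simp
      have t1 := tn ((R k).testBit 17)
      have t2 := tn ((R k).testBit 18)
      have t3 := tn (X 4)
      have t4 := tn (X 6)
      refine fV_sound _ L hokL s _ ρ _ _ (by rw [hlen]; exact hs4) (by omega) (by omega) (fun y _ => ?_)
      obtain ⟨hA, hC, hD⟩ := hcnt t y
      unfold good
      rw [hA, hC, hD]
      have hsp : ∀ i, i ∈ SPEC → i ∉ SH → i ∉ NINE → on w ρ t y i → (R k).testBit i = true := by
        intro i hi h1 h2 hon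
        rcases hon.1 with h | ⟨h, h'⟩ | ⟨h, h'⟩
        · exact absurd h h1
        · exact (hRb k i).2 ⟨spec_lt hi, hi, by omega⟩
        · exact absurd h h2
      have hnn : ∀ i, i ∉ SPEC → i ∉ SH → on w ρ t y i → w i % 9 = t % 9 := by
        intro i hi h1 hon
        rcases hon.1 with h | ⟨h, h'⟩ | ⟨h, h'⟩
        · exact absurd h h1
        · exact absurd h hi
        · exact h'
      rcases hQ t ht9 y with h | h | h
      · exact absurd (hnn 27 (by decide) (by decide) h) hn0
      · exact Or.inl h
      · right
        apply bet_bit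
        have e17 := toNat_nb (hsp 17 (by decide) (by decide) (by decide))
        have e18 := toNat_nb (hsp 18 (by decide) (by decide) (by decide))
        have e19 := toNat_nb (hsp 19 (by decide) (by decide) (by decide))
        have e25 := toNat_nb (fun h => hn4 (hnn 25 (by decide) (by decide) h))
        have e26 := toNat_nb (fun h => hn6 (hnn 26 (by decide) (by decide) h))
        have h' := ok_mono h (h' := (((R k).testBit 17).toNat + (X 4).toNat) + nC (on w ρ t y))
          (g' := (((R k).testBit 18).toNat + (X 6).toNat) + nD (on w ρ t y)) (by omega) (by omega)
        unfold ok at h' ⊢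
        rcases h' with h' | h' | h'
        · exact Or.inl h'
        · exact Or.inr (Or.inl h')
        · exact Or.inr (Or.inr (by omega))
  · intro k l hkl i hi hi'
    rw [hRb] at hi hi'
    exact hkl (Fin.ext (by omega))

theorem leaf5 (w : ℕ → ℕ) (r1 r2 r3 r4 r5 : ℕ) (hc : check L5 [(1,1,r1),(2,1,r2),(3,0,r3),(1,2,r4),(3,1,r5)] = true) :
    Dead w [(20,r1),(21,r2),(22,r3),(23,r4),(24,r5)] := fun ρ hQ ha => 
  leaf (lay5 (ha (20,r1) (by simp)) (ha (21,r2) (by simp)) (ha (22,r3) (by simp)) (ha (23,r4) (by simp)) (ha (24,r5) (by simp))) hQ hc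
theorem leaf6 (w : ℕ → ℕ) (r1 r2 r3 r4 r5 r6 : ℕ) (hc : check L6 [(1,1,r1),(2,1,r2),(3,0,r3),(1,2,r4),(3,1,r5),(2,2,r6)] = true) :
    Dead w [(20,r1),(21,r2),(22,r3),(23,r4),(24,r5),(11,r6)] := fun ρ hQ ha => 
  leaf (lay6 (ha (20,r1) (by simp)) (ha (21,r2) (by simp)) (ha (22,r3) (by simp)) (ha (23,r4) (by simp)) (ha (24,r5) (by simp)) (ha (11,r6) (by simp))) hQ hc
theorem leaf7 (w : ℕ → ℕ) (r1 r2 r3 r4 r5 r6 r7 : ℕ) (hc : check L7 [(1,1,r1),(2,1,r2),(3,0,r3),(1,2,r4),(3,1,r5),(2,2,r6),(4,0,r7)] = true) :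
    Dead w [(20,r1),(21,r2),(22,r3),(23,r4),(24,r5),(11,r6),(2,r7)] := fun ρ hQ ha => 
  leaf (lay7 (ha (20,r1) (by simp)) (ha (21,r2) (by simp)) (ha (22,r3) (by simp)) (ha (23,r4) (by simp)) (ha (24,r5) (by simp)) (ha (11,r6) (by simp)) (ha (2,r7) (by simp))) hQ hc
theorem leaf8 (w : ℕ → ℕ) (r1 r2 r3 r4 r5 r6 r7 r8 : ℕ) (hc : check L8 [(1,1,r1),(2,1,r2),(3,0,r3),(1,2,r4),(3,1,r5),(2,2,r6),(4,0,r7),(3,2,r8)] = true) :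
    Dead w [(20,r1),(21,r2),(22,r3),(23,r4),(24,r5),(11,r6),(2,r7),(6,r8)] := fun ρ hQ ha => 
  leaf (lay8 (ha (20,r1) (by simp)) (ha (21,r2) (by simp)) (ha (22,r3) (by simp)) (ha (23,r4) (by simp)) (ha (24,r5) (by simp)) (ha (11,r6) (by simp)) (ha (2,r7) (by simp)) (ha (6,r8) (by simp))) hQ hc

/-- tree automorphism of the integers modulo 16 -/
def phi (d q x : ℕ) : ℕ := if x % 2 ^ d = q then x + (16 - 2 ^ d) else x

theorem phi_mod {d q x x' l : ℕ} (hd : d < 4) (hl : l ≤ 4) : 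
    phi d q x % 2 ^ l = phi d q x' % 2 ^ l ↔ x % 2 ^ l = x' % 2 ^ l := by
  unfold phi
  interval_cases d <;> interval_cases l <;> simp only [Nat.reducePow, Nat.reduceSub] <;> split_ifs <;> omega

theorem phi_surj (d q y : ℕ) (hd : d < 4) : ∃ x, phi d q x % 16 = y % 16 := by
  refine ⟨if y % 2 ^ d = q then y + 2 ^ d else y, ?_⟩
  unfold phi
  interval_cases d <;> simp only [Nat.reducePow, Nat.reduceSub] <;> split_ifs <;> omega

theorem Q_phi {w ρ : ℕ → ℕ} (hQ : Q w ρ) (d q : ℕ) (hd : d < 4) : Q w (fun i => phi d q (ρ i)) := by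
  intro t ht y
  obtain ⟨x, hx⟩ := phi_surj d q y hd
  have : on w (fun i => phi d q (ρ i)) t y = on w ρ t x := by
    funext i
    apply propext
    unfold on
    have hl := lev_le i
    rw [← phi_mod (q := q) (x := x) (x' := ρ i) hd hl]
    have : phi d q x % 2 ^ lev i = y % 2 ^ lev i := by
      have h16 : 2 ^ lev i ∣ 16 := pow_dvd_pow 2 hl
      rw [← Nat.mod_mod_of_dvd (phi d q x) h16, hx, Nat.mod_mod_of_dvd _ h16]
    rw [this]
  rw [this]
  exact hQ t ht x

def canon (σ : List (ℕ × ℕ)) (n r : ℕ) : Bool :=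
  (List.range (lev n)).all fun d => !decide (r / 2 ^ d % 2 = 1) || σ.any fun a => decide (d < lev a.1 ∧ a.2 % 2 ^ d = r % 2 ^ d)

def All (P : ℕ → Prop) : List ℕ → Prop
  | [] => True
  | a :: l => P a ∧ All P l
theorem All_mem {P : ℕ → Prop} {l : List ℕ} (h : All P l) {a : ℕ} (ha : a ∈ l) : P a := by
  induction l with
  | nil => cases ha
  | cons b l ih =>
    rcases List.mem_cons.1 ha with rfl | ha
    · exact h.1
    · exact ih h.2 ha

theorem branch (w : ℕ → ℕ) (σ : List (ℕ × ℕ)) (n : ℕ) (rs : List ℕ)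
    (hrs : (List.range (2 ^ lev n)).filter (canon σ n) = rs) (hd : All (fun r => Dead w (σ ++ [(n, r)])) rs) : Dead w σ := by
  have main : ∀ r ρ, ρ n % 2 ^ lev n = r → Q w ρ → agree ρ σ → False := by
    intro r
    induction r using Nat.strong_induction_on with
    | _ r ih =>
      intro ρ hr hQ ha
      have hlt : r < 2 ^ lev n := by rw [← hr]; exact Nat.mod_lt _ (by positivity)
      by_cases hcan : canon σ n r = true
      · have hmem : r ∈ rs := by
          rw [← hrs, List.mem_filter, List.mem_range]; exact ⟨hlt, hcan⟩
        refine All_mem hd hmem ρ hQ ?_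
        intro a ha'
        rcases List.mem_append.1 ha' with h | h
        · exact ha a h
        · rw [List.mem_singleton] at h
          subst h
          show ρ n % 2 ^ lev n = r % 2 ^ lev n
          rw [hr, Nat.mod_eq_of_lt hlt]
      · have : ∃ d < lev n, r / 2 ^ d % 2 = 1 ∧ ∀ a ∈ σ, d < lev a.1 → a.2 % 2 ^ d ≠ r % 2 ^ d := by
          unfold canon at hcan
          simp only [List.all_eq_true, List.mem_range, Bool.or_eq_true, Bool.not_eq_true', decide_eq_false_iff_not,
            List.any_eq_true, decide_eq_true_eq, not_forall, not_or, not_exists, not_and, not_not] at hcan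
          obtain ⟨d, hd, h1, h2⟩ := hcan
          exact ⟨d, hd, h1, h2⟩
        obtain ⟨d, hdl, hbit, hno⟩ := this
        have hl4 := lev_le n
        have hd4 : d < 4 := by omega
        have hpow : 2 ^ d ≤ r := by
          by_contra hc
          rw [Nat.div_eq_of_lt (not_le.1 hc)] at hbit
          omega
        have hq : ρ n % 2 ^ d = r % 2 ^ d := by
          rw [← hr, Nat.mod_mod_of_dvd _ (pow_dvd_pow 2 hdl.le)]
        refine ih (r - 2 ^ d) (by have : 0 < 2 ^ d := by positivity
                                  omega) (fun i => phi d (r % 2 ^ d) (ρ i)) ?_ (Q_phi hQ d _ hd4) ?_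
        · show phi d (r % 2 ^ d) (ρ n) % 2 ^ lev n = r - 2 ^ d
          unfold phi
          rw [if_pos hq]
          clear ih hno ha hQ hd hrs
          generalize ρ n = x at *
          generalize lev n = l at *
          interval_cases l <;> interval_cases d <;> simp only [Nat.reducePow, Nat.reduceSub] at * <;> omega
        · intro a haσ
          have h := ha a haσ
          show phi d (r % 2 ^ d) (ρ a.1) % 2 ^ lev a.1 = _
          rw [← h]
          have hl4' := lev_le a.1
          by_cases hda : d < lev a.1
          · have hne := hno a haσ hda
            have : ρ a.1 % 2 ^ d = a.2 % 2 ^ d := by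
              rw [← Nat.mod_mod_of_dvd (ρ a.1) (pow_dvd_pow 2 hda.le), h, Nat.mod_mod_of_dvd _ (pow_dvd_pow 2 hda.le)]
            unfold phi
            rw [if_neg (by rw [this]; exact hne)]
          · have hda : lev a.1 ≤ d := not_lt.1 hda
            unfold phi
            split_ifs
            · have h16 : 2 ^ lev a.1 ∣ 16 - 2 ^ d := Nat.dvd_sub (pow_dvd_pow 2 hl4') (pow_dvd_pow 2 hda)
              obtain ⟨c, hc⟩ := h16
              rw [hc, Nat.add_mul_mod_self_left]
            · rfl
  exact fun ρ hQ ha => main _ ρ rfl hQ ha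
end CS

set_option autoImplicit false
set_option maxRecDepth 100000
namespace CS
theorem n_0_0_0_0 (w : ℕ → ℕ) : Dead w [(20,0),(21,0),(22,0),(23,0)] :=
  branch w [(20,0),(21,0),(22,0),(23,0)] 24 [0,1,2,4] (by decide +kernel)
  ⟨leaf5 w 0 0 0 0 0 (by decide +kernel),
   leaf5 w 0 0 0 0 1 (by decide +kernel),
   leaf5 w 0 0 0 0 2 (by decide +kernel),
   leaf5 w 0 0 0 0 4 (by decide +kernel), trivial⟩
theorem n_0_0_0_1 (w : ℕ → ℕ) : Dead w [(20,0),(21,0),(22,0),(23,1)] :=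
  branch w [(20,0),(21,0),(22,0),(23,1)] 24 [0,1,2,4] (by decide +kernel)
  ⟨leaf5 w 0 0 0 1 0 (by decide +kernel),
   leaf5 w 0 0 0 1 1 (by decide +kernel),
   leaf5 w 0 0 0 1 2 (by decide +kernel),
   leaf5 w 0 0 0 1 4 (by decide +kernel), trivial⟩
theorem n_0_0_0 (w : ℕ → ℕ) : Dead w [(20,0),(21,0),(22,0)] :=
  branch w [(20,0),(21,0),(22,0)] 23 [0,1] (by decide +kernel)
  ⟨n_0_0_0_0 w,
   n_0_0_0_1 w, trivial⟩
theorem n_0_0_1_0_0_2 (w : ℕ → ℕ) : Dead w [(20,0),(21,0),(22,1),(23,0),(24,0),(11,2)] :=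
  branch w [(20,0),(21,0),(22,1),(23,0),(24,0),(11,2)] 2 [0,1,2,3,4,5] (by decide +kernel)
  ⟨leaf7 w 0 0 1 0 0 2 0 (by decide +kernel),
   leaf7 w 0 0 1 0 0 2 1 (by decide +kernel),
   leaf7 w 0 0 1 0 0 2 2 (by decide +kernel),
   leaf7 w 0 0 1 0 0 2 3 (by decide +kernel),
   leaf7 w 0 0 1 0 0 2 4 (by decide +kernel),
   leaf7 w 0 0 1 0 0 2 5 (by decide +kernel), trivial⟩
theorem n_0_0_1_0_0 (w : ℕ → ℕ) : Dead w [(20,0),(21,0),(22,1),(23,0),(24,0)] :=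
  branch w [(20,0),(21,0),(22,1),(23,0),(24,0)] 11 [0,1,2,3] (by decide +kernel)
  ⟨leaf6 w 0 0 1 0 0 0 (by decide +kernel),
   leaf6 w 0 0 1 0 0 1 (by decide +kernel),
   n_0_0_1_0_0_2 w,
   leaf6 w 0 0 1 0 0 3 (by decide +kernel), trivial⟩
theorem n_0_0_1_0_2_2 (w : ℕ → ℕ) : Dead w [(20,0),(21,0),(22,1),(23,0),(24,2),(11,2)] :=
  branch w [(20,0),(21,0),(22,1),(23,0),(24,2),(11,2)] 2 [0,1,2,3,5,6] (by decide +kernel)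
  ⟨leaf7 w 0 0 1 0 2 2 0 (by decide +kernel),
   leaf7 w 0 0 1 0 2 2 1 (by decide +kernel),
   leaf7 w 0 0 1 0 2 2 2 (by decide +kernel),
   leaf7 w 0 0 1 0 2 2 3 (by decide +kernel),
   leaf7 w 0 0 1 0 2 2 5 (by decide +kernel),
   leaf7 w 0 0 1 0 2 2 6 (by decide +kernel), trivial⟩
theorem n_0_0_1_0_2 (w : ℕ → ℕ) : Dead w [(20,0),(21,0),(22,1),(23,0),(24,2)] :=
  branch w [(20,0),(21,0),(22,1),(23,0),(24,2)] 11 [0,1,2,3] (by decide +kernel)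
  ⟨leaf6 w 0 0 1 0 2 0 (by decide +kernel),
   leaf6 w 0 0 1 0 2 1 (by decide +kernel),
   n_0_0_1_0_2_2 w,
   leaf6 w 0 0 1 0 2 3 (by decide +kernel), trivial⟩
theorem n_0_0_1_0 (w : ℕ → ℕ) : Dead w [(20,0),(21,0),(22,1),(23,0)] :=
  branch w [(20,0),(21,0),(22,1),(23,0)] 24 [0,1,2,3,5] (by decide +kernel)
  ⟨n_0_0_1_0_0 w,
   leaf5 w 0 0 1 0 1 (by decide +kernel),
   n_0_0_1_0_2 w,
   leaf5 w 0 0 1 0 3 (by decide +kernel),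
   leaf5 w 0 0 1 0 5 (by decide +kernel), trivial⟩
theorem n_0_0_1_1 (w : ℕ → ℕ) : Dead w [(20,0),(21,0),(22,1),(23,1)] :=
  branch w [(20,0),(21,0),(22,1),(23,1)] 24 [0,1,2,3,5] (by decide +kernel)
  ⟨leaf5 w 0 0 1 1 0 (by decide +kernel),
   leaf5 w 0 0 1 1 1 (by decide +kernel),
   leaf5 w 0 0 1 1 2 (by decide +kernel),
   leaf5 w 0 0 1 1 3 (by decide +kernel),
   leaf5 w 0 0 1 1 5 (by decide +kernel), trivial⟩
theorem n_0_0_1 (w : ℕ → ℕ) : Dead w [(20,0),(21,0),(22,1)] :=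
  branch w [(20,0),(21,0),(22,1)] 23 [0,1] (by decide +kernel)
  ⟨n_0_0_1_0 w,
   n_0_0_1_1 w, trivial⟩
theorem n_0_0_2_0_0_0 (w : ℕ → ℕ) : Dead w [(20,0),(21,0),(22,2),(23,0),(24,0),(11,0)] :=
  branch w [(20,0),(21,0),(22,2),(23,0),(24,0),(11,0)] 2 [0,1,2,4,6] (by decide +kernel)
  ⟨leaf7 w 0 0 2 0 0 0 0 (by decide +kernel),
   leaf7 w 0 0 2 0 0 0 1 (by decide +kernel),
   leaf7 w 0 0 2 0 0 0 2 (by decide +kernel),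
   leaf7 w 0 0 2 0 0 0 4 (by decide +kernel),
   leaf7 w 0 0 2 0 0 0 6 (by decide +kernel), trivial⟩
theorem n_0_0_2_0_0_2 (w : ℕ → ℕ) : Dead w [(20,0),(21,0),(22,2),(23,0),(24,0),(11,2)] :=
  branch w [(20,0),(21,0),(22,2),(23,0),(24,0),(11,2)] 2 [0,1,2,4,6] (by decide +kernel)
  ⟨leaf7 w 0 0 2 0 0 2 0 (by decide +kernel),
   leaf7 w 0 0 2 0 0 2 1 (by decide +kernel),
   leaf7 w 0 0 2 0 0 2 2 (by decide +kernel),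
   leaf7 w 0 0 2 0 0 2 4 (by decide +kernel),
   leaf7 w 0 0 2 0 0 2 6 (by decide +kernel), trivial⟩
theorem n_0_0_2_0_0 (w : ℕ → ℕ) : Dead w [(20,0),(21,0),(22,2),(23,0),(24,0)] :=
  branch w [(20,0),(21,0),(22,2),(23,0),(24,0)] 11 [0,1,2] (by decide +kernel)
  ⟨n_0_0_2_0_0_0 w,
   leaf6 w 0 0 2 0 0 1 (by decide +kernel),
   n_0_0_2_0_0_2 w, trivial⟩
theorem n_0_0_2_0_6_0_6 (w : ℕ → ℕ) : Dead w [(20,0),(21,0),(22,2),(23,0),(24,6),(11,0),(2,6)] :=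
  branch w [(20,0),(21,0),(22,2),(23,0),(24,6),(11,0),(2,6)] 6 [0,1,2,6] (by decide +kernel)
  ⟨leaf8 w 0 0 2 0 6 0 6 0 (by decide +kernel),
   leaf8 w 0 0 2 0 6 0 6 1 (by decide +kernel),
   leaf8 w 0 0 2 0 6 0 6 2 (by decide +kernel),
   leaf8 w 0 0 2 0 6 0 6 6 (by decide +kernel), trivial⟩
theorem n_0_0_2_0_6_0 (w : ℕ → ℕ) : Dead w [(20,0),(21,0),(22,2),(23,0),(24,6),(11,0)] :=
  branch w [(20,0),(21,0),(22,2),(23,0),(24,6),(11,0)] 2 [0,1,2,6] (by decide +kernel)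
  ⟨leaf7 w 0 0 2 0 6 0 0 (by decide +kernel),
   leaf7 w 0 0 2 0 6 0 1 (by decide +kernel),
   leaf7 w 0 0 2 0 6 0 2 (by decide +kernel),
   n_0_0_2_0_6_0_6 w, trivial⟩
theorem n_0_0_2_0_6 (w : ℕ → ℕ) : Dead w [(20,0),(21,0),(22,2),(23,0),(24,6)] :=
  branch w [(20,0),(21,0),(22,2),(23,0),(24,6)] 11 [0,1,2] (by decide +kernel)
  ⟨n_0_0_2_0_6_0 w,
   leaf6 w 0 0 2 0 6 1 (by decide +kernel),
   leaf6 w 0 0 2 0 6 2 (by decide +kernel), trivial⟩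
theorem n_0_0_2_0 (w : ℕ → ℕ) : Dead w [(20,0),(21,0),(22,2),(23,0)] :=
  branch w [(20,0),(21,0),(22,2),(23,0)] 24 [0,1,2,6] (by decide +kernel)
  ⟨n_0_0_2_0_0 w,
   leaf5 w 0 0 2 0 1 (by decide +kernel),
   leaf5 w 0 0 2 0 2 (by decide +kernel),
   n_0_0_2_0_6 w, trivial⟩
theorem n_0_0_2_1 (w : ℕ → ℕ) : Dead w [(20,0),(21,0),(22,2),(23,1)] :=
  branch w [(20,0),(21,0),(22,2),(23,1)] 24 [0,1,2,6] (by decide +kernel)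
  ⟨leaf5 w 0 0 2 1 0 (by decide +kernel),
   leaf5 w 0 0 2 1 1 (by decide +kernel),
   leaf5 w 0 0 2 1 2 (by decide +kernel),
   leaf5 w 0 0 2 1 6 (by decide +kernel), trivial⟩
theorem n_0_0_2 (w : ℕ → ℕ) : Dead w [(20,0),(21,0),(22,2)] :=
  branch w [(20,0),(21,0),(22,2)] 23 [0,1] (by decide +kernel)
  ⟨n_0_0_2_0 w,
   n_0_0_2_1 w, trivial⟩
theorem n_0_0 (w : ℕ → ℕ) : Dead w [(20,0),(21,0)] :=
  branch w [(20,0),(21,0)] 22 [0,1,2] (by decide +kernel)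
  ⟨n_0_0_0 w,
   n_0_0_1 w,
   n_0_0_2 w, trivial⟩
theorem n_0_1_0_0 (w : ℕ → ℕ) : Dead w [(20,0),(21,1),(22,0),(23,0)] :=
  branch w [(20,0),(21,1),(22,0),(23,0)] 24 [0,1,2,3,4] (by decide +kernel)
  ⟨leaf5 w 0 1 0 0 0 (by decide +kernel),
   leaf5 w 0 1 0 0 1 (by decide +kernel),
   leaf5 w 0 1 0 0 2 (by decide +kernel),
   leaf5 w 0 1 0 0 3 (by decide +kernel),
   leaf5 w 0 1 0 0 4 (by decide +kernel), trivial⟩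
theorem n_0_1_0_1 (w : ℕ → ℕ) : Dead w [(20,0),(21,1),(22,0),(23,1)] :=
  branch w [(20,0),(21,1),(22,0),(23,1)] 24 [0,1,2,3,4] (by decide +kernel)
  ⟨leaf5 w 0 1 0 1 0 (by decide +kernel),
   leaf5 w 0 1 0 1 1 (by decide +kernel),
   leaf5 w 0 1 0 1 2 (by decide +kernel),
   leaf5 w 0 1 0 1 3 (by decide +kernel),
   leaf5 w 0 1 0 1 4 (by decide +kernel), trivial⟩
theorem n_0_1_0 (w : ℕ → ℕ) : Dead w [(20,0),(21,1),(22,0)] :=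
  branch w [(20,0),(21,1),(22,0)] 23 [0,1] (by decide +kernel)
  ⟨n_0_1_0_0 w,
   n_0_1_0_1 w, trivial⟩
theorem n_0_1_1_0 (w : ℕ → ℕ) : Dead w [(20,0),(21,1),(22,1),(23,0)] :=
  branch w [(20,0),(21,1),(22,1),(23,0)] 24 [0,1,3,5] (by decide +kernel)
  ⟨leaf5 w 0 1 1 0 0 (by decide +kernel),
   leaf5 w 0 1 1 0 1 (by decide +kernel),
   leaf5 w 0 1 1 0 3 (by decide +kernel),
   leaf5 w 0 1 1 0 5 (by decide +kernel), trivial⟩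
theorem n_0_1_1_1 (w : ℕ → ℕ) : Dead w [(20,0),(21,1),(22,1),(23,1)] :=
  branch w [(20,0),(21,1),(22,1),(23,1)] 24 [0,1,3,5] (by decide +kernel)
  ⟨leaf5 w 0 1 1 1 0 (by decide +kernel),
   leaf5 w 0 1 1 1 1 (by decide +kernel),
   leaf5 w 0 1 1 1 3 (by decide +kernel),
   leaf5 w 0 1 1 1 5 (by decide +kernel), trivial⟩
theorem n_0_1_1 (w : ℕ → ℕ) : Dead w [(20,0),(21,1),(22,1)] :=
  branch w [(20,0),(21,1),(22,1)] 23 [0,1] (by decide +kernel)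
  ⟨n_0_1_1_0 w,
   n_0_1_1_1 w, trivial⟩
theorem n_0_1_3_0 (w : ℕ → ℕ) : Dead w [(20,0),(21,1),(22,3),(23,0)] :=
  branch w [(20,0),(21,1),(22,3),(23,0)] 24 [0,1,3,7] (by decide +kernel)
  ⟨leaf5 w 0 1 3 0 0 (by decide +kernel),
   leaf5 w 0 1 3 0 1 (by decide +kernel),
   leaf5 w 0 1 3 0 3 (by decide +kernel),
   leaf5 w 0 1 3 0 7 (by decide +kernel), trivial⟩
theorem n_0_1_3_1 (w : ℕ → ℕ) : Dead w [(20,0),(21,1),(22,3),(23,1)] :=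
  branch w [(20,0),(21,1),(22,3),(23,1)] 24 [0,1,3,7] (by decide +kernel)
  ⟨leaf5 w 0 1 3 1 0 (by decide +kernel),
   leaf5 w 0 1 3 1 1 (by decide +kernel),
   leaf5 w 0 1 3 1 3 (by decide +kernel),
   leaf5 w 0 1 3 1 7 (by decide +kernel), trivial⟩
theorem n_0_1_3 (w : ℕ → ℕ) : Dead w [(20,0),(21,1),(22,3)] :=
  branch w [(20,0),(21,1),(22,3)] 23 [0,1] (by decide +kernel)
  ⟨n_0_1_3_0 w,
   n_0_1_3_1 w, trivial⟩
theorem n_0_1 (w : ℕ → ℕ) : Dead w [(20,0),(21,1)] :=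
  branch w [(20,0),(21,1)] 22 [0,1,3] (by decide +kernel)
  ⟨n_0_1_0 w,
   n_0_1_1 w,
   n_0_1_3 w, trivial⟩
theorem n_0 (w : ℕ → ℕ) : Dead w [(20,0)] :=
  branch w [(20,0)] 21 [0,1] (by decide +kernel)
  ⟨n_0_0 w,
   n_0_1 w, trivial⟩
theorem root (w : ℕ → ℕ) : Dead w [] :=
  branch w [] 20 [0] (by decide +kernel)
  ⟨n_0 w, trivial⟩
end CS

set_option autoImplicit false
namespace CS

def Covers (T : Finset ℕ) (a : ℕ → ℕ) : Prop := ∀ x : ℕ, ∃ n ∈ T, x % n = a n % n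

theorem drop {T T1 T2 : Finset ℕ} {a : ℕ → ℕ} (h : Covers T a) (N p : ℕ) (hT : ∀ n ∈ T, n ∈ T1 ∨ n ∈ T2)
    (h1 : ∀ n ∈ T1, n ∣ N) (h2 : ∀ n ∈ T2, ∀ d < p, 0 < d → ¬ n ∣ d * N) (hp : T2.card < p) : Covers T1 a := by
  intro x
  by_contra hx
  push Not at hx
  have hj : ∀ j : ℕ, ∃ n ∈ T2, (x + j * N) % n = a n % n := by
    intro j
    obtain ⟨n, hn, he⟩ := h (x + j * N)
    rcases hT n hn with h' | h'
    · exfalso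
      obtain ⟨c, hc⟩ := h1 n h'
      apply hx n h'
      rw [← he, hc, show x + j * (n * c) = x + n * (j * c) by ring, Nat.add_mul_mod_self_left]
    · exact ⟨n, h', he⟩
  choose f hf he using hj
  obtain ⟨i, hi, j, hjj, hij, hfe⟩ := Finset.exists_ne_map_eq_of_card_lt_of_maps_to (s := Finset.range p) (t := T2)
    (by rw [Finset.card_range]; exact hp) (f := f) (fun i _ => hf i)
  have main : ∀ i j, i < j → j < p → f i = f j → False := by
    intro i j hij hj hfe
    have e1 := he i
    have e2 := he j
    rw [← hfe] at e2
    have e3 : (x + i * N) ≡ (x + j * N) [MOD f i] := e1.trans e2.symm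
    have e4 := (Nat.modEq_iff_dvd' (by have := Nat.mul_le_mul_right N hij.le; omega)).1 e3
    refine h2 (f i) (hf i) (j - i) (by omega) (by omega) ?_
    rw [Nat.sub_mul]
    rwa [Nat.add_sub_add_left] at e4
  rw [Finset.mem_range] at hi hjj
  rcases lt_or_gt_of_ne hij with h' | h'
  · exact main i j h' hjj hfe
  · exact main j i h' hi hfe.symm

theorem dropP {T : Finset ℕ} {a : ℕ → ℕ} (h : Covers T a) (p : ℕ) (hp : p.Prime)
    (hc : (T.filter (fun n => p ∣ n)).card < p) : Covers (T.filter (fun n => ¬ p ∣ n)) a := by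
  refine drop (T2 := T.filter (fun n => p ∣ n)) h (∏ n ∈ T.filter (fun n => ¬ p ∣ n), n) p ?_ ?_ ?_ hc
  · intro n hn
    simp only [Finset.mem_filter]
    tauto
  · intro n hn
    exact Finset.dvd_prod_of_mem _ hn
  · intro n hn d hd hd0 hdvd
    have hpd := (Finset.mem_filter.1 hn).2.trans hdvd
    rcases (Nat.Prime.dvd_mul hp).1 hpd with h' | h'
    · exact absurd (Nat.le_of_dvd hd0 h') (not_le.2 hd)
    · obtain ⟨m, hm, hm'⟩ := (Prime.dvd_finsetProd_iff hp.prime _).1 h'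
      exact (Finset.mem_filter.1 hm).2 hm'

theorem Covers.mono {T T' : Finset ℕ} {a : ℕ → ℕ} (h : Covers T a) (hs : T ⊆ T') : Covers T' a := fun x => by
  obtain ⟨n, hn, he⟩ := h x
  exact ⟨n, hs hn, he⟩

def T0 : Finset ℕ := {5,6,7,8,9,10,12,14,15,16,18,20,21,24,28,30,35,36,40,42,45,48,56,60,63,70,72,80,84,90,105}

theorem smooth {a : ℕ → ℕ} (h : Covers (Finset.Icc 5 107) a) :
    Covers (T0 ∪ {25,50,75,100,49,98,27,54,81,64,32,96}) a := by
  replace h := dropP h 107 (by norm_num) (by decide +kernel)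
  replace h := dropP h 103 (by norm_num) (by decide +kernel)
  replace h := dropP h 101 (by norm_num) (by decide +kernel)
  replace h := dropP h 97 (by norm_num) (by decide +kernel)
  replace h := dropP h 89 (by norm_num) (by decide +kernel)
  replace h := dropP h 83 (by norm_num) (by decide +kernel)
  replace h := dropP h 79 (by norm_num) (by decide +kernel)
  replace h := dropP h 73 (by norm_num) (by decide +kernel)
  replace h := dropP h 71 (by norm_num) (by decide +kernel)
  replace h := dropP h 67 (by norm_num) (by decide +kernel)
  replace h := dropP h 61 (by norm_num) (by decide +kernel)
  replace h := dropP h 59 (by norm_num) (by decide +kernel)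
  replace h := dropP h 53 (by norm_num) (by decide +kernel)
  replace h := dropP h 47 (by norm_num) (by decide +kernel)
  replace h := dropP h 43 (by norm_num) (by decide +kernel)
  replace h := dropP h 41 (by norm_num) (by decide +kernel)
  replace h := dropP h 37 (by norm_num) (by decide +kernel)
  replace h := dropP h 31 (by norm_num) (by decide +kernel)
  replace h := dropP h 29 (by norm_num) (by decide +kernel)
  replace h := dropP h 23 (by norm_num) (by decide +kernel)
  replace h := dropP h 19 (by norm_num) (by decide +kernel)
  replace h := dropP h 17 (by norm_num) (by decide +kernel)
  replace h := dropP h 13 (by norm_num) (by decide +kernel)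
  replace h := dropP h 11 (by norm_num) (by decide +kernel)
  exact h.mono (by decide +kernel)

theorem reduce {a : ℕ → ℕ} (h : Covers (Finset.Icc 5 107) a) :
    ∀ x : ℕ, (∃ n ∈ T0, x % n = a n % n) ∨ x % 48 = a 96 % 48 := by
  replace h := smooth h
  replace h := drop (T1 := T0 ∪ {25,50,75,100,27,54,81,64,32,96}) (T2 := {49, 98}) h (2 ^ 6 * 3 ^ 4 * 5 ^ 2 * 7) 7
    (by decide +kernel) (by decide +kernel) (by decide +kernel) (by decide +kernel)
  replace h := drop (T1 := T0 ∪ {27,54,81,64,32,96}) (T2 := {25,50,75,100}) h (2 ^ 6 * 3 ^ 4 * 5 * 7) 5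
    (by decide +kernel) (by decide +kernel) (by decide +kernel) (by decide +kernel)
  replace h := drop (T1 := T0 ∪ {27,54,64,32,96}) (T2 := {81}) h (2 ^ 6 * 3 ^ 3 * 5 * 7) 3
    (by decide +kernel) (by decide +kernel) (by decide +kernel) (by decide +kernel)
  replace h := drop (T1 := T0 ∪ {64,32,96}) (T2 := {27, 54}) h (2 ^ 6 * 3 ^ 2 * 5 * 7) 3
    (by decide +kernel) (by decide +kernel) (by decide +kernel) (by decide +kernel)
  replace h := drop (T1 := T0 ∪ {32,96}) (T2 := {64}) h (2 ^ 5 * 3 ^ 2 * 5 * 7) 2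
    (by decide +kernel) (by decide +kernel) (by decide +kernel) (by decide +kernel)
  intro x
  by_cases hx : ∃ n ∈ T0, x % n = a n % n
  · exact Or.inl hx
  right
  have hd : ∀ n ∈ T0, n ∣ 5040 := by decide +kernel
  obtain ⟨n, hn, he⟩ := h x
  obtain ⟨m, hm, he'⟩ := h (x + 5040)
  have hn' : n = 32 ∨ n = 96 := by
    rcases Finset.mem_union.1 hn with h' | h'
    · exact absurd ⟨n, h', he⟩ hx
    · simpa using h'
  have hm' : m = 32 ∨ m = 96 := by
    rcases Finset.mem_union.1 hm with h' | h'
    · refine absurd ⟨m, h', ?_⟩ hx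
      obtain ⟨c, hc⟩ := hd m h'
      rw [hc, Nat.add_mul_mod_self_left] at he'
      exact he'
    · simpa using h'
  rcases hn' with rfl | rfl <;> rcases hm' with rfl | rfl <;> omega

/-- modulus of each item -/
def modu : ℕ → ℕ
  | 0 => 48
  | 1 => 96
  | 2 => 16
  | 3 => 80
  | 4 => 24
  | 5 => 72
  | 6 => 56
  | 7 => 12
  | 8 => 36
  | 9 => 60
  | 10 => 84
  | 11 => 28
  | 12 => 6
  | 13 => 18
  | 14 => 30
  | 15 => 90
  | 16 => 42
  | 17 => 15
  | 18 => 21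
  | 19 => 105
  | 20 => 10
  | 21 => 20
  | 22 => 8
  | 23 => 14
  | 24 => 40
  | 25 => 45
  | 26 => 63
  | 27 => 9
  | _ => 1

theorem on_sh {b : ℕ → ℕ} {t y i : ℕ} (hi : i ∈ SH) (h : y % 2 ^ lev i = b i % 2 ^ lev i) : on b b t y i :=
  ⟨Or.inl hi, h⟩
theorem on_spec {b : ℕ → ℕ} {t y i : ℕ} (hi : i ∈ SPEC) (h3 : b i % 3 = t % 3) (h : y % 2 ^ lev i = b i % 2 ^ lev i) :
    on b b t y i := ⟨Or.inr (Or.inl ⟨hi, h3⟩), h⟩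
theorem on_nine {b : ℕ → ℕ} {t y i : ℕ} (hi : i ∈ NINE) (h9 : b i % 9 = t % 9) (h : y % 2 ^ lev i = b i % 2 ^ lev i) :
    on b b t y i := ⟨Or.inr (Or.inr ⟨hi, h9⟩), h⟩

open Classical in
theorem card_filter_nb (f : ℕ → Prop) (s : Finset ℕ) : (s.filter f).card = ∑ i ∈ s, nb (f i) := by
  rw [Finset.card_filter]
  apply Finset.sum_congr rfl
  intro i _
  unfold nb
  rfl

def CI : Finset ℕ := {20,21,24,3,14,9,15,17,25}
def DI : Finset ℕ := {23,11,6,16,10,18,26}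

theorem nb_imp_pos {f : ℕ → Prop} (i : ℕ) (h : f i) (hi : i ∈ [0,1,2,4,5,7,8,12,13,22]) : 0 < nA f := by
  have h1 := nb_true h
  unfold nA
  simp only [List.mem_cons, List.not_mem_nil, or_false] at hi
  rcases hi with rfl | rfl | rfl | rfl | rfl | rfl | rfl | rfl | rfl | rfl <;> omega

open Classical in
theorem Q_of_cover {a : ℕ → ℕ} (h : ∀ x : ℕ, (∃ n ∈ T0, x % n = a n % n) ∨ x % 48 = a 96 % 48) :
    Q (fun i => a (modu i)) (fun i => a (modu i)) := by
  intro t ht y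
  set b : ℕ → ℕ := fun i => a (modu i) with hb
  by_cases h27 : on b b t y 27
  · exact Or.inl h27
  by_cases hA : 0 < nA (on b b t y)
  · exact Or.inr (Or.inl hA)
  right; right
  set f := on b b t y with hf
  have nA' : ∀ i, f i → i ∈ [0,1,2,4,5,7,8,12,13,22] → False := fun i hi hm => hA (nb_imp_pos i hi hm)
  set Cs : Finset ℕ := insert (a 5 % 5) ((CI.filter f).image (fun i => b i % 5)) with hCs
  set Ds : Finset ℕ := insert (a 7 % 7) ((DI.filter f).image (fun i => b i % 7)) with hDs
  set Es : Finset (ℕ × ℕ) := insert (a 35 % 5, a 35 % 7) (insert (a 70 % 5, a 70 % 7)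
    (if f 19 then {(a 105 % 5, a 105 % 7)} else ∅)) with hEs
  have cC : Cs.card ≤ 1 + (nC f + nb (f 17) + nb (f 25)) := by
    have h1 : Cs.card ≤ _ := Finset.card_insert_le _ _
    have h2 : ((CI.filter f).image (fun i => b i % 5)).card ≤ _ := Finset.card_image_le
    rw [card_filter_nb] at h2
    have h3 : ∑ i ∈ CI, nb (f i) = nC f + nb (f 17) + nb (f 25) := by
      unfold CI nC
      simp [Finset.sum_insert]
      ring
    omega
  have cD : Ds.card ≤ 1 + (nD f + nb (f 18) + nb (f 26)) := by
    have h1 : Ds.card ≤ _ := Finset.card_insert_le _ _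
    have h2 : ((DI.filter f).image (fun i => b i % 7)).card ≤ _ := Finset.card_image_le
    rw [card_filter_nb] at h2
    have h3 : ∑ i ∈ DI, nb (f i) = nD f + nb (f 18) + nb (f 26) := by
      unfold DI nD
      simp [Finset.sum_insert]
      ring
    omega
  have cE : Es.card ≤ 2 + nb (f 19) := by
    have h1 : Es.card ≤ _ := Finset.card_insert_le _ _
    have h2 := Finset.card_insert_le (a 70 % 5, a 70 % 7) (if f 19 then ({(a 105 % 5, a 105 % 7)} : Finset (ℕ × ℕ)) else ∅)
    have h3 : (if f 19 then ({(a 105 % 5, a 105 % 7)} : Finset (ℕ × ℕ)) else ∅).card = nb (f 19) := by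
      by_cases h19 : f 19
      · rw [if_pos h19, nb_true h19]; rfl
      · rw [if_neg h19, nb_false h19]; rfl
    omega
  have hsub : (Finset.range 5 \ Cs) ×ˢ (Finset.range 7 \ Ds) ⊆ Es := by
    rintro ⟨c, r⟩ hcr
    rw [Finset.mem_product, Finset.mem_sdiff, Finset.mem_sdiff, Finset.mem_range, Finset.mem_range] at hcr
    obtain ⟨⟨hc5, hcC⟩, hr7, hrD⟩ := hcr
    simp only at hc5 hcC hr7 hrD
    have kC : ∀ i, i ∈ CI → f i → c = b i % 5 → False := by
      intro i hi hfi he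
      apply hcC
      rw [hCs, Finset.mem_insert]
      right
      exact Finset.mem_image.2 ⟨i, Finset.mem_filter.2 ⟨hi, hfi⟩, he.symm⟩
    have kD : ∀ i, i ∈ DI → f i → r = b i % 7 → False := by
      intro i hi hfi he
      apply hrD
      rw [hDs, Finset.mem_insert]
      right
      exact Finset.mem_image.2 ⟨i, Finset.mem_filter.2 ⟨hi, hfi⟩, he.symm⟩
    have k5 : c ≠ a 5 % 5 := fun he => hcC (by rw [hCs, he]; exact Finset.mem_insert_self _ _)
    have k7 : r ≠ a 7 % 7 := fun he => hrD (by rw [hDs, he]; exact Finset.mem_insert_self _ _)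
    obtain ⟨X, x16, x9, x5, x7⟩ : ∃ X : ℕ, X % 16 = y % 16 ∧ X % 9 = t % 9 ∧ X % 5 = c ∧ X % 7 = r :=
      ⟨3745 * (81 * y + 64 * t) + 2016 * c + 4320 * r, by omega, by omega, by omega, by omega⟩
    have hE : ∀ n, (n = 35 ∨ n = 70 ∨ (n = 105 ∧ f 19)) → c = a n % 5 → r = a n % 7 → (c, r) ∈ Es := by
      intro n hn h5 h7
      rw [h5, h7, hEs]
      rcases hn with rfl | rfl | ⟨rfl, h19⟩
      · exact Finset.mem_insert_self _ _
      · exact Finset.mem_insert_of_mem (Finset.mem_insert_self _ _)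
      · rw [if_pos h19]
        exact Finset.mem_insert_of_mem (Finset.mem_insert_of_mem (Finset.mem_singleton_self _))
    rcases h X with ⟨n, hn, he⟩ | he
    · unfold T0 at hn
      simp only [Finset.mem_insert, Finset.mem_singleton] at hn
      clear cC cD cE
      clear_value Cs Ds Es
      rcases hn with rfl | rfl | rfl | rfl | rfl | rfl | rfl | rfl | rfl | rfl | rfl | rfl | rfl | rfl | rfl | rfl | rfl | rfl | rfl | rfl | rfl | rfl | rfl | rfl | rfl | rfl | rfl | rfl | rfl | rfl | rfl
      · exact absurd (by omega) k5
      · exact (nA' 12 (on_spec (i := 12) (by decide) (show a 6 % 3 = t % 3 by omega) (show y % 2 ^ 1 = a 6 % 2 ^ 1 by omega)) (by decide)).elim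
      · exact absurd (by omega) k7
      · exact (nA' 22 (on_sh (i := 22) (by decide) (show y % 2 ^ 3 = a 8 % 2 ^ 3 by omega)) (by decide)).elim
      · exact absurd (on_nine (i := 27) (by decide) (show a 9 % 9 = t % 9 by omega) (show y % 2 ^ 0 = a 9 % 2 ^ 0 by omega)) h27
      · exact (kC 20 (by decide) (on_sh (i := 20) (by decide) (show y % 2 ^ 1 = a 10 % 2 ^ 1 by omega)) (show c = a 10 % 5 by omega)).elim
      · exact (nA' 7 (on_spec (i := 7) (by decide) (show a 12 % 3 = t % 3 by omega) (show y % 2 ^ 2 = a 12 % 2 ^ 2 by omega)) (by decide)).elim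
      · exact (kD 23 (by decide) (on_sh (i := 23) (by decide) (show y % 2 ^ 1 = a 14 % 2 ^ 1 by omega)) (show r = a 14 % 7 by omega)).elim
      · exact (kC 17 (by decide) (on_spec (i := 17) (by decide) (show a 15 % 3 = t % 3 by omega) (show y % 2 ^ 0 = a 15 % 2 ^ 0 by omega)) (show c = a 15 % 5 by omega)).elim
      · exact (nA' 2 (on_sh (i := 2) (by decide) (show y % 2 ^ 4 = a 16 % 2 ^ 4 by omega)) (by decide)).elim
      · exact (nA' 13 (on_nine (i := 13) (by decide) (show a 18 % 9 = t % 9 by omega) (show y % 2 ^ 1 = a 18 % 2 ^ 1 by omega)) (by decide)).elim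
      · exact (kC 21 (by decide) (on_sh (i := 21) (by decide) (show y % 2 ^ 2 = a 20 % 2 ^ 2 by omega)) (show c = a 20 % 5 by omega)).elim
      · exact (kD 18 (by decide) (on_spec (i := 18) (by decide) (show a 21 % 3 = t % 3 by omega) (show y % 2 ^ 0 = a 21 % 2 ^ 0 by omega)) (show r = a 21 % 7 by omega)).elim
      · exact (nA' 4 (on_spec (i := 4) (by decide) (show a 24 % 3 = t % 3 by omega) (show y % 2 ^ 3 = a 24 % 2 ^ 3 by omega)) (by decide)).elim
      · exact (kD 11 (by decide) (on_sh (i := 11) (by decide) (show y % 2 ^ 2 = a 28 % 2 ^ 2 by omega)) (show r = a 28 % 7 by omega)).elim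
      · exact (kC 14 (by decide) (on_spec (i := 14) (by decide) (show a 30 % 3 = t % 3 by omega) (show y % 2 ^ 1 = a 30 % 2 ^ 1 by omega)) (show c = a 30 % 5 by omega)).elim
      · exact hE 35 (by omega) (by omega) (by omega)
      · exact (nA' 8 (on_nine (i := 8) (by decide) (show a 36 % 9 = t % 9 by omega) (show y % 2 ^ 2 = a 36 % 2 ^ 2 by omega)) (by decide)).elim
      · exact (kC 24 (by decide) (on_sh (i := 24) (by decide) (show y % 2 ^ 3 = a 40 % 2 ^ 3 by omega)) (show c = a 40 % 5 by omega)).elim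
      · exact (kD 16 (by decide) (on_spec (i := 16) (by decide) (show a 42 % 3 = t % 3 by omega) (show y % 2 ^ 1 = a 42 % 2 ^ 1 by omega)) (show r = a 42 % 7 by omega)).elim
      · exact (kC 25 (by decide) (on_nine (i := 25) (by decide) (show a 45 % 9 = t % 9 by omega) (show y % 2 ^ 0 = a 45 % 2 ^ 0 by omega)) (show c = a 45 % 5 by omega)).elim
      · exact (nA' 0 (on_spec (i := 0) (by decide) (show a 48 % 3 = t % 3 by omega) (show y % 2 ^ 4 = a 48 % 2 ^ 4 by omega)) (by decide)).elim
      · exact (kD 6 (by decide) (on_sh (i := 6) (by decide) (show y % 2 ^ 3 = a 56 % 2 ^ 3 by omega)) (show r = a 56 % 7 by omega)).elim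
      · exact (kC 9 (by decide) (on_spec (i := 9) (by decide) (show a 60 % 3 = t % 3 by omega) (show y % 2 ^ 2 = a 60 % 2 ^ 2 by omega)) (show c = a 60 % 5 by omega)).elim
      · exact (kD 26 (by decide) (on_nine (i := 26) (by decide) (show a 63 % 9 = t % 9 by omega) (show y % 2 ^ 0 = a 63 % 2 ^ 0 by omega)) (show r = a 63 % 7 by omega)).elim
      · exact hE 70 (by omega) (by omega) (by omega)
      · exact (nA' 5 (on_nine (i := 5) (by decide) (show a 72 % 9 = t % 9 by omega) (show y % 2 ^ 3 = a 72 % 2 ^ 3 by omega)) (by decide)).elim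
      · exact (kC 3 (by decide) (on_sh (i := 3) (by decide) (show y % 2 ^ 4 = a 80 % 2 ^ 4 by omega)) (show c = a 80 % 5 by omega)).elim
      · exact (kD 10 (by decide) (on_spec (i := 10) (by decide) (show a 84 % 3 = t % 3 by omega) (show y % 2 ^ 2 = a 84 % 2 ^ 2 by omega)) (show r = a 84 % 7 by omega)).elim
      · exact (kC 15 (by decide) (on_nine (i := 15) (by decide) (show a 90 % 9 = t % 9 by omega) (show y % 2 ^ 1 = a 90 % 2 ^ 1 by omega)) (show c = a 90 % 5 by omega)).elim
      · exact hE 105 (Or.inr (Or.inr ⟨rfl, on_spec (i := 19) (by decide) (show a 105 % 3 = t % 3 by omega) (show y % 2 ^ 0 = a 105 % 2 ^ 0 by omega)⟩)) (by omega) (by omega)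
    · exact (nA' 1 (on_spec (i := 1) (by decide) (show a 96 % 3 = t % 3 by omega) (show y % 2 ^ 4 = a 96 % 2 ^ 4 by omega)) (by decide)).elim
  have hcard := Finset.card_le_card hsub
  rw [Finset.card_product] at hcard
  have g1 := Finset.le_card_sdiff Cs (Finset.range 5)
  have g2 := Finset.le_card_sdiff Ds (Finset.range 7)
  rw [Finset.card_range] at g1 g2
  unfold ok
  right; right
  exact le_trans (le_trans (Nat.mul_le_mul (by omega) (by omega)) hcard) cE

theorem no_cover {a : ℕ → ℕ} (h : Covers (Finset.Icc 5 107) a) : False :=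
  root _ _ (Q_of_cover (reduce h)) (fun x hx => absurd hx (by simp))

end CS

/-- If a distinct covering system has least modulus equal to `5`, then its largest
modulus is at least `108`. -/
theorem min_modulus_five_implies_max_ge_108 (C : Finset (ℤ × ℕ))
    (hC : IsDistinctCoveringSystem C)
    (hmin : ∀ c ∈ C, 5 ≤ c.2) (h5 : ∃ c ∈ C, c.2 = 5) :
    ∃ c ∈ C, 108 ≤ c.2 := by
  by_contra hcon
  push Not at hcon
  obtain ⟨⟨_, hcov⟩, _, hdist⟩ := hC
  classical
  let a : ℕ → ℕ := fun n => if hz : ∃ z : ℤ, (z, n) ∈ C then (hz.choose % (n : ℤ)).toNat else 0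
  apply CS.no_cover (a := a)
  intro x
  obtain ⟨⟨z, n⟩, hc, he⟩ := hcov (x : ℤ)
  have hn5 : 5 ≤ n := hmin _ hc
  have hn108 : n < 108 := hcon _ hc
  refine ⟨n, Finset.mem_Icc.2 ⟨hn5, by omega⟩, ?_⟩
  have hz : ∃ z : ℤ, (z, n) ∈ C := ⟨z, hc⟩
  have huniq : hz.choose = z := by
    by_contra hne
    exact hdist _ hz.choose_spec _ hc (fun h => hne (Prod.ext_iff.1 h).1) rfl
  have ha : a n = (z % (n : ℤ)).toNat := by
    change (if hz : ∃ z : ℤ, (z, n) ∈ C then (hz.choose % (n : ℤ)).toNat else 0) = _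
    rw [dif_pos hz, huniq]
  have he2 : (x : ℤ) % (n : ℤ) = z % (n : ℤ) := he
  rw [ha, ← he2, ← Int.natCast_mod, Int.toNat_natCast, Nat.mod_mod]
end
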